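/- Let g be an infinite game on a countable pruned tree T over a countable set Σ, with two players a and b, outcomes {y, x_1, …, x_n} for some n ≥ 0, and strict linear preferences y <_a x_n <_a ⋯ <_a x_1 and y <_b x_1 <_b ⋯ <_b x_n. Suppose that for each i the set of plays with outcome x_i is a Borel subset of [T], and that the set Y of plays with outcome y is a quasi-difference set, i.e. Y ∈ 𝒟([T]). Then g has a global-Pareto subgame perfect equilibrium. -/

import Mathlib

/-! Basic setup: trees of finite sequences, their branches, the topology on the set of
branches, the Hausdorff difference hierarchy, quasi-difference sets, and infinite
games in extensive form. -/

/-- `T` is a tree over `α`: a set of finite sequences closed under taking prefixes. -/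
def IsTree {α : Type*} (T : Set (List α)) : Prop :=
  ∀ ⦃γ δ : List α⦄, γ <+: δ → δ ∈ T → γ ∈ T

/-- `succ(T, γ)`: the nodes of `T` extending `γ` and of length `|γ| + 1`. -/
def treeSucc {α : Type*} (T : Set (List α)) (γ : List α) : Set (List α) :=
  {δ | δ ∈ T ∧ γ <+: δ ∧ δ.length = γ.length + 1}

/-- `T` is pruned if every node has a successor. -/
def IsPruned {α : Type*} (T : Set (List α)) : Prop :=
  ∀ γ ∈ T, (treeSucc T γ).Nonempty

/-- The finite prefix of length `n` of an infinite sequence `p`. -/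
def playPrefix {α : Type*} (p : ℕ → α) (n : ℕ) : List α :=
  List.ofFn fun i : Fin n => p i

/-- `[T]`: the infinite sequences all of whose finite prefixes lie in `T`. -/
def Body {α : Type*} (T : Set (List α)) : Set (ℕ → α) :=
  {p | ∀ n : ℕ, playPrefix p n ∈ T}

/-- `γ[T_γ]`: the elements of `[T]` extending the node `γ`. -/
def cylinder {α : Type*} (T : Set (List α)) (γ : List α) : Set (ℕ → α) :=
  {p | p ∈ Body T ∧ playPrefix p γ.length = γ}

/-- Open subsets of `[T]`: the unions of basic sets `γ[T_γ]`, `γ ∈ T`. -/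
def IsOpenIn {α : Type*} (T : Set (List α)) (A : Set (ℕ → α)) : Prop :=
  ∃ S ⊆ T, A = ⋃ γ ∈ S, cylinder T γ

/-- Closed subsets of `[T]`: complements in `[T]` of open subsets of `[T]`. -/
def IsClosedIn {α : Type*} (T : Set (List α)) (A : Set (ℕ → α)) : Prop :=
  A ⊆ Body T ∧ IsOpenIn T (Body T \ A)

/-- Borel subsets of `[T]`: members of the σ-algebra generated by the open
subsets of `[T]` that are themselves included in `[T]`. -/
def IsBorelIn {α : Type*} (T : Set (List α)) (X : Set (ℕ → α)) : Prop :=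
  X ⊆ Body T ∧
    @MeasurableSet (ℕ → α) (MeasurableSpace.generateFrom {A | IsOpenIn T A}) X

/-- `D_θ((A_η)_{η<θ})`: the set of `x ∈ ⋃_{η<θ} A_η` such that the least `η < θ`
with `x ∈ A_η` has parity opposite to that of `θ`. -/
noncomputable def Dset {α : Type*} (θ : Ordinal.{0}) (A : Ordinal.{0} → Set (ℕ → α)) :
    Set (ℕ → α) :=
  {x | (∃ η < θ, x ∈ A η) ∧ sInf {η | η < θ ∧ x ∈ A η} % 2 ≠ θ % 2}

/-- `D_θ([T])`: all sets of the form `D_θ((A_η)_{η<θ})` for an `⊆`-increasing family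
of open subsets of `[T]`. -/
def Dclass {α : Type*} (T : Set (List α)) (θ : Ordinal.{0}) : Set (Set (ℕ → α)) :=
  {X | ∃ A : Ordinal.{0} → Set (ℕ → α),
        (∀ η < θ, IsOpenIn T (A η)) ∧
        (∀ η₁ η₂, η₁ ≤ η₂ → η₂ < θ → A η₁ ⊆ A η₂) ∧
        X = Dset θ A}

/-- The quasi-difference sets `𝒟([T])`: open sets, unions of quasi-difference sets
placed below pairwise `⊑`-incomparable nodes, and complements in `[T]`. -/
inductive QuasiDiff {α : Type*} (T : Set (List α)) : Set (ℕ → α) → Prop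
  | isOpen : ∀ A, IsOpenIn T A → QuasiDiff T A
  | iUnion : ∀ (S : Set (List α)) (D : List α → Set (ℕ → α)),
      S ⊆ T → (S.Pairwise fun γ δ => ¬ γ <+: δ) →
      (∀ γ ∈ S, QuasiDiff T (D γ)) →
      (∀ γ ∈ S, D γ ⊆ cylinder T γ) →
      QuasiDiff T (⋃ γ ∈ S, D γ)
  | compl : ∀ A, QuasiDiff T A → QuasiDiff T (Body T \ A)

/-- An infinite game in extensive form: a tree `T` of finite plays, an owner function `d`,
an outcome function `v` on infinite plays, and a preference relation for each player. -/
structure Game (α A O : Type*) where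
  T : Set (List α)
  d : List α → A
  v : (ℕ → α) → O
  pref : A → O → O → Prop

/-- The infinite sequence starting with `γ` and continuing with `p`. -/
def listExtend {α : Type*} (γ : List α) (p : ℕ → α) : ℕ → α :=
  fun n => if h : n < γ.length then γ.get ⟨n, h⟩ else p (n - γ.length)

/-- The subgame `g_γ` of `g` at a node `γ`. -/
def Game.sub {α A O : Type*} (g : Game α A O) (γ : List α) : Game α A O where
  T := {δ | γ ++ δ ∈ g.T}
  d := fun δ => g.d (γ ++ δ)
  v := fun p => g.v (listExtend γ p)
  pref := g.pref

/-- A strategy profile on `T`: it maps each node of `T` to a successor. -/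
def IsProfile {α : Type*} (T : Set (List α)) (s : List α → List α) : Prop :=
  ∀ γ ∈ T, s γ ∈ treeSucc T γ

/-- The sequence of nodes obtained from `γ` by repeatedly applying `s`. -/
def iterNode {α : Type*} (s : List α → List α) (γ : List α) : ℕ → List α
  | 0 => γ
  | n + 1 => s (iterNode s γ n)

/-- The play `p^ε(s)` induced by `s` at the root. -/
def inducedPlay {α : Type*} [Inhabited α] (s : List α → List α) : ℕ → α :=
  fun n => (iterNode s [] (n + 1)).getD n default

/-- The subprofile `s_γ`, defined by `γ s_γ(δ) = s(γδ)`. -/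
def subProfile {α : Type*} (γ : List α) (s : List α → List α) : List α → List α :=
  fun δ => (s (γ ++ δ)).drop γ.length

/-- `s` is a Nash equilibrium of `g`: no player `a` has a profitable deviation `s'`
differing from `s` only at nodes owned by `a`. -/
def IsNE {α A O : Type*} [Inhabited α] (g : Game α A O) (s : List α → List α) : Prop :=
  ¬ ∃ (a : A) (s' : List α → List α), IsProfile g.T s' ∧
      (∀ γ ∈ g.T, s γ ≠ s' γ → g.d γ = a) ∧
      g.pref a (g.v (inducedPlay s)) (g.v (inducedPlay s'))

/-- `s` is a subgame perfect equilibrium of `g`: `s_γ` is an NE of `g_γ` for all `γ ∈ T`. -/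
def IsSPE {α A O : Type*} [Inhabited α] (g : Game α A O) (s : List α → List α) : Prop :=
  ∀ γ ∈ g.T, IsNE (g.sub γ) (subProfile γ s)

/-- The outcomes occurring in `g`. -/
def OutcomesOf {α A O : Type*} (g : Game α A O) : Set O := g.v '' Body g.T

/-- `x ∈ Os` is Pareto-optimal in `Os`. -/
def ParetoOpt {A O : Type*} (pref : A → O → O → Prop) (Os : Set O) (x : O) : Prop :=
  x ∈ Os ∧ ∀ y ∈ Os, ∀ a, pref a x y → ∃ b, pref b y x

/-- The outcome induced by the subprofile `s_γ` in the subgame `g_γ`. -/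
def subOutcome {α A O : Type*} [Inhabited α] (g : Game α A O) (s : List α → List α)
    (γ : List α) : O :=
  (g.sub γ).v (inducedPlay (subProfile γ s))

/-- Global-Pareto SPE: an SPE inducing in every subgame an outcome that is
Pareto-optimal among the outcomes occurring in that subgame. -/
def IsGPSPE {α A O : Type*} [Inhabited α] (g : Game α A O) (s : List α → List α) : Prop :=
  IsSPE g s ∧ ∀ γ ∈ g.T, ParetoOpt g.pref (OutcomesOf (g.sub γ)) (subOutcome g s γ)

/-- An `x`-pseudo-leaf: a shortest node `γ ∈ T` such that only `x` occurs in `g_γ`. -/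
def IsPseudoLeaf {α A O : Type*} (g : Game α A O) (x : O) (γ : List α) : Prop :=
  γ ∈ g.T ∧ OutcomesOf (g.sub γ) = {x} ∧
    ∀ δ, δ <+: γ → δ ≠ γ → OutcomesOf (g.sub δ) ≠ {x}

/-- A strict weak order: irreflexive, transitive, with transitive complement. -/
def IsSWO {O : Type*} (r : O → O → Prop) : Prop :=
  (∀ x, ¬ r x x) ∧ (∀ x y z, r x y → r y z → r x z) ∧
  (∀ x y z, ¬ r x y → ¬ r y z → ¬ r x z)

/-- The SPE killer does not occur in the family of preferences `lt`. -/
def NoSPEKiller {A O : Type*} (lt : A → O → O → Prop) : Prop :=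
  ∀ a b : A, ∀ x y z : O, ¬ (lt a z y ∧ lt a y x ∧ lt b x z ∧ lt b z y)

/-- Player `a`'s preference `y <_a x_n <_a ⋯ <_a x_1`, where `y` is the outcome `0`
and `x_i` is the outcome `i` in `Fin (n+1)`. -/
def prefA (n : ℕ) : Fin (n + 1) → Fin (n + 1) → Prop :=
  fun u v => v ≠ 0 ∧ (u = 0 ∨ v < u)

/-- Player `b`'s preference `y <_b x_1 <_b ⋯ <_b x_n`, where `y` is the outcome `0`
and `x_i` is the outcome `i` in `Fin (n+1)`. -/
def prefB (n : ℕ) : Fin (n + 1) → Fin (n + 1) → Prop :=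
  fun u v => u < v


namespace BD

universe u

/-- Game arenas: positions with levels and parents. Player `true` moves at even levels. -/
structure Arena where
  Pos : Type u
  lev : Pos → ℕ
  par : Pos → Pos
  lev_par : ∀ p, lev (par p) = lev p - 1
  ex_child : ∀ p, ∃ c, lev c = lev p + 1 ∧ par c = p

def Arena.IsCh (G : Arena.{u}) (p c : G.Pos) : Prop := G.lev c = G.lev p + 1 ∧ G.par c = p

/-- Ancestor at level `n`. -/
def Arena.anc (G : Arena.{u}) (n : ℕ) (p : G.Pos) : G.Pos := G.par^[G.lev p - n] p

theorem Arena.anc_self' (G : Arena.{u}) (n : ℕ) (p : G.Pos) (h : G.lev p ≤ n) : G.anc n p = p := by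
  unfold Arena.anc
  rw [Nat.sub_eq_zero_of_le h]; rfl

theorem Arena.anc_self (G : Arena.{u}) (p : G.Pos) : G.anc (G.lev p) p = p :=
  G.anc_self' _ p le_rfl

theorem Arena.anc_lt (G : Arena.{u}) (n : ℕ) (p : G.Pos) (h : n < G.lev p) :
    G.anc n p = G.anc n (G.par p) := by
  unfold Arena.anc
  rw [G.lev_par]
  obtain ⟨k, hk⟩ : ∃ k, G.lev p - n = k + 1 := ⟨G.lev p - n - 1, by omega⟩
  rw [hk, show G.lev p - 1 - n = k by omega]
  rfl

theorem Arena.lev_anc (G : Arena.{u}) (n : ℕ) (p : G.Pos) (h : n ≤ G.lev p) :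
    G.lev (G.anc n p) = n := by
  induction hl : G.lev p generalizing p with
  | zero =>
    rw [G.anc_self' _ _ (by omega)]; omega
  | succ l ih =>
    rcases Nat.lt_or_ge n (G.lev p) with h1 | h1
    · rw [G.anc_lt _ _ h1]
      have := G.lev_par p
      exact ih _ (by omega) (by omega)
    · rw [G.anc_self' _ _ (by omega)]; omega

theorem Arena.anc_anc (G : Arena.{u}) (m n : ℕ) (p : G.Pos) (h : m ≤ n) :
    G.anc m (G.anc n p) = G.anc m p := by
  induction hl : G.lev p generalizing p with
  | zero =>
    rw [G.anc_self' n _ (by omega)]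
  | succ l ih =>
    rcases Nat.lt_or_ge n (G.lev p) with h1 | h1
    · rw [G.anc_lt n _ h1, G.anc_lt m p (by omega)]
      have := G.lev_par p
      exact ih _ (by omega)
    · rw [G.anc_self' n _ (by omega)]

theorem Arena.par_anc (G : Arena.{u}) (n : ℕ) (p : G.Pos) (h : n < G.lev p) :
    G.par (G.anc (n+1) p) = G.anc n p := by
  have h1 := G.lev_anc (n+1) p h
  rw [← G.anc_anc n (n+1) p (by omega), G.anc_lt n (G.anc (n+1) p) (by omega),
    G.anc_self' n (G.par (G.anc (n+1) p)) (by rw [G.lev_par]; omega)]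

theorem Arena.IsCh.anc_eq {G : Arena.{u}} {p c : G.Pos} (h : G.IsCh p c) (n : ℕ)
    (hn : n ≤ G.lev p) : G.anc n c = G.anc n p := by
  rw [G.anc_lt n c (by have := h.1; omega), h.2]

structure Play (G : Arena.{u}) where
  seq : ℕ → G.Pos
  lev_seq : ∀ n, G.lev (seq n) = n
  par_seq : ∀ n, G.par (seq (n+1)) = seq n

theorem Play.ext' {G : Arena.{u}} {x y : Play G} (h : ∀ n, x.seq n = y.seq n) : x = y := by
  cases x; cases y; congr; funext n; exact h n

theorem Play.anc {G : Arena.{u}} (x : Play G) (m n : ℕ) (h : m ≤ n) :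
    G.anc m (x.seq n) = x.seq m := by
  induction n with
  | zero =>
    obtain rfl : m = 0 := by omega
    exact G.anc_self' _ _ (by rw [x.lev_seq])
  | succ n ih =>
    rcases Nat.lt_or_ge m (n+1) with h1 | h1
    · rw [G.anc_lt _ _ (by rw [x.lev_seq]; exact h1), x.par_seq]; exact ih (by omega)
    · obtain rfl : m = n + 1 := by omega
      exact G.anc_self' _ _ (by rw [x.lev_seq])

theorem Play.isCh {G : Arena.{u}} (x : Play G) (n : ℕ) : G.IsCh (x.seq n) (x.seq (n+1)) :=
  ⟨by rw [x.lev_seq, x.lev_seq], x.par_seq n⟩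

theorem Play.eq_of_le {G : Arena.{u}} (x y : Play G) {m n : ℕ} (h : m ≤ n)
    (e : x.seq n = y.seq n) : x.seq m = y.seq m := by
  rw [← x.anc m n h, ← y.anc m n h, e]

abbrev Strat (G : Arena.{u}) := {σ : G.Pos → G.Pos // ∀ p, G.IsCh p (σ p)}

noncomputable def Arena.dflt (G : Arena.{u}) (p : G.Pos) : G.Pos := (G.ex_child p).choose

theorem Arena.dflt_spec (G : Arena.{u}) (p : G.Pos) : G.IsCh p (G.dflt p) :=
  (G.ex_child p).choose_spec

/-- Turn a partial choice into a strategy. -/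
noncomputable def mkStrat (G : Arena.{u}) (σ : G.Pos → G.Pos) : Strat G := by
  classical
  exact ⟨fun p => if G.IsCh p (σ p) then σ p else G.dflt p, fun p => by
    dsimp only
    split_ifs with h
    · exact h
    · exact G.dflt_spec p⟩

theorem mkStrat_eq (G : Arena.{u}) (σ : G.Pos → G.Pos) (p : G.Pos) (h : G.IsCh p (σ p)) :
    (mkStrat G σ).1 p = σ p := by
  simp [mkStrat, h]

/-- Player whose turn it is at level `n`. -/
def tn (n : ℕ) : Bool := decide (n % 2 = 0)

theorem tn_succ (n : ℕ) : tn (n+1) = !tn n := by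
  unfold tn
  rcases Nat.mod_two_eq_zero_or_one n with h | h
  · have : (n+1) % 2 = 1 := by omega
    simp [h, this]
  · have : (n+1) % 2 = 0 := by omega
    simp [h, this]

def Consistent {G : Arena.{u}} (i : Bool) (σ : Strat G) (m : ℕ) (x : Play G) : Prop :=
  ∀ n, m ≤ n → tn n = i → x.seq (n+1) = σ.1 (x.seq n)

/-- The play through `p` following `σ` after `p`. -/
def follow {G : Arena.{u}} (σ : Strat G) (p : G.Pos) : Play G where
  seq n := if n ≤ G.lev p then G.anc n p else σ.1^[n - G.lev p] p
  lev_seq n := by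
    split_ifs with h
    · exact G.lev_anc n p h
    · have : ∀ j, G.lev (σ.1^[j] p) = G.lev p + j := by
        intro j
        induction j with
        | zero => rfl
        | succ j ih => rw [Function.iterate_succ_apply', (σ.2 _).1, ih]; rfl
      rw [this]; omega
  par_seq n := by
    rcases Nat.lt_or_ge n (G.lev p) with h | h
    · rw [if_pos (by omega), if_pos (by omega), G.par_anc n p h]
    · rw [if_neg (by omega)]
      rw [show n + 1 - G.lev p = (n - G.lev p) + 1 by omega, Function.iterate_succ_apply',
        (σ.2 _).2]
      split_ifs with h1
      · rw [show n - G.lev p = 0 by omega, G.anc_self' _ _ h]; rfl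
      · rfl

theorem follow_at {G : Arena.{u}} (σ : Strat G) (p : G.Pos) :
    (follow σ p).seq (G.lev p) = p := by
  simp [follow, G.anc_self]

theorem follow_step {G : Arena.{u}} (σ : Strat G) (p : G.Pos) (n : ℕ) (h : G.lev p ≤ n) :
    (follow σ p).seq (n+1) = σ.1 ((follow σ p).seq n) := by
  simp only [follow]
  rw [if_neg (by omega), show n + 1 - G.lev p = (n - G.lev p) + 1 by omega,
    Function.iterate_succ_apply']
  split_ifs with h1
  · rw [show n - G.lev p = 0 by omega, G.anc_self' _ _ h]; rfl
  · rfl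

/-! Attractors -/

/-- Player `i` can force `B` inside region `S` with ordinal rank `α`. -/
inductive Rk (G : Arena.{u}) (i : Bool) (S B : Set G.Pos) : Ordinal.{u} → G.Pos → Prop
  | base (α t) : t ∈ B → Rk G i S B α t
  | own (α β t c) : tn (G.lev t) = i → β < α → G.IsCh t c → c ∈ S → Rk G i S B β c →
      Rk G i S B α t
  | oth (α t) (b : G.Pos → Ordinal.{u}) : tn (G.lev t) ≠ i →
      (∀ c, b c < α) → (∀ c, G.IsCh t c → c ∈ S → Rk G i S B (b c) c) → Rk G i S B α t

def Win (G : Arena.{u}) (i : Bool) (S B : Set G.Pos) : Set G.Pos := {t | ∃ α, Rk G i S B α t}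

section attr
variable {G : Arena.{u}} {i : Bool} {S B : Set G.Pos}

theorem win_base {t : G.Pos} (h : t ∈ B) : t ∈ Win G i S B := ⟨0, Rk.base _ _ h⟩

theorem win_own {t c : G.Pos} (h : tn (G.lev t) = i) (hc : G.IsCh t c) (hS : c ∈ S)
    (hw : c ∈ Win G i S B) : t ∈ Win G i S B := by
  obtain ⟨β, hβ⟩ := hw
  exact ⟨Order.succ β, Rk.own _ β _ c h (Order.lt_succ β) hc hS hβ⟩

theorem win_oth {t : G.Pos} (h : tn (G.lev t) ≠ i)
    (hw : ∀ c, G.IsCh t c → c ∈ S → c ∈ Win G i S B) : t ∈ Win G i S B := by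
  classical
  let b : G.Pos → Ordinal.{u} := fun c =>
    if hc : G.IsCh t c ∧ c ∈ S then (hw c hc.1 hc.2).choose else 0
  refine ⟨Order.succ (⨆ c, b c), Rk.oth _ _ b h ?_ ?_⟩
  · intro c
    exact Order.lt_succ_of_le (Ordinal.le_iSup b c)
  · intro c h1 h2
    have : b c = (hw c h1 h2).choose := dif_pos ⟨h1, h2⟩
    rw [this]
    exact (hw c h1 h2).choose_spec

noncomputable def rank (G : Arena.{u}) (i : Bool) (S B : Set G.Pos) (t : G.Pos) : Ordinal.{u} :=
  sInf {α | Rk G i S B α t}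

theorem rk_rank {t : G.Pos} (h : t ∈ Win G i S B) : Rk G i S B (rank G i S B t) t :=
  csInf_mem (s := {α | Rk G i S B α t}) h

theorem rank_le {t : G.Pos} {α} (h : Rk G i S B α t) : rank G i S B t ≤ α :=
  csInf_le' h

theorem att_ex {t : G.Pos} (h : t ∈ Win G i S B) (ho : tn (G.lev t) = i) (hB : t ∉ B) :
    ∃ c, G.IsCh t c ∧ c ∈ S ∧ c ∈ Win G i S B ∧ rank G i S B c < rank G i S B t := by
  have := rk_rank h
  generalize hr : rank G i S B t = r at *
  cases this with
  | base _ _ h => exact absurd h hB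
  | own _ β _ c h1 h2 h3 h4 h5 =>
    exact ⟨c, h3, h4, ⟨β, h5⟩, lt_of_le_of_lt (rank_le h5) h2⟩
  | oth _ _ b h1 => exact absurd ho h1

theorem oth_rank {t c : G.Pos} (h : t ∈ Win G i S B) (ho : tn (G.lev t) ≠ i) (hB : t ∉ B)
    (hc : G.IsCh t c) (hS : c ∈ S) :
    c ∈ Win G i S B ∧ rank G i S B c < rank G i S B t := by
  have := rk_rank h
  generalize hr : rank G i S B t = r at *
  cases this with
  | base _ _ h => exact absurd h hB
  | own _ β _ c h1 h2 h3 h4 h5 => exact absurd h1 ho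
  | oth _ _ b h1 h2 h3 =>
    exact ⟨⟨_, h3 c hc hS⟩, lt_of_le_of_lt (rank_le (h3 c hc hS)) (h2 c)⟩

open Classical in
noncomputable def att (G : Arena.{u}) (i : Bool) (S B : Set G.Pos) (t : G.Pos) : G.Pos :=
  if h : t ∈ Win G i S B ∧ tn (G.lev t) = i ∧ t ∉ B then (att_ex h.1 h.2.1 h.2.2).choose
  else G.dflt t

theorem att_spec {t : G.Pos} (h : t ∈ Win G i S B) (ho : tn (G.lev t) = i) (hB : t ∉ B) :
    G.IsCh t (att G i S B t) ∧ att G i S B t ∈ S ∧ att G i S B t ∈ Win G i S B ∧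
      rank G i S B (att G i S B t) < rank G i S B t := by
  have : att G i S B t = (att_ex h ho hB).choose := dif_pos ⟨h, ho, hB⟩
  rw [this]
  exact (att_ex h ho hB).choose_spec

/-- A play following the attractor strategy hits the target. -/
theorem att_hit (x : Play G) (n₀ : ℕ) (hw : x.seq n₀ ∈ Win G i S B)
    (h1 : ∀ n, n₀ ≤ n → x.seq n ∈ Win G i S B → (∀ k, n₀ ≤ k → k ≤ n → x.seq k ∉ B) →
      tn n = i → x.seq (n+1) = att G i S B (x.seq n))
    (h2 : ∀ n, n₀ ≤ n → x.seq n ∈ Win G i S B → (∀ k, n₀ ≤ k → k ≤ n → x.seq k ∉ B) →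
      tn n ≠ i → x.seq (n+1) ∈ S) :
    ∃ n, n₀ ≤ n ∧ x.seq n ∈ B := by
  by_contra hcon
  push Not at hcon
  have key : ∀ r : Ordinal.{u}, ∀ n, n₀ ≤ n → x.seq n ∈ Win G i S B →
      rank G i S B (x.seq n) = r → False := by
    intro r
    induction r using WellFoundedLT.induction with
    | ind r ih =>
      intro n hn hx hr
      by_cases ho : tn n = i
      · have := att_spec hx (by rw [x.lev_seq]; exact ho) (hcon n hn)
        rw [← h1 n hn hx (fun k hk _ => hcon k hk) ho] at this
        exact ih _ (hr ▸ this.2.2.2) (n+1) (by omega) this.2.2.1 rfl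
      · have := oth_rank hx (by rw [x.lev_seq]; exact ho) (hcon n hn) (x.isCh n)
          (h2 n hn hx (fun k hk _ => hcon k hk) ho)
        exact ih _ (hr ▸ this.2) (n+1) (by omega) this.1 rfl
  exact key _ n₀ le_rfl hw rfl

theorem not_win_own {t c : G.Pos} (h : t ∉ Win G i S B) (ho : tn (G.lev t) = i)
    (hc : G.IsCh t c) (hS : c ∈ S) : c ∉ Win G i S B :=
  fun hw => h (win_own ho hc hS hw)

theorem not_win_oth {t : G.Pos} (h : t ∉ Win G i S B) (ho : tn (G.lev t) ≠ i) :
    ∃ c, G.IsCh t c ∧ c ∈ S ∧ c ∉ Win G i S B := by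
  by_contra hcon
  push Not at hcon
  exact h (win_oth ho hcon)

end attr

/-! Open sets and open determinacy -/

def IsOp {G : Arena.{u}} (A : Set (Play G)) : Prop :=
  ∀ x ∈ A, ∃ n, ∀ y : Play G, y.seq n = x.seq n → y ∈ A

def IsClop {G : Arena.{u}} (A : Set (Play G)) : Prop := IsOp A ∧ IsOp Aᶜ

def Det (G : Arena.{u}) (A : Set (Play G)) (p : G.Pos) : Prop :=
  (∃ σ : Strat G, ∀ x : Play G, x.seq (G.lev p) = p → Consistent true σ (G.lev p) x → x ∈ A) ∨
  (∃ σ : Strat G, ∀ x : Play G, x.seq (G.lev p) = p → Consistent false σ (G.lev p) x → x ∉ A)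

theorem open_det (G : Arena.{u}) (A : Set (Play G)) (hA : IsOp A) (p : G.Pos) : Det G A p := by
  classical
  let B : Set G.Pos := {t | ∀ x : Play G, x.seq (G.lev t) = t → x ∈ A}
  by_cases hw : p ∈ Win G true Set.univ B
  · left
    refine ⟨mkStrat G (att G true Set.univ B), fun x hx hc => ?_⟩
    obtain ⟨n, hn, hB⟩ := att_hit (i := true) (S := Set.univ) (B := B) x (G.lev p) (by rw [hx]; exact hw)
      (by
        intro n hn hxw hxB ho
        rw [hc n hn ho, mkStrat_eq]
        exact (att_spec hxw (by rw [x.lev_seq]; exact ho) (hxB n hn le_rfl)).1)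
      (fun _ _ _ _ _ => Set.mem_univ _)
    exact hB x (by rw [x.lev_seq])
  · right
    have hch : ∀ t : G.Pos, ∃ c, G.IsCh t c ∧ (t ∉ Win G true Set.univ B →
        tn (G.lev t) = false → c ∉ Win G true Set.univ B) := by
      intro t
      by_cases h : t ∉ Win G true Set.univ B ∧ tn (G.lev t) = false
      · obtain ⟨c, h1, h2, h3⟩ := not_win_oth h.1 (by rw [h.2]; simp)
        exact ⟨c, h1, fun _ _ => h3⟩
      · exact ⟨G.dflt t, G.dflt_spec t, fun h1 h2 => absurd ⟨h1, h2⟩ h⟩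
    choose τ hτ1 hτ2 using hch
    refine ⟨⟨τ, hτ1⟩, fun x hx hc hxA => ?_⟩
    have hnw : ∀ n, G.lev p ≤ n → x.seq n ∉ Win G true Set.univ B := by
      intro n hn
      induction n, hn using Nat.le_induction with
      | base => rw [hx]; exact hw
      | succ n hn ih =>
        cases ho : tn n with
        | true => exact not_win_own ih (by rw [x.lev_seq]; exact ho) (x.isCh n) (Set.mem_univ _)
        | false =>
          rw [hc n hn ho]
          exact hτ2 _ ih (by rw [x.lev_seq]; exact ho)
    obtain ⟨n, hn⟩ := hA x hxA
    refine hnw (max n (G.lev p)) (le_max_right _ _) (win_base ?_)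
    intro y hy
    rw [x.lev_seq] at hy
    exact hn y (y.eq_of_le x (le_max_left _ _) hy)

end BD


namespace BD

universe u

/-! Coverings -/

structure Hom (H G : Arena.{u}) where
  f : H.Pos → G.Pos
  lev_f : ∀ p, G.lev (f p) = H.lev p
  par_f : ∀ p, f (H.par p) = G.par (f p)

def Hom.play {H G : Arena.{u}} (h : Hom H G) (y : Play H) : Play G where
  seq n := h.f (y.seq n)
  lev_seq n := by rw [h.lev_f, y.lev_seq]
  par_seq n := by rw [← h.par_f, y.par_seq]

def Hom.id (G : Arena.{u}) : Hom G G := ⟨fun p => p, fun _ => rfl, fun _ => rfl⟩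

def Hom.comp {K H G : Arena.{u}} (h : Hom H G) (h' : Hom K H) : Hom K G :=
  ⟨fun p => h.f (h'.f p), fun p => by rw [h.lev_f, h'.lev_f], fun p => by rw [h'.par_f, h.par_f]⟩

theorem Hom.isCh {H G : Arena.{u}} (h : Hom H G) {p c : H.Pos} (hc : H.IsCh p c) :
    G.IsCh (h.f p) (h.f c) := ⟨by rw [h.lev_f, h.lev_f]; exact hc.1, by rw [← h.par_f, hc.2]⟩

theorem Hom.open {H G : Arena.{u}} (h : Hom H G) {A : Set (Play G)} (hA : IsOp A) :
    IsOp (h.play ⁻¹' A) := by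
  intro x hx
  obtain ⟨n, hn⟩ := hA _ hx
  exact ⟨n, fun y hy => hn _ (by simp only [Hom.play, hy])⟩

structure Cover (k : ℕ) (H G : Arena.{u}) extends Hom H G where
  inj : ∀ p q, H.lev p ≤ k → f p = f q → p = q
  surj : ∀ p, G.lev p ≤ k → ∃ q, f q = p
  φ : Bool → Strat H → Strat G
  loc : ∀ i n (σ σ' : Strat H), (∀ p, H.lev p < n → σ.1 p = σ'.1 p) →
    ∀ p, G.lev p < n → (φ i σ).1 p = (φ i σ').1 p
  idl : ∀ i (σ : Strat H) p, H.lev p < k → (φ i σ).1 (f p) = f (σ.1 p)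
  lift : ∀ i (σ : Strat H) m (x : Play G), m ≤ k → Consistent i (φ i σ) m x →
    ∃ y : Play H, Consistent i σ m y ∧ toHom.play y = x

theorem Cover.det {k : ℕ} {H G : Arena.{u}} (c : Cover k H G) (A : Set (Play G)) (p : H.Pos)
    (hp : H.lev p ≤ k) (h : Det H (c.toHom.play ⁻¹' A) p) : Det G A (c.f p) := by
  have key : ∀ i (σ : Strat H) (x : Play G), x.seq (G.lev (c.f p)) = c.f p →
      Consistent i (c.φ i σ) (G.lev (c.f p)) x →
      ∃ y : Play H, y.seq (H.lev p) = p ∧ Consistent i σ (H.lev p) y ∧ c.toHom.play y = x := by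
    intro i σ x hx hc
    rw [c.lev_f] at hx hc
    obtain ⟨y, hy, hyx⟩ := c.lift i σ _ x hp hc
    refine ⟨y, ?_, hy, hyx⟩
    apply c.inj
    · rw [y.lev_seq]; exact hp
    · rw [← hx, ← hyx]; rfl
  rcases h with ⟨σ, h⟩ | ⟨σ, h⟩
  · left
    refine ⟨c.φ true σ, fun x hx hc => ?_⟩
    obtain ⟨y, h1, h2, rfl⟩ := key _ _ _ hx hc
    exact h y h1 h2
  · right
    refine ⟨c.φ false σ, fun x hx hc => ?_⟩
    obtain ⟨y, h1, h2, rfl⟩ := key _ _ _ hx hc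
    exact h y h1 h2

def Cover.comp {k : ℕ} {K H G : Arena.{u}} (c : Cover k H G) (c' : Cover k K H) : Cover k K G where
  toHom := c.toHom.comp c'.toHom
  inj p q hp h := c'.inj _ _ hp (c.inj _ _ (by rw [c'.lev_f]; exact hp) h)
  surj p hp := by
    obtain ⟨q, rfl⟩ := c.surj p hp
    obtain ⟨r, rfl⟩ := c'.surj q (by rw [← c.lev_f]; exact hp)
    exact ⟨r, rfl⟩
  φ i σ := c.φ i (c'.φ i σ)
  loc i n σ σ' h := c.loc i n _ _ (c'.loc i n _ _ h)
  idl i σ p hp := by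
    change (c.φ i (c'.φ i σ)).1 (c.f (c'.f p)) = c.f (c'.f (σ.1 p))
    rw [c.idl _ _ _ (by rw [c'.lev_f]; exact hp), c'.idl _ _ _ hp]
  lift i σ m x hm hx := by
    obtain ⟨y, hy, rfl⟩ := c.lift i _ m x hm hx
    obtain ⟨z, hz, rfl⟩ := c'.lift i _ m y hm hy
    exact ⟨z, hz, rfl⟩

def Cover.mono {k k' : ℕ} {H G : Arena.{u}} (c : Cover k H G) (h : k' ≤ k) : Cover k' H G where
  toHom := c.toHom
  inj p q hp := c.inj p q (by omega)
  surj p hp := c.surj p (by omega)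
  φ := c.φ
  loc := c.loc
  idl i σ p hp := c.idl i σ p (by omega)
  lift i σ m x hm := c.lift i σ m x (by omega)

/-! Inverse limits -/

section limit

structure Tower (k : ℕ) where
  T : ℕ → Arena.{u}
  c : ∀ j, Cover (k + j) (T (j+1)) (T j)

variable {k : ℕ}

abbrev Thread (W : Tower.{u} k) := {th : ∀ j, (W.T j).Pos // ∀ j, (W.c j).f (th (j+1)) = th j}

def Tower.shift (W : Tower.{u} k) : Tower.{u} (k+1) where
  T j := W.T (j+1)
  c j := (W.c (j+1)).mono (by omega)

theorem Thread.lev {W : Tower.{u} k} (th : Thread W) (j : ℕ) :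
    (W.T j).lev (th.1 j) = (W.T 0).lev (th.1 0) := by
  induction j with
  | zero => rfl
  | succ j ih => rw [← ih, ← (W.c j).lev_f, th.2]

theorem Thread.eq {W : Tower.{u} k} (th th' : Thread W) (j : ℕ)
    (hl : (W.T j).lev (th.1 j) ≤ k + j) (h : th.1 j = th'.1 j) : th = th' := by
  have hup : ∀ i, j ≤ i → th.1 i = th'.1 i := by
    intro i hi
    induction i, hi using Nat.le_induction with
    | base => exact h
    | succ i hi ih =>
      apply (W.c i).inj
      · rw [th.lev, ← th.lev j]; omega
      · rw [th.2, th'.2, ih]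
  have hdown : ∀ d i, i + d = j → th.1 i = th'.1 i := by
    intro d
    induction d with
    | zero => intro i hi; exact hup i (by omega)
    | succ d ih =>
      intro i hi
      rw [← th.2, ← th'.2, ih (i+1) (by omega)]
  apply Subtype.ext
  funext i
  rcases Nat.lt_or_ge i j with h1 | h1
  · exact hdown (j - i) i (by omega)
  · exact hup i h1

theorem thread_ex (j : ℕ) : ∀ {k : ℕ} (W : Tower.{u} k) (p : (W.T j).Pos),
    (W.T j).lev p ≤ k + j → ∃ th : Thread W, th.1 j = p := by
  induction j with
  | zero =>
    intro k W p hp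
    have hs : ∀ i (q : {q : (W.T i).Pos // (W.T i).lev q ≤ k}),
        ∃ q' : {q : (W.T (i+1)).Pos // (W.T (i+1)).lev q ≤ k}, (W.c i).f q'.1 = q.1 := by
      intro i q
      obtain ⟨q', hq'⟩ := (W.c i).surj q.1 (by have := q.2; omega)
      exact ⟨⟨q', by rw [← (W.c i).lev_f, hq']; exact q.2⟩, hq'⟩
    choose F hF using hs
    let th : ∀ i, {q : (W.T i).Pos // (W.T i).lev q ≤ k} := fun i =>
      Nat.rec (motive := fun i => {q : (W.T i).Pos // (W.T i).lev q ≤ k}) ⟨p, by omega⟩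
        (fun i q => F i q) i
    exact ⟨⟨fun i => (th i).1, fun i => hF i (th i)⟩, rfl⟩
  | succ j ih =>
    intro k W p hp
    obtain ⟨th, hth⟩ := ih W.shift p (by change (W.T (j+1)).lev p ≤ _; omega)
    refine ⟨⟨fun i => Nat.casesOn (motive := fun i => (W.T i).Pos) i ((W.c 0).f (th.1 0))
      (fun i => th.1 i), ?_⟩, hth⟩
    intro i
    cases i with
    | zero => rfl
    | succ i => exact th.2 i

def Tower.lim (W : Tower.{u} k) : Arena.{u} where
  Pos := Thread W
  lev th := (W.T 0).lev (th.1 0)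
  par th := ⟨fun j => (W.T j).par (th.1 j), fun j => by rw [(W.c j).par_f, th.2]⟩
  lev_par th := (W.T 0).lev_par _
  ex_child th := by
    set n := (W.T 0).lev (th.1 0) with hn
    obtain ⟨c, hc1, hc2⟩ := (W.T (n+1)).ex_child (th.1 (n+1))
    rw [th.lev, ← hn] at hc1
    obtain ⟨th', h'⟩ := thread_ex (n+1) W c (by omega)
    have hl : (W.T 0).lev (th'.1 0) = n + 1 := by rw [← th'.lev (n+1), h', hc1]
    refine ⟨th', hl, ?_⟩
    apply Thread.eq _ _ (n+1)
    · change (W.T (n+1)).lev ((W.T (n+1)).par (th'.1 (n+1))) ≤ _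
      rw [(W.T (n+1)).lev_par, th'.lev, hl]; omega
    · change (W.T (n+1)).par (th'.1 (n+1)) = _
      rw [h', hc2]

def Tower.proj (W : Tower.{u} k) (j : ℕ) : Hom W.lim (W.T j) where
  f th := th.1 j
  lev_f th := th.lev j
  par_f th := rfl

/-- The strategy induced by `σ` on the `j`-th arena (meaningful at levels `< k + j`). -/
noncomputable def Tower.ind (W : Tower.{u} k) (σ : Strat W.lim) (j : ℕ) : Strat (W.T j) := by
  classical
  exact ⟨fun p => if h : (W.T j).lev p < k + j then
      (σ.1 (thread_ex j W p h.le).choose).1 j else (W.T j).dflt p, fun p => by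
    dsimp only
    split_ifs with h
    · have h1 := (W.proj j).isCh (σ.2 (thread_ex j W p h.le).choose)
      change (W.T j).IsCh ((thread_ex j W p h.le).choose.1 j) _ at h1
      rw [(thread_ex j W p h.le).choose_spec] at h1
      exact h1
    · exact (W.T j).dflt_spec p⟩

theorem Tower.ind_eq (W : Tower.{u} k) (σ : Strat W.lim) (j : ℕ) (th : Thread W)
    (h : (W.T j).lev (th.1 j) < k + j) : (W.ind σ j).1 (th.1 j) = (σ.1 th).1 j := by
  have h1 : (thread_ex j W (th.1 j) h.le).choose = th := by
    apply Thread.eq _ _ j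
    · rw [(thread_ex j W (th.1 j) h.le).choose_spec]; exact h.le
    · exact (thread_ex j W (th.1 j) h.le).choose_spec
  simp only [Tower.ind]
  rw [dif_pos h, h1]

theorem Tower.ind_loc (W : Tower.{u} k) (σ σ' : Strat W.lim) (n : ℕ)
    (h : ∀ p, W.lim.lev p < n → σ.1 p = σ'.1 p) (j : ℕ) (p : (W.T j).Pos)
    (hp : (W.T j).lev p < n) : (W.ind σ j).1 p = (W.ind σ' j).1 p := by
  by_cases h1 : (W.T j).lev p < k + j
  · obtain ⟨th, rfl⟩ := thread_ex j W p h1.le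
    have hth : (W.T 0).lev (th.1 0) < n := by rw [← th.lev j]; exact hp
    rw [W.ind_eq _ _ _ h1, W.ind_eq _ _ _ h1]
    exact congrArg (fun z : Thread W => z.1 j) (h th hth)
  · simp only [Tower.ind]
    rw [dif_neg h1, dif_neg h1]

noncomputable def Tower.psi (W : Tower.{u} k) (b : Bool) (σ : Strat W.lim) :
    ℕ → ∀ i, Strat (W.T i)
  | 0 => fun i => W.ind σ i
  | d + 1 => fun i => (W.c i).φ b (W.psi b σ d (i+1))

theorem Tower.psi_step (W : Tower.{u} k) (b : Bool) (σ : Strat W.lim) (d : ℕ) : ∀ i p,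
    (W.T i).lev p < k + i + d → (W.psi b σ (d+1) i).1 p = (W.psi b σ d i).1 p := by
  induction d with
  | zero =>
    intro i p hp
    obtain ⟨th, rfl⟩ := thread_ex i W p (by omega)
    change ((W.c i).φ b (W.ind σ (i+1))).1 (th.1 i) = (W.ind σ i).1 (th.1 i)
    rw [W.ind_eq _ _ _ (by omega), ← th.2, (W.c i).idl, W.ind_eq, (σ.1 th).2]
    · rw [th.lev, ← th.lev i]; omega
    · rw [th.lev, ← th.lev i]; omega
  | succ d ih =>
    intro i p hp
    exact (W.c i).loc b (k + i + (d+1)) _ _ (fun q hq => ih (i+1) q (by omega)) p hp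

theorem Tower.psi_stable (W : Tower.{u} k) (b : Bool) (σ : Strat W.lim) (d d' : ℕ) (hd : d ≤ d')
    (i) (p : (W.T i).Pos) (hp : (W.T i).lev p < k + i + d) :
    (W.psi b σ d' i).1 p = (W.psi b σ d i).1 p := by
  induction d', hd using Nat.le_induction with
  | base => rfl
  | succ d' hd ih => rw [W.psi_step b σ d' i p (by omega), ih]

noncomputable def Tower.psi' (W : Tower.{u} k) (b : Bool) (σ : Strat W.lim) (i : ℕ) :
    Strat (W.T i) :=
  ⟨fun p => (W.psi b σ ((W.T i).lev p + 1) i).1 p, fun p => (W.psi b σ _ i).2 p⟩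

theorem Tower.psi'_eq (W : Tower.{u} k) (b : Bool) (σ : Strat W.lim) (i d : ℕ)
    (p : (W.T i).Pos) (hp : (W.T i).lev p < k + i + d) :
    (W.psi' b σ i).1 p = (W.psi b σ d i).1 p := by
  change (W.psi b σ ((W.T i).lev p + 1) i).1 p = _
  rcases Nat.le_total d ((W.T i).lev p + 1) with h | h
  · exact W.psi_stable b σ _ _ h i p hp
  · exact (W.psi_stable b σ _ _ h i p (by omega)).symm

theorem Tower.psi'_succ (W : Tower.{u} k) (b : Bool) (σ : Strat W.lim) (i : ℕ) :
    W.psi' b σ i = (W.c i).φ b (W.psi' b σ (i+1)) := by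
  apply Subtype.ext
  funext p
  have h1 := W.psi'_eq b σ i ((W.T i).lev p + 1 + 1) p (by omega)
  rw [h1]
  refine (W.c i).loc b ((W.T i).lev p + 1) _ _ (fun q hq => ?_) p (by omega)
  rw [W.psi'_eq b σ (i+1) ((W.T i).lev p + 1) q (by omega)]

noncomputable def Tower.cover (W : Tower.{u} k) : Cover k W.lim (W.T 0) where
  toHom := W.proj 0
  inj p q hp h := Thread.eq _ _ 0 hp h
  surj p hp := thread_ex 0 W p hp
  φ b σ := W.psi' b σ 0
  loc b n σ σ' h := by
    have key : ∀ d i p, (W.T i).lev p < n → (W.psi b σ d i).1 p = (W.psi b σ' d i).1 p := by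
      intro d
      induction d with
      | zero => exact fun i p hp => W.ind_loc σ σ' n h i p hp
      | succ d ih => exact fun i p hp => (W.c i).loc b n _ _ (ih (i+1)) p hp
    intro p hp
    exact key _ 0 p hp
  idl b σ th hp := by
    change (W.psi' b σ 0).1 (th.1 0) = (σ.1 th).1 0
    rw [W.psi'_eq b σ 0 0 _ (by exact hp)]
    exact W.ind_eq σ 0 th hp
  lift b σ m x hm hx := by
    have hs : ∀ i (y : {y : Play (W.T i) // Consistent b (W.psi' b σ i) m y}),
        ∃ y' : {y : Play (W.T (i+1)) // Consistent b (W.psi' b σ (i+1)) m y},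
          (W.c i).toHom.play y'.1 = y.1 := by
      rintro i ⟨y, hy⟩
      rw [W.psi'_succ] at hy
      obtain ⟨z, hz, hzy⟩ := (W.c i).lift b _ m y (by omega) hy
      exact ⟨⟨z, hz⟩, hzy⟩
    choose F hF using hs
    let Y : ∀ i, {y : Play (W.T i) // Consistent b (W.psi' b σ i) m y} := fun i =>
      Nat.rec (motive := fun i => {y : Play (W.T i) // Consistent b (W.psi' b σ i) m y}) ⟨x, hx⟩
        (fun i q => F i q) i
    have hY : ∀ i, (W.c i).toHom.play (Y (i+1)).1 = (Y i).1 := fun i => hF i (Y i)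
    let y : Play W.lim :=
      { seq := fun n => ⟨fun i => (Y i).1.seq n, fun i =>
          congrArg (fun z : Play (W.T i) => z.seq n) (hY i)⟩
        lev_seq := fun n => (Y 0).1.lev_seq n
        par_seq := fun n => Subtype.ext (funext fun i => (Y i).1.par_seq n) }
    refine ⟨y, ?_, rfl⟩
    intro n hn hb
    have hl : (W.T (n+1)).lev ((y.seq n).1 (n+1)) = n := (Y (n+1)).1.lev_seq n
    apply Thread.eq _ _ (n+1)
    · have : (W.T (n+1)).lev ((Y (n+1)).1.seq (n+1)) ≤ k + (n+1) := by
        rw [Play.lev_seq]; omega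
      exact this
    · refine Eq.trans ?_ (W.ind_eq σ (n+1) (y.seq n) (by omega))
      have := (Y (n+1)).2 n hn hb
      rw [W.psi'_eq b σ (n+1) 0 _ (by rw [Play.lev_seq]; omega)] at this
      exact this

end limit

end BD


namespace BD

universe u

/-! Unraveling closed sets -/

inductive Aux (P : Type u) : Type u
  | low : Aux P
  | mid (S : Set P) : Aux P
  | h1 (S : Set P) (w : P) : Aux P
  | h2 (S S2 : Set P) : Aux P

section unravel
variable (G : Arena.{u}) (k : ℕ) (C : Set G.Pos)

def QI (S : Set G.Pos) : Prop :=
  ∀ p ∈ S, (tn (G.lev p) = false → ∀ c, G.IsCh p c → c ∈ S) ∧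
    (tn (G.lev p) = true → ∃ c, G.IsCh p c ∧ c ∈ S)

def QII (S S2 : Set G.Pos) : Prop :=
  ∀ p ∈ S2, p ∈ S ∧ p ∈ C ∧ (tn (G.lev p) = true → ∀ c, G.IsCh p c → c ∈ S → c ∈ S2) ∧
    (tn (G.lev p) = false → ∃ c, G.IsCh p c ∧ c ∈ S2)

def VH1 (t : G.Pos) (S : Set G.Pos) (w : G.Pos) : Prop :=
  k + 2 ≤ G.lev t ∧ k + 2 ≤ G.lev w ∧ (∀ n, n ≤ G.lev t → n ≤ G.lev w → G.anc n t = G.anc n w) ∧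
    (∀ n, k + 2 ≤ n → n ≤ G.lev w → G.anc n w ∈ S) ∧ w ∉ C ∧ QI G S ∧ G.anc (k+1) t ∈ S

def VH2 (t : G.Pos) (S S2 : Set G.Pos) : Prop :=
  k + 2 ≤ G.lev t ∧ (∀ n, k + 2 ≤ n → n ≤ G.lev t → G.anc n t ∈ S2) ∧ QI G S ∧
    G.anc (k+1) t ∈ S ∧ QII G C S S2

def Valid (t : G.Pos) : Aux G.Pos → Prop
  | Aux.low => G.lev t ≤ k
  | Aux.mid S => G.lev t = k + 1 ∧ t ∈ S ∧ QI G S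
  | Aux.h1 S w => VH1 G k C t S w
  | Aux.h2 S S2 => VH2 G k C t S S2

open Classical in
noncomputable def parAux (l : ℕ) : Aux G.Pos → Aux G.Pos
  | Aux.low => Aux.low
  | Aux.mid _ => Aux.low
  | Aux.h1 S w => if l = k + 2 then Aux.mid S else Aux.h1 S w
  | Aux.h2 S S2 => if l = k + 2 then Aux.mid S else Aux.h2 S S2

theorem valid_par (t : G.Pos) (a : Aux G.Pos) (h : Valid G k C t a) :
    Valid G k C (G.par t) (parAux G k (G.lev t) a) := by
  have hl := G.lev_par t
  cases a with
  | low => simp only [Valid, parAux] at *; omega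
  | mid S => simp only [Valid, parAux] at *; omega
  | h1 S w =>
    obtain ⟨a1, a2, a3, a4, a5, a6, a7⟩ := h
    simp only [parAux]
    split_ifs with hc
    · refine ⟨by omega, ?_, a6⟩
      rw [G.anc_lt _ _ (by omega), G.anc_self' _ _ (by omega)] at a7
      exact a7
    · refine ⟨by omega, a2, ?_, a4, a5, a6, ?_⟩
      · intro n h1 h2
        rw [← G.anc_lt _ _ (by omega)]; exact a3 n (by omega) h2
      · rw [← G.anc_lt _ _ (by omega)]; exact a7
  | h2 S S2 =>
    obtain ⟨a1, a2, a3, a4, a5⟩ := h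
    simp only [parAux]
    split_ifs with hc
    · refine ⟨by omega, ?_, a3⟩
      rw [G.anc_lt _ _ (by omega), G.anc_self' _ _ (by omega)] at a4
      exact a4
    · refine ⟨by omega, ?_, a3, ?_, a5⟩
      · intro n h1 h2
        rw [← G.anc_lt _ _ (by omega)]; exact a2 n h1 (by omega)
      · rw [← G.anc_lt _ _ (by omega)]; exact a4

theorem valid_child (hk : tn k = true) (t : G.Pos) (a : Aux G.Pos) (h : Valid G k C t a) :
    ∃ c b, Valid G k C c b ∧ G.IsCh t c ∧ parAux G k (G.lev c) b = a := by
  cases a with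
  | low =>
    simp only [Valid] at h
    have hd := G.dflt_spec t
    rcases Nat.lt_or_ge (G.lev t) k with h1 | h1
    · exact ⟨G.dflt t, Aux.low, by simp only [Valid]; rw [hd.1]; omega, hd, rfl⟩
    · exact ⟨G.dflt t, Aux.mid Set.univ, ⟨by rw [hd.1]; omega, Set.mem_univ _,
        fun p _ => ⟨fun _ _ _ => Set.mem_univ _, fun _ => ⟨_, G.dflt_spec p, Set.mem_univ _⟩⟩⟩, hd, rfl⟩
  | mid S =>
    obtain ⟨a1, a2, a3⟩ := h
    have ht : tn (G.lev t) = false := by rw [a1, tn_succ, hk]; rfl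
    by_cases hu : ∃ w, k + 2 ≤ G.lev w ∧ (∀ n, k + 2 ≤ n → n ≤ G.lev w → G.anc n w ∈ S) ∧
        G.anc (k+1) w = t ∧ w ∉ C
    · obtain ⟨w, b1, b2, b3, b4⟩ := hu
      have hl : G.lev (G.anc (k+2) w) = k + 2 := G.lev_anc _ _ b1
      have hp : G.par (G.anc (k+2) w) = t := by rw [G.par_anc _ _ (by omega), b3]
      refine ⟨G.anc (k+2) w, Aux.h1 S w, ⟨by omega, b1, ?_, b2, b4, a3, ?_⟩, ⟨by omega, hp⟩, ?_⟩
      · intro n h1 h2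
        exact G.anc_anc _ _ _ (by omega)
      · rw [G.anc_anc _ _ _ (by omega), b3]; exact a2
      · simp [parAux, hl]
    · push Not at hu
      let S2 : Set G.Pos := {w | k + 2 ≤ G.lev w ∧ (∀ n, k + 2 ≤ n → n ≤ G.lev w → G.anc n w ∈ S) ∧
        G.anc (k+1) w = t}
      have hstep : ∀ w ∈ S2, ∀ c, G.IsCh w c → c ∈ S → c ∈ S2 := by
        rintro w ⟨b1, b2, b3⟩ c hc hcS
        refine ⟨by rw [hc.1]; omega, ?_, ?_⟩
        · intro n hn1 hn2
          rw [hc.1] at hn2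
          rcases Nat.lt_or_ge (G.lev w) n with h1 | h1
          · rw [G.anc_self' _ _ (by rw [hc.1]; omega)]; exact hcS
          · rw [hc.anc_eq _ h1]; exact b2 n hn1 h1
        · rw [hc.anc_eq _ (by omega)]; exact b3
      have hself : ∀ w ∈ S2, w ∈ S := by
        rintro w ⟨b1, b2, b3⟩
        have := b2 _ b1 le_rfl
        rwa [G.anc_self] at this
      have hd := G.dflt_spec t
      have hdS : G.dflt t ∈ S := (a3 t a2).1 ht _ hd
      refine ⟨G.dflt t, Aux.h2 S S2, ⟨by rw [hd.1]; omega, ?_, a3, ?_, ?_⟩, hd, ?_⟩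
      · intro n h1 h2
        rw [hd.1] at h2
        rw [G.anc_self' _ _ (by rw [hd.1]; omega)]
        refine ⟨by rw [hd.1]; omega, ?_, ?_⟩
        · intro m h3 h4
          rw [G.anc_self' _ _ (by rw [hd.1]; omega)]; exact hdS
        · rw [hd.anc_eq _ (by omega), G.anc_self' _ _ (by omega)]
      · rw [hd.anc_eq _ (by omega), G.anc_self' _ _ (by omega)]; exact a2
      · intro w hw
        refine ⟨hself w hw, hu w hw.1 hw.2.1 hw.2.2, fun _ => hstep w hw, fun ho => ?_⟩
        have := (a3 w (hself w hw)).1 ho _ (G.dflt_spec w)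
        exact ⟨_, G.dflt_spec w, hstep w hw _ (G.dflt_spec w) this⟩
      · simp [parAux, hd.1, a1]
  | h1 S w =>
    obtain ⟨a1, a2, a3, a4, a5, a6, a7⟩ := h
    have key : ∀ c, G.IsCh t c → (∀ n, n ≤ G.lev c → n ≤ G.lev w → G.anc n c = G.anc n w) →
        ∃ c b, Valid G k C c b ∧ G.IsCh t c ∧ parAux G k (G.lev c) b = Aux.h1 S w := by
      intro c hc hcw
      refine ⟨c, Aux.h1 S w, ⟨by rw [hc.1]; omega, a2, hcw, a4, a5, a6, ?_⟩, hc, ?_⟩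
      · rw [hc.anc_eq _ (by omega)]; exact a7
      · have : G.lev c ≠ k + 2 := by rw [hc.1]; omega
        simp [parAux, this]
    rcases Nat.lt_or_ge (G.lev t) (G.lev w) with h | h
    · apply key (G.anc (G.lev t + 1) w)
      · refine ⟨G.lev_anc _ _ h, ?_⟩
        rw [G.par_anc _ _ h, ← a3 _ le_rfl h.le, G.anc_self]
      · intro n h1 h2
        rw [G.lev_anc _ _ h] at h1
        rw [G.anc_anc _ _ _ h1]
    · apply key _ (G.dflt_spec t)
      intro n h1 h2
      rw [(G.dflt_spec t).anc_eq _ (by omega)]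
      exact a3 n (by omega) h2
  | h2 S S2 =>
    obtain ⟨a1, a2, a3, a4, a5⟩ := h
    have htS : t ∈ S2 := by have := a2 _ a1 le_rfl; rwa [G.anc_self] at this
    have hex : ∃ c, G.IsCh t c ∧ c ∈ S2 := by
      obtain ⟨b1, b2, b3, b4⟩ := a5 t htS
      cases ho : tn (G.lev t) with
      | true =>
        obtain ⟨c, c1, c2⟩ := (a3 t b1).2 ho
        exact ⟨c, c1, b3 ho c c1 c2⟩
      | false => exact b4 ho
    obtain ⟨c, hc, hcS⟩ := hex
    refine ⟨c, Aux.h2 S S2, ⟨by rw [hc.1]; omega, ?_, a3, ?_, a5⟩, hc, ?_⟩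
    · intro n hn1 hn2
      rw [hc.1] at hn2
      rcases Nat.lt_or_ge (G.lev t) n with h1 | h1
      · rw [G.anc_self' _ _ (by rw [hc.1]; omega)]; exact hcS
      · rw [hc.anc_eq _ h1]; exact a2 n hn1 h1
    · rw [hc.anc_eq _ (by omega)]; exact a4
    · have : G.lev c ≠ k + 2 := by rw [hc.1]; omega
      simp [parAux, this]

noncomputable def UA (hk : tn k = true) : Arena.{u} where
  Pos := {z : G.Pos × Aux G.Pos // Valid G k C z.1 z.2}
  lev z := G.lev z.1.1
  par z := ⟨(G.par z.1.1, parAux G k (G.lev z.1.1) z.1.2), valid_par G k C _ _ z.2⟩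
  lev_par z := G.lev_par _
  ex_child z := by
    obtain ⟨c, b, h1, h2, h3⟩ := valid_child G k C hk z.1.1 z.1.2 z.2
    refine ⟨⟨(c, b), h1⟩, h2.1, ?_⟩
    apply Subtype.ext
    exact Prod.ext h2.2 h3

variable {G k C} (hk : tn k = true)

def UAhom : Hom (UA G k C hk) G := ⟨fun z => z.1.1, fun _ => rfl, fun _ => rfl⟩

theorem valid_low {t : G.Pos} {a : Aux G.Pos} (h : Valid G k C t a) (hl : G.lev t ≤ k) :
    a = Aux.low := by
  cases a with
  | low => rfl
  | mid S => have := h.1; omega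
  | h1 S w => have := h.1; omega
  | h2 S S2 => have := h.1; omega

theorem valid_mid {t : G.Pos} {a : Aux G.Pos} (h : Valid G k C t a) (hl : G.lev t = k + 1) :
    ∃ S, a = Aux.mid S := by
  cases a with
  | low => simp only [Valid] at h; omega
  | mid S => exact ⟨S, rfl⟩
  | h1 S w => have := h.1; omega
  | h2 S S2 => have := h.1; omega

theorem aux_of_mid {z z' : (UA G k C hk).Pos} (h : (UA G k C hk).IsCh z z') {S}
    (hl : z.1.2 = Aux.mid S) :
    (∃ w, z'.1.2 = Aux.h1 S w) ∨ (∃ S2, z'.1.2 = Aux.h2 S S2) := by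
  obtain ⟨⟨t, a⟩, ha⟩ := z
  obtain ⟨⟨t', a'⟩, ha'⟩ := z'
  have h2 : parAux G k (G.lev t') a' = a := congrArg (fun z : (UA G k C hk).Pos => z.1.2) h.2
  have h1 : G.lev t' = G.lev t + 1 := h.1
  dsimp only at *
  subst hl
  cases a' with
  | low => simp [parAux] at h2
  | mid S => simp [parAux] at h2
  | h1 S w =>
    simp only [parAux] at h2
    split_ifs at h2
    · injection h2 with h2; subst h2; exact Or.inl ⟨w, rfl⟩
  | h2 S S2 =>
    simp only [parAux] at h2
    split_ifs at h2
    · injection h2 with h2; subst h2; exact Or.inr ⟨S2, rfl⟩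

theorem aux_of_high {z z' : (UA G k C hk).Pos} (h : (UA G k C hk).IsCh z z')
    (hl : k + 2 ≤ G.lev z.1.1) : z'.1.2 = z.1.2 := by
  obtain ⟨⟨t, a⟩, ha⟩ := z
  obtain ⟨⟨t', a'⟩, ha'⟩ := z'
  have h2 : parAux G k (G.lev t') a' = a := congrArg (fun z : (UA G k C hk).Pos => z.1.2) h.2
  have h1 : G.lev t' = G.lev t + 1 := h.1
  dsimp only at *
  have h3 : G.lev t' ≠ k + 2 := by omega
  cases a' with
  | low => simp only [Valid] at ha'; omega
  | mid S => have : G.lev t' = k + 1 := ha'.1; omega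
  | h1 S w => simp only [parAux, if_neg h3] at h2; exact h2
  | h2 S w => simp only [parAux, if_neg h3] at h2; exact h2

open Classical in
noncomputable def mv1 (σ : Strat (UA G k C hk)) (t : G.Pos) (a : Aux G.Pos) : G.Pos × Aux G.Pos :=
  if h : Valid G k C t a then (σ.1 ⟨(t, a), h⟩).1 else (G.dflt t, Aux.low)

theorem mv1_eq (σ : Strat (UA G k C hk)) {t : G.Pos} {a : Aux G.Pos} (h : Valid G k C t a) :
    mv1 hk σ t a = (σ.1 ⟨(t, a), h⟩).1 := dif_pos h

theorem mv1_isCh (σ : Strat (UA G k C hk)) (t : G.Pos) (a : Aux G.Pos) :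
    G.IsCh t (mv1 hk σ t a).1 := by
  by_cases h : Valid G k C t a
  · rw [mv1_eq hk σ h]
    exact (UAhom hk).isCh (σ.2 ⟨(t, a), h⟩)
  · simp only [mv1, dif_neg h]
    exact G.dflt_spec t

theorem mv1_valid (σ : Strat (UA G k C hk)) {t : G.Pos} {a : Aux G.Pos} (h : Valid G k C t a) :
    Valid G k C (mv1 hk σ t a).1 (mv1 hk σ t a).2 := by
  rw [mv1_eq hk σ h]; exact (σ.1 ⟨(t, a), h⟩).2

theorem mv1_high (σ : Strat (UA G k C hk)) {t : G.Pos} {a : Aux G.Pos} (h : Valid G k C t a)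
    (hl : k + 2 ≤ G.lev t) : (mv1 hk σ t a).2 = a := by
  rw [mv1_eq hk σ h]
  exact aux_of_high hk (σ.2 ⟨(t, a), h⟩) hl

theorem mv1_mid (σ : Strat (UA G k C hk)) {t : G.Pos} {S} (h : Valid G k C t (Aux.mid S)) :
    (∃ w, (mv1 hk σ t (Aux.mid S)).2 = Aux.h1 S w) ∨
    (∃ S2, (mv1 hk σ t (Aux.mid S)).2 = Aux.h2 S S2) := by
  rw [mv1_eq hk σ h]
  exact aux_of_mid hk (σ.2 ⟨(t, Aux.mid S), h⟩) rfl

theorem mv1_loc (σ σ' : Strat (UA G k C hk)) (n : ℕ)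
    (h : ∀ p, (UA G k C hk).lev p < n → σ.1 p = σ'.1 p) (t : G.Pos) (a) (hl : G.lev t < n) :
    mv1 hk σ t a = mv1 hk σ' t a := by
  by_cases hv : Valid G k C t a
  · rw [mv1_eq hk σ hv, mv1_eq hk σ' hv, h ⟨(t, a), hv⟩ hl]
  · simp only [mv1, dif_neg hv]

theorem mkStrat_congr (σ σ' : G.Pos → G.Pos) (p : G.Pos) (h : σ p = σ' p) :
    (mkStrat G σ).1 p = (mkStrat G σ').1 p := by
  simp only [mkStrat]; rw [h]

/-- A lifted play. -/
noncomputable def mkPlay (x : Play G) (S : Set G.Pos) (top : Aux G.Pos)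
    (hmid : Valid G k C (x.seq (k+1)) (Aux.mid S)) (htop : ∀ n, k + 2 ≤ n → Valid G k C (x.seq n) top)
    (hpar : parAux G k (k+2) top = Aux.mid S) (hpar' : ∀ l, k + 2 < l → parAux G k l top = top) :
    Play (UA G k C hk) where
  seq n := ⟨(x.seq n, if n ≤ k then Aux.low else if n = k + 1 then Aux.mid S else top), by
    dsimp only
    split_ifs with h1 h2
    · simp only [Valid]; rw [x.lev_seq]; exact h1
    · subst h2; exact hmid
    · exact htop n (by omega)⟩
  lev_seq n := x.lev_seq n
  par_seq n := by
    apply Subtype.ext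
    refine Prod.ext (x.par_seq n) ?_
    change parAux G k (G.lev (x.seq (n+1)))
      (if n + 1 ≤ k then Aux.low else if n + 1 = k + 1 then Aux.mid S else top) =
      if n ≤ k then Aux.low else if n = k + 1 then Aux.mid S else top
    rw [x.lev_seq]
    split_ifs with h1 h2 h3 h4 h5 h6 h7 <;> first | omega | rfl | skip
    · obtain rfl : n = k + 1 := by omega
      exact hpar
    · exact hpar' _ (by omega)

theorem mkPlay_cons (x : Play G) (S : Set G.Pos) (top : Aux G.Pos)
    (hmid : Valid G k C (x.seq (k+1)) (Aux.mid S)) (htop : ∀ n, k + 2 ≤ n → Valid G k C (x.seq n) top)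
    (hpar : parAux G k (k+2) top = Aux.mid S) (hpar' : ∀ l, k + 2 < l → parAux G k l top = top)
    (i : Bool) (σ : Strat (UA G k C hk)) (m : ℕ)
    (c1 : ∀ n, m ≤ n → n < k → tn n = i → x.seq (n+1) = (mv1 hk σ (x.seq n) Aux.low).1)
    (c2 : i = true → mv1 hk σ (x.seq k) Aux.low = (x.seq (k+1), Aux.mid S))
    (c3 : i = false → mv1 hk σ (x.seq (k+1)) (Aux.mid S) = (x.seq (k+2), top))
    (c4 : ∀ n, k + 2 ≤ n → tn n = i → x.seq (n+1) = (mv1 hk σ (x.seq n) top).1) :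
    Consistent i σ m (mkPlay hk x S top hmid htop hpar hpar') := by
  intro n hn hi
  apply Subtype.ext
  have hlow : ∀ j, j ≤ k → Valid G k C (x.seq j) Aux.low := by
    intro j hj; simp only [Valid]; rw [x.lev_seq]; exact hj
  have key : ∀ a, Valid G k C (x.seq n) a →
      a = (if n ≤ k then Aux.low else if n = k + 1 then Aux.mid S else top) →
      (σ.1 ((mkPlay hk x S top hmid htop hpar hpar').seq n)).1 = mv1 hk σ (x.seq n) a := by
    intro a hv ha
    rw [mv1_eq hk σ hv]
    subst ha
    rfl
  change (x.seq (n+1), _) = _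
  rcases Nat.lt_or_ge n k with h | h
  · rw [key Aux.low (hlow n h.le) (by rw [if_pos h.le])]
    refine Prod.ext (c1 n hn h hi) ?_
    change (if n + 1 ≤ k then Aux.low else if n + 1 = k + 1 then Aux.mid S else top) = _
    have hv := mv1_valid hk σ (hlow n h.le)
    rw [valid_low hv (by rw [(mv1_isCh hk σ _ _).1, x.lev_seq]; omega)]
    rw [if_pos (by omega)]
  · rcases Nat.eq_or_lt_of_le h with h | h
    · subst h
      rw [key Aux.low (hlow _ le_rfl) (by rw [if_pos le_rfl]), c2 (by rw [← hi, hk])]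
      simp
    · rcases Nat.eq_or_lt_of_le h with h | h
      · have h : n = k + 1 := h.symm
        subst h
        rw [key (Aux.mid S) hmid (by simp), c3 (by rw [← hi, tn_succ, hk]; rfl)]
        simp
      · have hh : k + 2 ≤ n := h
        rw [key top (htop n hh) (by rw [if_neg (by omega), if_neg (by omega)])]
        refine Prod.ext (c4 n hh hi) ?_
        rw [mv1_high hk σ (htop n hh) (by rw [x.lev_seq]; exact hh)]
        change (if n + 1 ≤ k then Aux.low else if n + 1 = k + 1 then Aux.mid S else top) = _
        rw [if_neg (by omega), if_neg (by omega)]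

theorem mkPlay_play (x : Play G) (S : Set G.Pos) (top : Aux G.Pos)
    (hmid : Valid G k C (x.seq (k+1)) (Aux.mid S)) (htop : ∀ n, k + 2 ≤ n → Valid G k C (x.seq n) top)
    (hpar : parAux G k (k+2) top = Aux.mid S) (hpar' : ∀ l, k + 2 < l → parAux G k l top = top) :
    (UAhom hk).play (mkPlay hk x S top hmid htop hpar hpar') = x := rfl

/-- In the `h1` phase below `w`, the move is forced. -/
theorem mv1_forced (σ : Strat (UA G k C hk)) (t S w) (h : Valid G k C t (Aux.h1 S w))
    (hl : G.lev t < G.lev w) : (mv1 hk σ t (Aux.h1 S w)).1 = G.anc (G.lev t + 1) w := by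
  have h1 := mv1_valid hk σ h
  have h2 := mv1_high hk σ h h.1
  rw [h2] at h1
  have h3 := h1.2.2.1 (G.lev t + 1) (by rw [(mv1_isCh hk σ _ _).1]) hl
  rw [← h3, G.anc_self' _ _ (by rw [(mv1_isCh hk σ _ _).1])]

end unravel

end BD


namespace BD

universe u

section unravel
variable {G : Arena.{u}} {k : ℕ} {C : Set G.Pos} (hk : tn k = true)

/-- `t` has an ancestor of level `≥ k+2` in `B`. -/
def HasAnc (k : ℕ) (B : Set G.Pos) (t : G.Pos) : Prop :=
  ∃ n, k + 2 ≤ n ∧ n ≤ G.lev t ∧ G.anc n t ∈ B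

open Classical in
noncomputable def firstAnc (k : ℕ) (B : Set G.Pos) (t : G.Pos) : G.Pos :=
  if h : HasAnc k B t then G.anc (Nat.find h) t else t

theorem firstAnc_play (x : Play G) (B : Set G.Pos) (n0 n : ℕ) (h0 : k + 2 ≤ n0) (hn : n0 ≤ n)
    (hB : x.seq n0 ∈ B) (hmin : ∀ i, k + 2 ≤ i → i < n0 → x.seq i ∉ B) :
    HasAnc k B (x.seq n) ∧ firstAnc k B (x.seq n) = x.seq n0 := by
  classical
  have hex : HasAnc k B (x.seq n) := ⟨n0, h0, by rw [x.lev_seq]; exact hn, by rw [x.anc _ _ hn]; exact hB⟩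
  refine ⟨hex, ?_⟩
  have : Nat.find hex = n0 := by
    refine (Nat.find_eq_iff hex).2 ⟨⟨h0, by rw [x.lev_seq]; exact hn, by rw [x.anc _ _ hn]; exact hB⟩, ?_⟩
    rintro i hi ⟨a1, a2, a3⟩
    rw [x.anc _ _ (by omega)] at a3
    exact hmin i a1 hi a3
  simp only [firstAnc]
  rw [dif_pos hex, this, x.anc _ _ hn]

theorem not_hasAnc_play (x : Play G) (B : Set G.Pos) (n : ℕ)
    (h : ∀ i, k + 2 ≤ i → i ≤ n → x.seq i ∉ B) : ¬ HasAnc k B (x.seq n) := by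
  rintro ⟨i, a1, a2, a3⟩
  rw [x.lev_seq] at a2
  rw [x.anc _ _ a2] at a3
  exact h i a1 a2 a3

/-! Player I -/

def auxS : Aux G.Pos → Set G.Pos
  | Aux.mid S => S
  | _ => ∅

open Classical in
noncomputable def phiT (k : ℕ) (C S : Set G.Pos) (mvt : Aux G.Pos → G.Pos) (t : G.Pos) : G.Pos :=
  if HasAnc k Cᶜ t then mvt (Aux.h1 S (firstAnc k Cᶜ t))
  else if t ∈ Win G true S Cᶜ then att G true S Cᶜ t
  else mvt (Aux.h2 S (S \ Win G true S Cᶜ))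

noncomputable def PT (σ : Strat (UA G k C hk)) : Strat G :=
  mkStrat G fun t => if G.lev t ≤ k then (mv1 hk σ t Aux.low).1
    else phiT k C (auxS (mv1 hk σ (G.anc k t) Aux.low).2) (fun a => (mv1 hk σ t a).1) t

theorem PT_low (σ : Strat (UA G k C hk)) (t : G.Pos) (h : G.lev t ≤ k) :
    (PT hk σ).1 t = (mv1 hk σ t Aux.low).1 := by
  rw [PT, mkStrat_eq]
  · rw [if_pos h]
  · rw [if_pos h]; exact mv1_isCh hk σ _ _

theorem PT_high (σ : Strat (UA G k C hk)) (t : G.Pos) (h : k < G.lev t) (S)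
    (hS : auxS (mv1 hk σ (G.anc k t) Aux.low).2 = S)
    (hc : G.IsCh t (phiT k C S (fun a => (mv1 hk σ t a).1) t)) :
    (PT hk σ).1 t = phiT k C S (fun a => (mv1 hk σ t a).1) t := by
  rw [PT, mkStrat_eq]
  · rw [if_neg (by omega), hS]
  · rw [if_neg (by omega), hS]; exact hc

theorem PT_loc (n : ℕ) (σ σ' : Strat (UA G k C hk))
    (h : ∀ p, (UA G k C hk).lev p < n → σ.1 p = σ'.1 p) (p : G.Pos) (hp : G.lev p < n) :
    (PT hk σ).1 p = (PT hk σ').1 p := by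
  apply mkStrat_congr
  have h1 : ∀ a, mv1 hk σ p a = mv1 hk σ' p a := fun a => mv1_loc hk σ σ' n h p a hp
  simp only [h1]
  split_ifs with hl
  · rfl
  · rw [mv1_loc hk σ σ' n h (G.anc k p) _ (by rw [G.lev_anc _ _ (by omega)]; omega)]

theorem par_h1 (S w) : parAux G k (k+2) (Aux.h1 S w) = Aux.mid S := by simp [parAux]
theorem par_h2 (S w) : parAux G k (k+2) (Aux.h2 S w) = Aux.mid S := by simp [parAux]
theorem par_h1' (S w) (l) (h : k + 2 < l) : parAux G k l (Aux.h1 S w) = Aux.h1 S w := by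
  have : l ≠ k + 2 := by omega
  simp [parAux, this]
theorem par_h2' (S w) (l) (h : k + 2 < l) : parAux G k l (Aux.h2 S w) = Aux.h2 S w := by
  have : l ≠ k + 2 := by omega
  simp [parAux, this]

theorem valid_h1_play (x : Play G) (S : Set G.Pos) (n0 : ℕ) (h0 : k + 2 ≤ n0)
    (hS : ∀ i, k + 2 ≤ i → i ≤ n0 → x.seq i ∈ S) (hC : x.seq n0 ∉ C) (hQ : QI G S)
    (hq : x.seq (k+1) ∈ S) (n : ℕ) (hn : k + 2 ≤ n) :
    Valid G k C (x.seq n) (Aux.h1 S (x.seq n0)) := by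
  refine ⟨by rw [x.lev_seq]; exact hn, by rw [x.lev_seq]; exact h0, ?_, ?_, hC, hQ, ?_⟩
  · intro i h1 h2
    rw [x.lev_seq] at h1 h2
    rw [x.anc _ _ h1, x.anc _ _ h2]
  · intro i h1 h2
    rw [x.lev_seq] at h2
    rw [x.anc _ _ h2]; exact hS i h1 h2
  · rw [x.anc _ _ (by omega)]; exact hq

theorem valid_h2_play (x : Play G) (S S2 : Set G.Pos) (n : ℕ)
    (hS : ∀ i, k + 2 ≤ i → i ≤ n → x.seq i ∈ S2) (hQ : QI G S) (hQ2 : QII G C S S2)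
    (hq : x.seq (k+1) ∈ S) (hn : k + 2 ≤ n) :
    Valid G k C (x.seq n) (Aux.h2 S S2) := by
  refine ⟨by rw [x.lev_seq]; exact hn, ?_, hQ, ?_, hQ2⟩
  · intro i h1 h2
    rw [x.lev_seq] at h2
    rw [x.anc _ _ h2]; exact hS i h1 h2
  · rw [x.anc _ _ (by omega)]; exact hq

theorem QII_win (S : Set G.Pos) : QII G C S (S \ Win G true S Cᶜ) := by
  rintro p ⟨hpS, hpW⟩
  refine ⟨hpS, ?_, ?_, ?_⟩
  · by_contra hC; exact hpW (win_base hC)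
  · intro ho c hc hcS
    exact ⟨hcS, not_win_own hpW ho hc hcS⟩
  · intro ho
    obtain ⟨c, h1, h2, h3⟩ := not_win_oth hpW (by rw [ho]; simp)
    exact ⟨c, h1, h2, h3⟩

theorem PT_lift (σ : Strat (UA G k C hk)) (m : ℕ) (x : Play G) (hm : m ≤ k)
    (hx : Consistent true (PT hk σ) m x) :
    ∃ y, Consistent true σ m y ∧ (UAhom hk).play y = x := by
  classical
  have hvk : Valid G k C (x.seq k) Aux.low := by simp only [Valid]; rw [x.lev_seq]
  have hxk : x.seq (k+1) = (mv1 hk σ (x.seq k) Aux.low).1 := by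
    rw [hx k hm hk, PT_low]; rw [x.lev_seq]
  have hv := mv1_valid hk σ hvk
  rw [← hxk] at hv
  obtain ⟨S, hS⟩ := valid_mid hv (by rw [x.lev_seq])
  rw [hS] at hv
  obtain ⟨-, hqS, hQ⟩ := id hv
  have hc2 : mv1 hk σ (x.seq k) Aux.low = (x.seq (k+1), Aux.mid S) := Prod.ext hxk.symm hS
  have hc1 : ∀ n, m ≤ n → n < k → tn n = true → x.seq (n+1) = (mv1 hk σ (x.seq n) Aux.low).1 := by
    intro n h1 h2 h3
    rw [hx n h1 h3, PT_low]; rw [x.lev_seq]; omega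
  have hhigh : ∀ n, k + 2 ≤ n → tn n = true →
      G.IsCh (x.seq n) (phiT k C S (fun a => (mv1 hk σ (x.seq n) a).1) (x.seq n)) →
      x.seq (n+1) = phiT k C S (fun a => (mv1 hk σ (x.seq n) a).1) (x.seq n) := by
    intro n h1 h2 h3
    rw [hx n (by omega) h2]
    apply PT_high hk σ _ _ S _ h3
    · rw [x.lev_seq]; omega
    · rw [x.anc _ _ (by omega), hS]; rfl
  set W := Win G true S Cᶜ with hW
  have hatt : ∀ n, k + 2 ≤ n → tn n = true → (∀ i, k + 2 ≤ i → i ≤ n → x.seq i ∈ C) →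
      x.seq n ∈ W → x.seq (n+1) = att G true S Cᶜ (x.seq n) := by
    intro n h1 h2 h3 h4
    have hna : ¬ HasAnc k Cᶜ (x.seq n) :=
      not_hasAnc_play x _ n (fun i a b hc => hc (h3 i a b))
    have e : phiT k C S (fun a => (mv1 hk σ (x.seq n) a).1) (x.seq n) = att G true S Cᶜ (x.seq n) := by
      rw [phiT, if_neg hna, if_pos h4]
    have := hhigh n h1 h2
    rw [e] at this
    exact this (att_spec h4 (by rw [x.lev_seq]; exact h2) (fun hc => hc (h3 n h1 le_rfl))).1
  have hstay : ∀ n, k + 2 ≤ n → tn n = true → (∀ i, k + 2 ≤ i → i ≤ n → x.seq i ∈ C) →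
      x.seq n ∉ W → x.seq (n+1) = (mv1 hk σ (x.seq n) (Aux.h2 S (S \ W))).1 := by
    intro n h1 h2 h3 h4
    have hna : ¬ HasAnc k Cᶜ (x.seq n) :=
      not_hasAnc_play x _ n (fun i a b hc => hc (h3 i a b))
    have e : phiT k C S (fun a => (mv1 hk σ (x.seq n) a).1) (x.seq n) =
        (mv1 hk σ (x.seq n) (Aux.h2 S (S \ W))).1 := by
      rw [phiT, if_neg hna, if_neg h4]
    have := hhigh n h1 h2
    rw [e] at this
    exact this (mv1_isCh hk σ _ _)
  have hmono : ∀ n, k + 2 ≤ n → (∀ i, k + 2 ≤ i → i ≤ n → x.seq i ∈ C) → x.seq (n+1) ∈ S →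
      x.seq n ∈ W → x.seq (n+1) ∈ W := by
    intro n h1 h2 h3 h4
    by_cases ho : tn n = true
    · rw [hatt n h1 ho h2 h4]
      exact (att_spec h4 (by rw [x.lev_seq]; exact ho) (fun hc => hc (h2 n h1 le_rfl))).2.2.1
    · exact (oth_rank h4 (by rw [x.lev_seq]; exact ho) (fun hc => hc (h2 n h1 le_rfl)) (x.isCh n) h3).1
  have hk1 : tn (k+1) = false := by rw [tn_succ, hk]; rfl
  -- the play stays in S as long as it is in C
  have hinS : ∀ N, (∀ i, k + 2 ≤ i → i < N → x.seq i ∈ C) → ∀ j, k + 1 ≤ j → j ≤ N → x.seq j ∈ S := by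
    intro N hN j hj
    induction j using Nat.strong_induction_on with
    | _ j ih =>
      intro hjN
      rcases Nat.eq_or_lt_of_le hj with h | h
      · rw [← h]; exact hqS
      · obtain ⟨l, rfl⟩ : ∃ l, j = l + 1 := ⟨j - 1, by omega⟩
        have hl := ih l (by omega) (by omega) (by omega)
        by_cases ho : tn l = true
        · have hlk : k + 2 ≤ l := by
            by_contra hcon
            obtain rfl : l = k + 1 := by omega
            rw [hk1] at ho; simp at ho
          have hC : ∀ i, k + 2 ≤ i → i ≤ l → x.seq i ∈ C := fun i a b => hN i a (by omega)
          by_cases hw : x.seq l ∈ W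
          · rw [hatt l hlk ho hC hw]
            exact (att_spec hw (by rw [x.lev_seq]; exact ho) (fun hc => hc (hC l hlk le_rfl))).2.1
          · have hno : ∀ d i, k + 2 ≤ i → i + d = l → x.seq i ∉ W := by
              intro d
              induction d with
              | zero => intro i h1 h2; rw [show i = l by omega]; exact hw
              | succ d ihd =>
                intro i h1 h2 hiW
                exact ihd (i+1) (by omega) (by omega)
                  (hmono i h1 (fun a b c => hC a b (by omega)) (ih (i+1) (by omega) (by omega) (by omega)) hiW)
            have hval : Valid G k C (x.seq l) (Aux.h2 S (S \ W)) := by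
              refine valid_h2_play x S _ l ?_ hQ (QII_win S) hqS hlk
              intro i h1 h2
              exact ⟨ih i (by omega) (by omega) (by omega), hno (l - i) i h1 (by omega)⟩
            have h1 := mv1_valid hk σ hval
            rw [mv1_high hk σ hval (by rw [x.lev_seq]; exact hlk), ← hstay l hlk ho hC hw] at h1
            have := h1.2.1 (l+1) (by omega) (by rw [x.lev_seq])
            rw [x.anc _ _ le_rfl] at this
            exact this.1
        · exact (hQ _ hl).1 (by rw [x.lev_seq]; simpa using ho) _ (x.isCh l)
  by_cases hex : ∃ n, k + 2 ≤ n ∧ x.seq n ∉ C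
  · obtain ⟨h0, h0C⟩ := Nat.find_spec hex
    set n0 := Nat.find hex with hn0
    have hmin : ∀ i, k + 2 ≤ i → i < n0 → x.seq i ∈ C := by
      intro i h1 h2
      by_contra hc
      exact Nat.find_min hex h2 ⟨h1, hc⟩
    have hSS := hinS n0 hmin
    have hval := valid_h1_play (C := C) x S n0 h0 (fun i a b => hSS i (by omega) b) h0C hQ hqS
    refine ⟨mkPlay hk x S (Aux.h1 S (x.seq n0)) hv hval (par_h1 _ _) (par_h1' _ _), ?_, rfl⟩
    apply mkPlay_cons
    · exact hc1
    · exact fun _ => hc2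
    · intro h; simp at h
    · intro n hn ho
      rcases Nat.lt_or_ge n n0 with h | h
      · rw [mv1_forced hk σ _ _ _ (hval n hn) (by rw [x.lev_seq, x.lev_seq]; exact h), x.lev_seq,
          x.anc _ _ (by omega)]
      · have hfa := firstAnc_play x Cᶜ n0 n h0 h h0C (fun i a b hc => hc (hmin i a b))
        have e : phiT k C S (fun a => (mv1 hk σ (x.seq n) a).1) (x.seq n) =
            (mv1 hk σ (x.seq n) (Aux.h1 S (x.seq n0))).1 := by
          rw [phiT, if_pos hfa.1, hfa.2]
        have := hhigh n hn ho
        rw [e] at this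
        exact this (mv1_isCh hk σ _ _)
  · push Not at hex
    have hSS : ∀ j, k + 1 ≤ j → x.seq j ∈ S := fun j hj => hinS j (fun i a _ => hex i a) j hj le_rfl
    have hnW : ∀ j, k + 2 ≤ j → x.seq j ∉ W := by
      intro j hj hw
      obtain ⟨n, hn, hB⟩ := att_hit x j hw
        (fun n h1 h2 h3 h4 => hatt n (by omega) h4 (fun i a _ => hex i a) h2)
        (fun n h1 h2 h3 h4 => hSS (n+1) (by omega))
      exact hB (hex n (by omega))
    have hval : ∀ n, k + 2 ≤ n → Valid G k C (x.seq n) (Aux.h2 S (S \ W)) := by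
      intro n hn
      exact valid_h2_play x S _ n (fun i a b => ⟨hSS i (by omega), hnW i a⟩) hQ (QII_win S) hqS hn
    refine ⟨mkPlay hk x S (Aux.h2 S (S \ W)) hv hval (par_h2 _ _) (par_h2' _ _), ?_, rfl⟩
    apply mkPlay_cons
    · exact hc1
    · exact fun _ => hc2
    · intro h; simp at h
    · intro n hn ho
      exact hstay n hn ho (fun i a _ => hex i a) (hnW n hn)

/-! Player II -/

def USet (G : Arena.{u}) (k : ℕ) (C : Set G.Pos) (q : G.Pos) (mvq : Aux G.Pos → G.Pos × Aux G.Pos) :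
    Set G.Pos :=
  {w | ∃ S r, Valid G k C q (Aux.mid S) ∧ mvq (Aux.mid S) = (r, Aux.h1 S w)}

open Classical in
noncomputable def Su (G : Arena.{u}) (k : ℕ) (C : Set G.Pos) (q : G.Pos)
    (mvq : Aux G.Pos → G.Pos × Aux G.Pos) (w : G.Pos) : Set G.Pos :=
  if h : w ∈ USet G k C q mvq then h.choose else ∅

theorem Su_spec {q : G.Pos} {mvq : Aux G.Pos → G.Pos × Aux G.Pos} {w : G.Pos}
    (h : w ∈ USet G k C q mvq) : ∃ r, Valid G k C q (Aux.mid (Su G k C q mvq w)) ∧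
      mvq (Aux.mid (Su G k C q mvq w)) = (r, Aux.h1 (Su G k C q mvq w) w) := by
  have : Su G k C q mvq w = h.choose := dif_pos h
  rw [this]
  exact h.choose_spec

def auxS2 : Aux G.Pos → Set G.Pos
  | Aux.h2 _ S2 => S2
  | _ => ∅

open Classical in
noncomputable def phiF (k : ℕ) (C : Set G.Pos) (q : G.Pos) (mvq : Aux G.Pos → G.Pos × Aux G.Pos)
    (mvt : Aux G.Pos → G.Pos) (t : G.Pos) : G.Pos :=
  let U := USet G k C q mvq
  let W := Win G false Set.univ U
  if HasAnc k U t then mvt (Aux.h1 (Su G k C q mvq (firstAnc k U t)) (firstAnc k U t))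
  else if t ∈ W then att G false Set.univ U t
  else if G.lev t = k + 1 then mvt (Aux.mid Wᶜ)
  else mvt (Aux.h2 Wᶜ (auxS2 (mvq (Aux.mid Wᶜ)).2))

noncomputable def PF (σ : Strat (UA G k C hk)) : Strat G :=
  mkStrat G fun t => if G.lev t ≤ k then (mv1 hk σ t Aux.low).1
    else phiF k C (G.anc (k+1) t) (mv1 hk σ (G.anc (k+1) t)) (fun a => (mv1 hk σ t a).1) t

theorem PF_low (σ : Strat (UA G k C hk)) (t : G.Pos) (h : G.lev t ≤ k) :
    (PF hk σ).1 t = (mv1 hk σ t Aux.low).1 := by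
  rw [PF, mkStrat_eq]
  · rw [if_pos h]
  · rw [if_pos h]; exact mv1_isCh hk σ _ _

theorem PF_high (σ : Strat (UA G k C hk)) (t : G.Pos) (h : k < G.lev t) (q)
    (hq : G.anc (k+1) t = q) (r : G.Pos)
    (hr : phiF k C q (mv1 hk σ q) (fun a => (mv1 hk σ t a).1) t = r)
    (hc : G.IsCh t r) :
    (PF hk σ).1 t = r := by
  rw [PF, mkStrat_eq]
  · rw [if_neg (by omega), hq, hr]
  · rw [if_neg (by omega), hq, hr]; exact hc

theorem PF_loc (n : ℕ) (σ σ' : Strat (UA G k C hk))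
    (h : ∀ p, (UA G k C hk).lev p < n → σ.1 p = σ'.1 p) (p : G.Pos) (hp : G.lev p < n) :
    (PF hk σ).1 p = (PF hk σ').1 p := by
  apply mkStrat_congr
  have h1 : ∀ a, mv1 hk σ p a = mv1 hk σ' p a := fun a => mv1_loc hk σ σ' n h p a hp
  simp only [h1]
  split_ifs with hl
  · rfl
  · have h2 : mv1 hk σ (G.anc (k+1) p) = mv1 hk σ' (G.anc (k+1) p) := by
      funext a
      exact mv1_loc hk σ σ' n h (G.anc (k+1) p) _ (by rw [G.lev_anc _ _ (by omega)]; omega)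
    rw [h2]

theorem PF_lift (σ : Strat (UA G k C hk)) (m : ℕ) (x : Play G) (hm : m ≤ k)
    (hx : Consistent false (PF hk σ) m x) :
    ∃ y, Consistent false σ m y ∧ (UAhom hk).play y = x := by
  classical
  have hc1 : ∀ n, m ≤ n → n < k → tn n = false → x.seq (n+1) = (mv1 hk σ (x.seq n) Aux.low).1 := by
    intro n h1 h2 h3
    rw [hx n h1 h3, PF_low]; rw [x.lev_seq]; omega
  have hk1 : tn (k+1) = false := by rw [tn_succ, hk]; rfl
  have hk2 : tn (k+2) = true := by rw [tn_succ, hk1]; rfl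
  set q := x.seq (k+1) with hq
  have hhigh : ∀ n, k + 1 ≤ n → tn n = false → ∀ r,
      phiF k C q (mv1 hk σ q) (fun a => (mv1 hk σ (x.seq n) a).1) (x.seq n) = r →
      G.IsCh (x.seq n) r → x.seq (n+1) = r := by
    intro n h1 h2 r h3 h4
    rw [hx n (by omega) h2]
    exact PF_high hk σ _ (by rw [x.lev_seq]; omega) q (x.anc _ _ h1) r h3 h4
  set U := USet G k C q (mv1 hk σ q) with hU
  set W := Win G false Set.univ U with hW
  have hUspec : ∀ w ∈ U, k + 2 ≤ G.lev w := by
    rintro w ⟨S, r, h1, h2⟩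
    have := mv1_valid hk σ h1
    rw [h2] at this
    exact this.2.1
  by_cases hex : ∃ n, k + 2 ≤ n ∧ x.seq n ∈ U
  · obtain ⟨h0, h0U⟩ := Nat.find_spec hex
    set n0 := Nat.find hex with hn0
    have hmin : ∀ i, k + 2 ≤ i → i < n0 → x.seq i ∉ U :=
      fun i h1 h2 hc => Nat.find_min hex h2 ⟨h1, hc⟩
    obtain ⟨r, hv, hr⟩ := Su_spec h0U
    set S := Su G k C q (mv1 hk σ q) (x.seq n0) with hS
    have hvr := mv1_valid hk σ hv
    have hrc := mv1_isCh hk σ q (Aux.mid S)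
    rw [hr] at hvr hrc
    obtain ⟨a1, a2, a3, a4, a5, a6, a7⟩ := hvr
    have hlr : G.lev r = k + 2 := by rw [hrc.1, hq, x.lev_seq]
    have hrx : r = x.seq (k+2) := by
      have := a3 (k+2) (by dsimp only; omega) (by rw [x.lev_seq]; exact h0)
      rw [G.anc_self' _ _ (by dsimp only; omega), x.anc _ _ h0] at this
      exact this
    have hval := valid_h1_play (C := C) x S n0 h0 (fun i a b => by
      have := a4 i a (by rw [x.lev_seq]; exact b)
      rwa [x.anc _ _ b] at this) a5 hv.2.2 hv.2.1
    refine ⟨mkPlay hk x S (Aux.h1 S (x.seq n0)) hv hval (par_h1 _ _) (par_h1' _ _), ?_, rfl⟩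
    apply mkPlay_cons
    · exact hc1
    · intro h; simp at h
    · intro _
      rw [← hq, hr, hrx]
    · intro n hn ho
      rcases Nat.lt_or_ge n n0 with h | h
      · rw [mv1_forced hk σ _ _ _ (hval n hn) (by rw [x.lev_seq, x.lev_seq]; exact h), x.lev_seq,
          x.anc _ _ (by omega)]
      · have hfa := firstAnc_play x U n0 n h0 h h0U hmin
        apply hhigh n (by omega) ho
        · simp only [phiF]
          rw [if_pos hfa.1, hfa.2]
        · exact mv1_isCh hk σ _ _
  · push Not at hex
    have hna : ∀ n, ¬ HasAnc k U (x.seq n) := fun n =>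
      not_hasAnc_play x _ n (fun i a b => hex i a)
    have hnU : ∀ n, k + 1 ≤ n → x.seq n ∉ U := by
      intro n hn hc
      have := hUspec _ hc
      rw [x.lev_seq] at this
      exact hex n this hc
    have hnW : ∀ j, k + 1 ≤ j → x.seq j ∉ W := by
      intro j hj hw
      obtain ⟨n, hn, hB⟩ := att_hit x j hw
        (fun n h1 h2 h3 h4 => by
          apply hhigh n (by omega) h4
          · simp only [phiF]
            rw [if_neg (hna n), if_pos h2]
          · exact (att_spec h2 (by rw [x.lev_seq]; exact h4) (hnU n (by omega))).1)
        (fun n h1 h2 h3 h4 => Set.mem_univ _)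
      exact hnU n (by omega) hB
    have hQ : QI G Wᶜ := by
      intro p hp
      refine ⟨fun ho c hc => not_win_own hp ho hc (Set.mem_univ _), fun ho => ?_⟩
      obtain ⟨c, b1, b2, b3⟩ := not_win_oth hp (by rw [ho]; simp)
      exact ⟨c, b1, b3⟩
    have hv : Valid G k C q (Aux.mid Wᶜ) := ⟨by rw [hq, x.lev_seq], hnW _ le_rfl, hQ⟩
    have hvr := mv1_valid hk σ hv
    obtain ⟨S2, hS2⟩ : ∃ S2, (mv1 hk σ q (Aux.mid Wᶜ)).2 = Aux.h2 Wᶜ S2 := by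
      rcases mv1_mid hk σ hv with ⟨w, hw⟩ | h
      · exfalso
        rw [hw] at hvr
        have h1 := hvr.2.2.2.1 (G.lev w) hvr.2.1 le_rfl
        rw [G.anc_self] at h1
        exact h1 (win_base ⟨Wᶜ, _, hv, Prod.ext rfl hw⟩)
      · exact h
    have hxk : x.seq (k+2) = (mv1 hk σ q (Aux.mid Wᶜ)).1 := by
      apply hhigh (k+1) le_rfl hk1
      · simp only [phiF]
        rw [if_neg (hna _), if_neg (hnW _ le_rfl), if_pos (x.lev_seq _)]
      · exact mv1_isCh hk σ _ _
    rw [hS2, ← hxk] at hvr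
    obtain ⟨a1, a2, a3, a4, a5⟩ := hvr
    have hstep : ∀ n, k + 2 ≤ n → tn n = false →
        x.seq (n+1) = (mv1 hk σ (x.seq n) (Aux.h2 Wᶜ S2)).1 := by
      intro n hn ho
      apply hhigh n (by omega) ho
      · simp only [phiF]
        rw [if_neg (hna _), if_neg (hnW _ (by omega)), if_neg (by rw [x.lev_seq]; omega), ← hU, ← hW, hS2]
        rfl
      · exact mv1_isCh hk σ _ _
    have hinS : ∀ j, k + 2 ≤ j → x.seq j ∈ S2 := by
      intro j hj
      induction j using Nat.strong_induction_on with
      | _ j ih =>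
        rcases Nat.eq_or_lt_of_le hj with h | h
        · rw [← h]
          have := a2 (k+2) le_rfl (by rw [x.lev_seq])
          rwa [x.anc _ _ le_rfl] at this
        · obtain ⟨l, rfl⟩ : ∃ l, j = l + 1 := ⟨j - 1, by omega⟩
          have hl := ih l (by omega) (by omega)
          cases ho : tn l with
          | true => exact (a5 _ hl).2.2.1 (by rw [x.lev_seq]; exact ho) _ (x.isCh l) (hnW _ (by omega))
          | false =>
            have hval : Valid G k C (x.seq l) (Aux.h2 Wᶜ S2) :=
              valid_h2_play x _ _ l (fun i b c => ih i (by omega) b) hQ a5 (hnW _ le_rfl) (by omega)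
            have h1 := mv1_valid hk σ hval
            rw [mv1_high hk σ hval (by rw [x.lev_seq]; omega), ← hstep l (by omega) ho] at h1
            have := h1.2.1 (l+1) (by omega) (by rw [x.lev_seq])
            rwa [x.anc _ _ le_rfl] at this
    have hval : ∀ n, k + 2 ≤ n → Valid G k C (x.seq n) (Aux.h2 Wᶜ S2) := fun n hn =>
      valid_h2_play x _ _ n (fun i b c => hinS i b) hQ a5 (hnW _ le_rfl) hn
    refine ⟨mkPlay hk x Wᶜ (Aux.h2 Wᶜ S2) hv hval (par_h2 _ _) (par_h2' _ _), ?_, rfl⟩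
    apply mkPlay_cons
    · exact hc1
    · intro h; simp at h
    · intro _
      exact Prod.ext hxk.symm hS2
    · exact hstep

noncomputable def UAcover : Cover k (UA G k C hk) G where
  toHom := UAhom hk
  inj := by
    rintro ⟨⟨t, a⟩, ha⟩ ⟨⟨t', a'⟩, ha'⟩ hp (h : t = t')
    subst h
    have hp : G.lev t ≤ k := hp
    obtain rfl := valid_low ha hp
    obtain rfl := valid_low ha' hp
    rfl
  surj p hp := ⟨⟨(p, Aux.low), hp⟩, rfl⟩
  φ b σ := match b with
    | true => PT hk σ
    | false => PF hk σ
  loc := by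
    rintro (_ | _) n σ σ' h p hp
    · exact PF_loc hk n σ σ' h p hp
    · exact PT_loc hk n σ σ' h p hp
  idl := by
    rintro i σ ⟨⟨t, a⟩, ha⟩ hp
    have hp : G.lev t < k := hp
    obtain rfl := valid_low ha hp.le
    cases i with
    | true =>
      change (PT hk σ).1 t = _
      rw [PT_low hk σ t hp.le, mv1_eq hk σ ha]; rfl
    | false =>
      change (PF hk σ).1 t = _
      rw [PF_low hk σ t hp.le, mv1_eq hk σ ha]; rfl
  lift := by
    rintro (_ | _) σ m x hm hx
    · exact PF_lift hk σ m x hm hx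
    · exact PT_lift hk σ m x hm hx

theorem UA_high (y : Play (UA G k C hk)) (n : ℕ) (hn : k + 2 ≤ n) :
    (y.seq n).1.2 = (y.seq (k+2)).1.2 := by
  induction n, hn using Nat.le_induction with
  | base => rfl
  | succ n hn ih =>
    rw [← ih]
    exact aux_of_high hk (y.isCh n) (by have : G.lev (y.seq n).1.1 = n := y.lev_seq n; omega)

theorem UA_clop (hC : ∀ p, 0 < G.lev p → p ∈ C → G.par p ∈ C) :
    IsClop ((UAhom (C := C) hk).play ⁻¹' {x | ∀ n, x.seq n ∈ C}) := by
  have key : ∀ y : Play (UA G k C hk), y ∈ ((UAhom (C := C) hk).play ⁻¹' {x | ∀ n, x.seq n ∈ C}) ↔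
      ∃ S S2, (y.seq (k+2)).1.2 = Aux.h2 S S2 := by
    intro y
    set x := (UAhom (C := C) hk).play y with hx
    have hl : ∀ n, G.lev (y.seq n).1.1 = n := y.lev_seq
    constructor
    · intro h
      have h : ∀ n, x.seq n ∈ C := h
      have hv := (y.seq (k+2)).2
      cases ha : (y.seq (k+2)).1.2 with
      | low => rw [ha] at hv; simp only [Valid] at hv; rw [hl] at hv; omega
      | mid S => rw [ha] at hv; have := hv.1; rw [hl] at this; omega
      | h2 S S2 => exact ⟨S, S2, rfl⟩
      | h1 S w =>
        exfalso
        rw [ha] at hv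
        have hlw := hv.2.1
        have hv' := (y.seq (G.lev w)).2
        rw [UA_high hk y _ hlw, ha] at hv'
        have := hv'.2.2.1 (G.lev w) (by rw [hl]) le_rfl
        rw [G.anc_self, G.anc_self' _ _ (by rw [hl])] at this
        exact hv.2.2.2.2.1 (this ▸ h (G.lev w))
    · rintro ⟨S, S2, ha⟩
      have hbig : ∀ n, k + 2 ≤ n → x.seq n ∈ C := by
        intro n hn
        have hv := (y.seq n).2
        rw [UA_high hk y n hn, ha] at hv
        have := hv.2.1 n hn (by rw [hl])
        rw [G.anc_self' _ _ (by rw [hl])] at this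
        exact (hv.2.2.2.2 _ this).2.1
      have hdown : ∀ d n, k + 2 ≤ n + d → x.seq n ∈ C := by
        intro d
        induction d with
        | zero => exact fun n hn => hbig n hn
        | succ d ih => intro n hn; rw [← x.par_seq]; exact hC _ (by rw [x.lev_seq]; omega) (ih (n+1) (by omega))
      exact fun n => hdown (k+2) n (by omega)
  constructor
  · intro y hy
    rw [key] at hy
    refine ⟨k+2, fun z hz => ?_⟩
    rw [key, hz]; exact hy
  · intro y hy
    refine ⟨k+2, fun z hz hc => hy ?_⟩
    rw [key] at hc ⊢
    rw [← hz]; exact hc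

end unravel

end BD


namespace BD

universe u

def Unrav {G : Arena.{u}} (A : Set (Play G)) : Prop :=
  ∀ (H : Arena.{u}) (h : Hom H G) (k : ℕ), ∃ (H' : Arena.{u}) (c : Cover k H' H),
    IsClop (c.toHom.play ⁻¹' (h.play ⁻¹' A))

theorem IsClop.compl {G : Arena.{u}} {A : Set (Play G)} (h : IsClop A) : IsClop Aᶜ :=
  ⟨h.2, by rw [compl_compl]; exact h.1⟩

theorem Unrav.compl {G : Arena.{u}} {A : Set (Play G)} (h : Unrav A) : Unrav Aᶜ := by
  intro H f k
  obtain ⟨H', c, hc⟩ := h H f k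
  exact ⟨H', c, hc.compl⟩

theorem unrav_closed {G : Arena.{u}} {A : Set (Play G)} (hA : IsOp Aᶜ) : Unrav A := by
  intro H f k
  set A' := f.play ⁻¹' A with hA'
  have hop : IsOp A'ᶜ := f.open hA
  let C : Set H.Pos := {p | ∃ x ∈ A', x.seq (H.lev p) = p}
  have hC : ∀ p, 0 < H.lev p → p ∈ C → H.par p ∈ C := by
    rintro p hp ⟨x, hx, hxp⟩
    refine ⟨x, hx, ?_⟩
    rw [H.lev_par, ← hxp, x.lev_seq]
    obtain ⟨l, hl⟩ : ∃ l, H.lev p = l + 1 := ⟨H.lev p - 1, by omega⟩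
    rw [hl, x.par_seq]; rfl
  have hAC : A' = {x | ∀ n, x.seq n ∈ C} := by
    ext x
    constructor
    · intro hx n
      exact ⟨x, hx, by rw [x.lev_seq]⟩
    · intro h
      by_contra hx
      obtain ⟨n, hn⟩ := hop x hx
      obtain ⟨y, hy, hyx⟩ := h n
      rw [x.lev_seq] at hyx
      exact hn y hyx hy
  obtain ⟨k', hk', hkk⟩ : ∃ k', tn k' = true ∧ k ≤ k' := by
    cases h : tn k with
    | true => exact ⟨k, h, le_rfl⟩
    | false => exact ⟨k+1, by rw [tn_succ, h]; rfl, by omega⟩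
  refine ⟨_, (UAcover (C := C) hk').mono hkk, ?_⟩
  rw [hAC]
  exact UA_clop hk' hC

theorem unrav_open {G : Arena.{u}} {A : Set (Play G)} (hA : IsOp A) : Unrav A := by
  rw [← compl_compl A]
  exact (unrav_closed (by rw [compl_compl]; exact hA)).compl

theorem unrav_iUnion {G : Arena.{u}} {A : ℕ → Set (Play G)} (hA : ∀ j, Unrav (A j)) :
    Unrav (⋃ j, A j) := by
  intro H f k
  choose X c hc using fun j => hA j
  let st : ℕ → Σ K : Arena.{u}, Hom K G := fun j =>
    Nat.rec (motive := fun _ => Σ K : Arena.{u}, Hom K G) ⟨H, f⟩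
      (fun j s => ⟨X j s.1 s.2 (k+j), s.2.comp (c j s.1 s.2 (k+j)).toHom⟩) j
  let W : Tower.{u} k := ⟨fun j => (st j).1, fun j => c j (st j).1 (st j).2 (k+j)⟩
  have hst : ∀ j y, (st j).2.play ((W.proj j).play y) = f.play ((W.proj 0).play y) := by
    intro j
    induction j with
    | zero => intro y; rfl
    | succ j ih =>
      intro y
      rw [← ih]
      apply Play.ext'
      intro n
      change (st j).2.f ((W.c j).f ((y.seq n).1 (j+1))) = (st j).2.f ((y.seq n).1 j)
      rw [(y.seq n).2 j]
  have hop : IsOp ((W.proj 0).play ⁻¹' (f.play ⁻¹' (⋃ j, A j))) := by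
    intro y hy
    obtain ⟨j, hj⟩ := Set.mem_iUnion.1 (show f.play ((W.proj 0).play y) ∈ ⋃ j, A j from hy)
    have h1 := (W.proj (j+1)).open (hc j (st j).1 (st j).2 (k+j)).1
    have h2 : ∀ y, (c j (st j).1 (st j).2 (k+j)).toHom.play ((W.proj (j+1)).play y) =
        (W.proj j).play y := by
      intro y
      apply Play.ext'
      intro n
      exact (y.seq n).2 j
    have h3 : ∀ y, y ∈ (W.proj (j+1)).play ⁻¹' ((c j (st j).1 (st j).2 (k+j)).toHom.play ⁻¹'
        ((st j).2.play ⁻¹' (A j))) ↔ f.play ((W.proj 0).play y) ∈ A j := by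
      intro y
      rw [← hst j y, ← h2 y]
      rfl
    obtain ⟨n, hn⟩ := h1 y ((h3 y).2 hj)
    exact ⟨n, fun z hz => Set.mem_iUnion.2 ⟨j, (h3 z).1 (hn z hz)⟩⟩
  obtain ⟨K, d, hd⟩ := unrav_open hop W.lim (Hom.id _) k
  exact ⟨K, W.cover.comp d, hd⟩

theorem Unrav.det {G : Arena.{u}} {A : Set (Play G)} (h : Unrav A) (p : G.Pos) : Det G A p := by
  obtain ⟨H, c, hc⟩ := h G (Hom.id _) (G.lev p)
  obtain ⟨q, hq⟩ := c.surj p le_rfl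
  have hl : H.lev q ≤ G.lev p := by rw [← c.lev_f, hq]
  rw [← hq]
  exact c.det A q hl (open_det H _ hc.1 q)

end BD


namespace BD

universe u

section lists
variable {α : Type u}

theorem length_pp (p : ℕ → α) (n : ℕ) : (playPrefix p n).length = n := by
  simp [playPrefix]

theorem getElem_pp (p : ℕ → α) (n i : ℕ) (h : i < (playPrefix p n).length) :
    (playPrefix p n)[i] = p i := by
  simp [playPrefix]

theorem pp_succ (p : ℕ → α) (n : ℕ) : playPrefix p (n+1) = playPrefix p n ++ [p n] := by
  simp only [playPrefix]
  rw [List.ofFn_succ_last]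
  rfl

theorem pp_pfx (p : ℕ → α) {m n : ℕ} (h : m ≤ n) : playPrefix p m <+: playPrefix p n := by
  induction n, h using Nat.le_induction with
  | base => exact List.prefix_refl _
  | succ n h ih => rw [pp_succ]; exact ih.trans (List.prefix_append _ _)

theorem pp_dropLast (p : ℕ → α) (n : ℕ) : (playPrefix p (n+1)).dropLast = playPrefix p n := by
  rw [pp_succ]; simp

theorem pp_getD [Inhabited α] (p : ℕ → α) (n : ℕ) : (playPrefix p (n+1)).getD n default = p n := by
  rw [List.getD_eq_getElem _ _ (by rw [length_pp]; omega), getElem_pp]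

theorem pp_eq_of_pfx {p : ℕ → α} {n : ℕ} {γ : List α} (h : γ <+: playPrefix p n) :
    playPrefix p γ.length = γ := by
  have hl : γ.length ≤ n := by have := h.length_le; rwa [length_pp] at this
  have h2 := pp_pfx p hl
  exact (List.prefix_of_prefix_length_le h2 h (by rw [length_pp])).eq_of_length (by rw [length_pp])

theorem succ_dropLast {T : Set (List α)} {γ c : List α} (h : c ∈ treeSucc T γ) :
    c.dropLast = γ := by
  obtain ⟨-, ⟨t, rfl⟩, hl⟩ := h
  rw [List.length_append] at hl
  obtain ⟨a, rfl⟩ := List.length_eq_one_iff.1 (show t.length = 1 by omega)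
  simp

theorem succ_iff {T : Set (List α)} {γ c : List α} :
    c ∈ treeSucc T γ ↔ c ∈ T ∧ ∃ a, c = γ ++ [a] := by
  constructor
  · rintro ⟨h1, ⟨t, rfl⟩, hl⟩
    rw [List.length_append] at hl
    obtain ⟨a, rfl⟩ := List.length_eq_one_iff.1 (show t.length = 1 by omega)
    exact ⟨h1, a, rfl⟩
  · rintro ⟨h1, a, rfl⟩
    exact ⟨h1, List.prefix_append _ _, by simp⟩

theorem body_succ {T : Set (List α)} {p : ℕ → α} (hp : p ∈ Body T) (n : ℕ) :
    playPrefix p (n+1) ∈ treeSucc T (playPrefix p n) :=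
  succ_iff.2 ⟨hp _, _, pp_succ p n⟩

end lists

/-- Cylinder in the full space. -/
def Cyl {α : Type u} (γ : List α) : Set (ℕ → α) := {p | playPrefix p γ.length = γ}

/-- σ-algebra generated by cylinders. -/
abbrev CylM (α : Type u) : MeasurableSpace (ℕ → α) :=
  MeasurableSpace.generateFrom {A | ∃ γ : List α, A = Cyl γ}

section bridge
variable {α : Type u} (T : Set (List α)) (d : List α → Bool)

def TValid (z : List α × Option (List α)) : Prop :=
  z.1 ∈ T ∧ ∀ c, z.2 = some c → (d z.1 = true → c ∈ treeSucc T z.1) ∧ (d z.1 = false → c = z.1)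

open Classical in
noncomputable def tpar : List α × Option (List α) → List α × Option (List α)
  | (γ, some _) => (γ, none)
  | (γ, none) => if γ = [] then ([], none) else
      (γ.dropLast, some (if d γ.dropLast = true then γ else γ.dropLast))

def tlev : List α × Option (List α) → ℕ
  | (γ, some _) => 2 * γ.length + 1
  | (γ, none) => 2 * γ.length

variable {T d}

theorem tvalid_par (hT : IsTree T) (z) (h : TValid T d z) : TValid T d (tpar d z) := by
  obtain ⟨γ, o⟩ := z
  cases o with
  | some c => exact ⟨h.1, by simp [tpar]⟩
  | none =>
    simp only [tpar]
    split_ifs with h0 h1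
    · subst h0; exact h
    · have hp : γ.dropLast <+: γ := (List.prefix_iff_eq_take.2 (by simp [List.dropLast_eq_take]))
      refine ⟨hT hp h.1, ?_⟩
      rintro c hc
      simp only [Option.some.injEq] at hc
      subst hc
      refine ⟨fun _ => ⟨h.1, hp, ?_⟩, fun h2 => by simp [h1] at h2⟩
      have := List.length_pos_iff.2 h0
      dsimp only
      rw [List.length_dropLast]; omega
    · have hp : γ.dropLast <+: γ := (List.prefix_iff_eq_take.2 (by simp [List.dropLast_eq_take]))
      refine ⟨hT hp h.1, ?_⟩
      rintro c hc
      simp only [Option.some.injEq] at hc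
      subst hc
      exact ⟨fun h2 => absurd h2 h1, fun _ => rfl⟩

theorem tlev_par (z : List α × Option (List α)) : tlev (tpar d z) = tlev z - 1 := by
  obtain ⟨γ, o⟩ := z
  cases o with
  | some c => simp [tpar, tlev]
  | none =>
    by_cases h0 : γ = []
    · subst h0; simp [tpar, tlev]
    · simp only [tpar, if_neg h0, tlev]
      have := List.length_pos_iff.2 h0
      rw [List.length_dropLast]; omega

theorem tpar_succ {γ c : List α} (h : c ∈ treeSucc T γ) :
    tpar d (c, none) = (γ, some (if d γ = true then c else γ)) := by
  have h1 : c ≠ [] := by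
    intro h0
    have := h.2.2
    rw [h0] at this
    simp at this
  simp only [tpar, if_neg h1, succ_dropLast h]

noncomputable def TA (hT : IsTree T) (hP : IsPruned T) (d : List α → Bool) : Arena.{u} where
  Pos := {z : List α × Option (List α) // TValid T d z}
  lev z := tlev z.1
  par z := ⟨tpar d z.1, tvalid_par hT z.1 z.2⟩
  lev_par z := tlev_par z.1
  ex_child := by
    rintro ⟨⟨γ, o⟩, h⟩
    obtain ⟨c, hc⟩ := hP γ h.1
    cases o with
    | none =>
      cases hd : d γ with
      | true =>
        refine ⟨⟨(γ, some c), h.1, ?_⟩, rfl, rfl⟩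
        intro c' hc'
        simp only [Option.some.injEq] at hc'
        subst hc'
        exact ⟨fun _ => hc, fun h2 => by simp [hd] at h2⟩
      | false =>
        refine ⟨⟨(γ, some γ), h.1, ?_⟩, rfl, rfl⟩
        intro c' hc'
        simp only [Option.some.injEq] at hc'
        subst hc'
        exact ⟨fun h2 => by simp [hd] at h2, fun _ => rfl⟩
    | some e =>
      have he := h.2 e rfl
      dsimp only at he
      cases hd : d γ with
      | true =>
        have he := he.1 hd
        refine ⟨⟨(e, none), he.1, by simp⟩, ?_, ?_⟩
        · simp only [tlev]; rw [he.2.2]; omega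
        · apply Subtype.ext
          change tpar d (e, none) = (γ, some e)
          rw [tpar_succ he, if_pos hd]
      | false =>
        have he := he.2 hd
        subst he
        refine ⟨⟨(c, none), hc.1, by simp⟩, ?_, ?_⟩
        · simp only [tlev]; rw [hc.2.2]; omega
        · apply Subtype.ext
          change tpar d (c, none) = (e, some e)
          rw [tpar_succ hc, if_neg (by simp [hd])]

variable (hT : IsTree T) (hP : IsPruned T)

/-- The underlying infinite sequence. -/
noncomputable def tproj [Inhabited α] (x : Play (TA hT hP d)) : ℕ → α :=
  fun n => ((x.seq (2 * (n+1))).1.1).getD n default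

theorem tproj_cyl [Inhabited α] (γ : List α) :
    IsOp (tproj (d := d) hT hP ⁻¹' (Cyl γ)) := by
  intro x hx
  refine ⟨2 * γ.length, fun y hy => ?_⟩
  change playPrefix _ _ = γ
  rw [← show playPrefix (tproj hT hP x) _ = γ from hx]
  apply List.ext_getElem
  · simp [length_pp]
  · intro i h1 h2
    rw [getElem_pp, getElem_pp]
    rw [length_pp] at h1
    have hi : i < γ.length := by
      have : playPrefix (tproj hT hP x) γ.length = γ := hx
      rw [this] at h1; exact h1
    simp only [tproj]
    rw [y.eq_of_le x (m := 2 * (i+1)) (n := 2 * γ.length) (by omega) hy]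

theorem unrav_meas [Inhabited α] (X : Set (ℕ → α)) (hX : @MeasurableSet (ℕ → α) (CylM α) X) :
    Unrav (tproj (d := d) hT hP ⁻¹' X) := by
  induction X, hX using MeasurableSpace.generateFrom_induction with
  | hC t ht _ =>
    obtain ⟨γ, rfl⟩ := ht
    exact unrav_open (tproj_cyl hT hP γ)
  | empty => exact unrav_open (by intro x hx; exact absurd hx (by simp))
  | compl t _ ih => exact ih.compl
  | iUnion s _ ih =>
    rw [Set.preimage_iUnion]
    exact unrav_iUnion ih

open Classical in
/-- The play of the arena corresponding to a branch. -/
noncomputable def tplay (p : ℕ → α) (hp : p ∈ Body T) : Play (TA hT hP d) where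
  seq m := ⟨(playPrefix p (m/2), if m % 2 = 0 then none else
      some (if d (playPrefix p (m/2)) = true then playPrefix p (m/2+1) else playPrefix p (m/2))), by
    refine ⟨hp _, ?_⟩
    dsimp only
    intro c hc
    split_ifs at hc with h1 h2
    · simp only [Option.some.injEq] at hc
      subst hc
      exact ⟨fun _ => body_succ hp _, fun h3 => by simp [h2] at h3⟩
    · simp only [Option.some.injEq] at hc
      subst hc
      exact ⟨fun h3 => absurd h3 h2, fun _ => rfl⟩⟩
  lev_seq m := by
    change tlev _ = m
    dsimp only
    split_ifs with h
    · simp only [tlev, length_pp]; omega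
    · simp only [tlev, length_pp]; omega
    · simp only [tlev, length_pp]; omega
  par_seq m := by
    apply Subtype.ext
    change tpar d (playPrefix p ((m+1)/2), if (m+1) % 2 = 0 then none else
      some (if d (playPrefix p ((m+1)/2)) = true then playPrefix p ((m+1)/2+1) else playPrefix p ((m+1)/2)))
      = (playPrefix p (m/2), if m % 2 = 0 then none else
      some (if d (playPrefix p (m/2)) = true then playPrefix p (m/2+1) else playPrefix p (m/2)))
    rcases Nat.mod_two_eq_zero_or_one m with h | h
    · rw [if_neg (by omega), if_pos h, show (m+1)/2 = m/2 by omega]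
      rfl
    · rw [if_pos (by omega), if_neg (by omega), show (m+1)/2 = m/2+1 by omega, tpar_succ (body_succ hp _)]

theorem tplay_proj [Inhabited α] (p : ℕ → α) (hp : p ∈ Body T) :
    tproj (d := d) hT hP (tplay hT hP p hp) = p := by
  funext n
  change (playPrefix p (2*(n+1)/2)).getD n default = p n
  rw [show 2*(n+1)/2 = n+1 by omega, pp_getD]

theorem tplay_even (p : ℕ → α) (hp : p ∈ Body T) (m : ℕ) :
    ((tplay (d := d) hT hP p hp).seq (2*m)).1 = (playPrefix p m, none) := by
  change (playPrefix p (2*m/2), _) = _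
  rw [if_pos (by omega), show 2*m/2 = m by omega]

theorem tplay_odd (p : ℕ → α) (hp : p ∈ Body T) (m : ℕ) :
    ((tplay (d := d) hT hP p hp).seq (2*m+1)).1 = (playPrefix p m,
      some (if d (playPrefix p m) = true then playPrefix p (m+1) else playPrefix p m)) := by
  change (playPrefix p ((2*m+1)/2), _) = _
  rw [if_neg (by omega), show (2*m+1)/2 = m by omega]

/-- `p` follows profile `σ` at nodes of player `i` of length at least `n`. -/
def Follows (d : List α → Bool) (i : Bool) (σ : List α → List α) (n : ℕ) (p : ℕ → α) : Prop :=
  ∀ m, n ≤ m → d (playPrefix p m) = i → playPrefix p (m+1) = σ (playPrefix p m)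

theorem ch_even (z z' : (TA hT hP d).Pos) (h : (TA hT hP d).IsCh z z') (γ) (hz : z.1 = (γ, none)) :
    ∃ c, z'.1 = (γ, some c) := by
  obtain ⟨⟨γ1, o1⟩, h1⟩ := z
  obtain ⟨⟨γ2, o2⟩, h2⟩ := z'
  have e1 : tpar d (γ2, o2) = (γ1, o1) := congrArg Subtype.val h.2
  have e2 : tlev (γ2, o2) = tlev (γ1, o1) + 1 := h.1
  dsimp only at hz
  rw [hz] at e1 e2
  cases o2 with
  | none => simp only [tlev] at e2; omega
  | some c =>
    simp only [tpar, Prod.mk.injEq] at e1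
    rw [← e1.1]
    exact ⟨c, rfl⟩

theorem ch_odd (z z' : (TA hT hP d).Pos) (h : (TA hT hP d).IsCh z z') (γ e) (hz : z.1 = (γ, some e)) :
    ∃ c, z'.1 = (c, none) ∧ c ∈ treeSucc T γ ∧ (d γ = true → c = e) := by
  obtain ⟨⟨γ1, o1⟩, h1⟩ := z
  obtain ⟨⟨γ2, o2⟩, h2⟩ := z'
  have e1 : tpar d (γ2, o2) = (γ1, o1) := congrArg Subtype.val h.2
  have e2 : tlev (γ2, o2) = tlev (γ1, o1) + 1 := h.1
  dsimp only at hz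
  rw [hz] at e1 e2
  cases o2 with
  | some c => simp only [tlev] at e2; omega
  | none =>
    refine ⟨γ2, rfl, ?_⟩
    simp only [tlev] at e2
    have h0 : γ2 ≠ [] := by
      rintro rfl
      simp at e2
    simp only [tpar, if_neg h0, Prod.mk.injEq, Option.some.injEq] at e1
    refine ⟨⟨h2.1, ?_, by omega⟩, ?_⟩
    · rw [← e1.1]; exact List.prefix_iff_eq_take.2 (by simp [List.dropLast_eq_take])
    · intro hd
      rw [e1.1, if_pos hd] at e1
      exact e1.2

theorem borel_det [Inhabited α] (hT : IsTree T) (hP : IsPruned T) (d : List α → Bool)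
    (X : Set (ℕ → α)) (hX : @MeasurableSet (ℕ → α) (CylM α) X)
    (δ : List α) (hδ : δ ∈ T) :
    (∃ σ, IsProfile T σ ∧ ∀ p ∈ Body T, playPrefix p δ.length = δ →
      Follows d true σ δ.length p → p ∈ X) ∨
    (∃ σ, IsProfile T σ ∧ ∀ p ∈ Body T, playPrefix p δ.length = δ →
      Follows d false σ δ.length p → p ∉ X) := by
  classical
  have hP2 := hP
  choose! nx hnx using hP2
  let p0 : (TA hT hP d).Pos := ⟨(δ, none), hδ, by simp⟩
  have hp0 : (TA hT hP d).lev p0 = 2 * δ.length := rfl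
  rcases (unrav_meas (d := d) hT hP X hX).det p0 with ⟨σ, hσ⟩ | ⟨σ, hσ⟩
  · left
    have hc : ∀ γ, γ ∈ T → ∃ c ∈ treeSucc T γ, ∀ h : TValid T d (γ, none), d γ = true →
        (σ.1 ⟨(γ, none), h⟩).1 = (γ, some c) := by
      intro γ hγ
      by_cases hd : d γ = true
      · have hv : TValid T d (γ, none) := ⟨hγ, by simp⟩
        obtain ⟨c, hc⟩ := ch_even hT hP _ _ (σ.2 ⟨(γ, none), hv⟩) γ rfl
        have h2 := (σ.1 ⟨(γ, none), hv⟩).2.2 c (by rw [hc])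
        refine ⟨c, ?_, fun h _ => hc⟩
        rw [hc] at h2
        exact h2.1 hd
      · exact ⟨nx γ, hnx γ hγ, fun _ h => absurd h hd⟩
    choose! s hs1 hs2 using hc
    refine ⟨s, hs1, fun p hp hpδ hf => ?_⟩
    have h1 := hσ (tplay hT hP p hp) ?_ ?_
    · change tproj hT hP _ ∈ X at h1
      rwa [tplay_proj] at h1
    · apply Subtype.ext
      rw [hp0, tplay_even, hpδ]
    · intro n hn ho
      rw [hp0] at hn
      obtain ⟨m, rfl⟩ : ∃ m, n = 2 * m := ⟨n/2, by
        have : n % 2 = 0 := by simpa [tn] using ho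
        omega⟩
      apply Subtype.ext
      rw [tplay_odd]
      by_cases hd : d (playPrefix p m) = true
      · rw [if_pos hd]
        have hv : TValid T d (playPrefix p m, none) := ⟨hp m, by simp⟩
        have e : (tplay (d := d) hT hP p hp).seq (2*m) = ⟨(playPrefix p m, none), hv⟩ :=
          Subtype.ext (tplay_even hT hP p hp m)
        rw [e, hs2 _ (hp m) hv hd, hf m (by omega) hd]
      · rw [if_neg hd]
        obtain ⟨c, hc⟩ := ch_even hT hP _ _ (σ.2 ((tplay (d := d) hT hP p hp).seq (2*m))) _
          (tplay_even hT hP p hp m)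
        rw [hc]
        have h2 := (σ.1 ((tplay (d := d) hT hP p hp).seq (2*m))).2.2 c (by rw [hc])
        rw [hc] at h2
        rw [h2.2 (by simpa using hd)]
  · right
    have hc : ∀ γ, γ ∈ T → ∃ c ∈ treeSucc T γ, ∀ h : TValid T d (γ, some γ), d γ = false →
        (σ.1 ⟨(γ, some γ), h⟩).1 = (c, none) := by
      intro γ hγ
      by_cases hd : d γ = false
      · have hv : TValid T d (γ, some γ) := ⟨hγ, by
          intro c hc
          simp only [Option.some.injEq] at hc
          subst hc
          exact ⟨fun h => by simp [hd] at h, fun _ => rfl⟩⟩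
        obtain ⟨c, hc, hc2, -⟩ := ch_odd hT hP _ _ (σ.2 ⟨(γ, some γ), hv⟩) γ γ rfl
        exact ⟨c, hc2, fun h _ => hc⟩
      · exact ⟨nx γ, hnx γ hγ, fun _ h => absurd h hd⟩
    choose! s hs1 hs2 using hc
    refine ⟨s, hs1, fun p hp hpδ hf => ?_⟩
    have h1 := hσ (tplay hT hP p hp) ?_ ?_
    · intro hpX
      apply h1
      change tproj hT hP _ ∈ X
      rwa [tplay_proj]
    · apply Subtype.ext
      rw [hp0, tplay_even, hpδ]
    · intro n hn ho
      rw [hp0] at hn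
      obtain ⟨m, rfl⟩ : ∃ m, n = 2 * m + 1 := ⟨n/2, by
        have : ¬ n % 2 = 0 := by simpa [tn] using ho
        omega⟩
      apply Subtype.ext
      rw [show 2*m+1+1 = 2*(m+1) by omega, tplay_even]
      have ho := tplay_odd (d := d) hT hP p hp m
      by_cases hd : d (playPrefix p m) = true
      · rw [if_pos hd] at ho
        obtain ⟨c, hc, hc2, hc3⟩ := ch_odd hT hP _ _ (σ.2 ((tplay (d := d) hT hP p hp).seq (2*m+1))) _ _ ho
        rw [hc, hc3 hd]
      · rw [if_neg hd] at ho
        have hd : d (playPrefix p m) = false := by simpa using hd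
        have hv : TValid T d (playPrefix p m, some (playPrefix p m)) := by
          rw [← ho]; exact Subtype.property _
        have e : (tplay (d := d) hT hP p hp).seq (2*m+1) = ⟨_, hv⟩ := Subtype.ext ho
        rw [e, hs2 _ (hp m) hv hd, hf m (by omega) hd]

end bridge

end BD


namespace BD

universe u

section basics
variable {α : Type u} [Inhabited α] {T : Set (List α)}

def playOf (s : List α → List α) (γ : List α) : ℕ → α :=
  fun n => (iterNode s γ (n + 1)).getD n default

theorem inducedPlay_eq (s : List α → List α) : inducedPlay s = playOf s [] := rfl

theorem iter_mem {s : List α → List α} (hs : IsProfile T s) {γ : List α} (hγ : γ ∈ T) (k : ℕ) :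
    iterNode s γ k ∈ T ∧ (iterNode s γ k).length = γ.length + k := by
  induction k with
  | zero => exact ⟨hγ, rfl⟩
  | succ k ih =>
    have := hs _ ih.1
    exact ⟨this.1, by rw [iterNode, this.2.2, ih.2]; rfl⟩

theorem iter_pfx {s : List α → List α} (hs : IsProfile T s) {γ : List α} (hγ : γ ∈ T) {k l : ℕ}
    (h : k ≤ l) : iterNode s γ k <+: iterNode s γ l := by
  induction l, h using Nat.le_induction with
  | base => exact List.prefix_refl _
  | succ l h ih => exact ih.trans (hs _ (iter_mem hs hγ l).1).2.1

theorem playOf_pfx {s : List α → List α} (hs : IsProfile T s) {γ : List α} (hγ : γ ∈ T) (k : ℕ) :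
    playPrefix (playOf s γ) (γ.length + k) = iterNode s γ k := by
  apply List.ext_getElem
  · rw [length_pp, (iter_mem hs hγ k).2]
  · intro i h1 h2
    rw [getElem_pp]
    have hl := (iter_mem hs hγ (i+1)).2
    have hi : i < (iterNode s γ (i+1)).length := by omega
    change (iterNode s γ (i+1)).getD i default = _
    rw [List.getD_eq_getElem _ _ hi]
    rcases Nat.le_total (i+1) k with h | h
    · exact (iter_pfx hs hγ h).getElem hi
    · exact ((iter_pfx hs hγ h).getElem h2).symm

/-- `p` is the play of `T` through `γ` following `s`. -/
structure SP (T : Set (List α)) (s : List α → List α) (γ : List α) (p : ℕ → α) : Prop where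
  body : p ∈ Body T
  thr : playPrefix p γ.length = γ
  fol : ∀ m, γ.length ≤ m → playPrefix p (m+1) = s (playPrefix p m)

theorem body_of_large (hT : IsTree T) {p : ℕ → α} (l : ℕ) (h : ∀ k, playPrefix p (l + k) ∈ T) :
    p ∈ Body T := fun n => hT (pp_pfx p (show n ≤ l + n by omega)) (h n)

theorem playOf_SP (hT : IsTree T) {s : List α → List α} (hs : IsProfile T s) {γ : List α} (hγ : γ ∈ T) :
    SP T s γ (playOf s γ) := by
  refine ⟨body_of_large hT γ.length (fun k => ?_), playOf_pfx hs hγ 0, fun m hm => ?_⟩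
  · rw [playOf_pfx hs hγ]; exact (iter_mem hs hγ k).1
  · obtain ⟨k, rfl⟩ := Nat.exists_eq_add_of_le hm
    rw [playOf_pfx hs hγ, show γ.length + k + 1 = γ.length + (k+1) by omega, playOf_pfx hs hγ]
    rfl

theorem pp_inj {p q : ℕ → α} (h : ∀ n, playPrefix p n = playPrefix q n) : p = q := by
  funext n
  rw [← pp_getD p n, h, pp_getD]

theorem SP.unique {s s' : List α → List α} {γ : List α} {p q : ℕ → α} (hp : SP T s γ p)
    (hq : SP T s' γ q) (h : ∀ e ∈ T, γ <+: e → s e = s' e) : p = q := by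
  have h1 : ∀ k, playPrefix p (γ.length + k) = playPrefix q (γ.length + k) := by
    intro k
    induction k with
    | zero => exact hp.thr.trans hq.thr.symm
    | succ k ih =>
      rw [show γ.length + (k+1) = γ.length + k + 1 by omega, hp.fol _ (by omega),
        hq.fol _ (by omega), ih]
      refine h _ (hq.body _) ?_
      rw [← hq.thr, length_pp]
      exact pp_pfx _ (by omega)
  apply pp_inj
  intro n
  have a1 := pp_pfx p (show n ≤ γ.length + n by omega)
  have a2 := pp_pfx q (show n ≤ γ.length + n by omega)
  rw [h1] at a1
  exact (List.prefix_of_prefix_length_le a1 a2 (by simp [length_pp])).eq_of_length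
    (by simp [length_pp])

variable (T) (d : List α → Bool) (v : (ℕ → α) → ℕ)

structure Good (s : List α → List α) (γ : List α) : Prop where
  zero : v (playOf s γ) = 0 → ∀ p ∈ Body T, playPrefix p γ.length = γ → v p = 0
  devA : v (playOf s γ) ≠ 0 → ∀ p ∈ Body T, playPrefix p γ.length = γ →
    Follows d false s γ.length p → v p = 0 ∨ v (playOf s γ) ≤ v p
  devB : v (playOf s γ) ≠ 0 → ∀ p ∈ Body T, playPrefix p γ.length = γ →
    Follows d true s γ.length p → v p ≤ v (playOf s γ)

def Solv (γ : List α) : Prop :=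
  ∃ s, IsProfile T s ∧ ∀ δ ∈ T, γ <+: δ → Good T d v s δ

variable {T d v}

theorem prefix_of_thr {p : ℕ → α} {γ : List α} (h : playPrefix p γ.length = γ) {m : ℕ}
    (hm : γ.length ≤ m) : γ <+: playPrefix p m := by
  conv_lhs => rw [← h]
  exact pp_pfx p hm

theorem Follows.congr {i : Bool} {s s' : List α → List α} {γ : List α} {p : ℕ → α}
    (hp : p ∈ Body T) (ht : playPrefix p γ.length = γ)
    (h : ∀ e ∈ T, γ <+: e → s e = s' e) (hf : Follows d i s γ.length p) :
    Follows d i s' γ.length p := by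
  intro m hm hd
  rw [hf m hm hd]
  exact h _ (hp _) (prefix_of_thr ht hm)

theorem playOf_congr (hT : IsTree T) {s s' : List α → List α} (hs : IsProfile T s)
    (hs' : IsProfile T s') {γ : List α} (hγ : γ ∈ T) (h : ∀ e ∈ T, γ <+: e → s e = s' e) :
    playOf s γ = playOf s' γ :=
  (playOf_SP hT hs hγ).unique (playOf_SP hT hs' hγ) h

theorem Good.congr (hT : IsTree T) {s s' : List α → List α} (hs : IsProfile T s)
    (hs' : IsProfile T s') {γ : List α} (hγ : γ ∈ T) (h : ∀ e ∈ T, γ <+: e → s e = s' e)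
    (hg : Good T d v s γ) : Good T d v s' γ := by
  have e := playOf_congr hT hs hs' hγ h
  have h' : ∀ e ∈ T, γ <+: e → s' e = s e := fun e a b => (h e a b).symm
  obtain ⟨g1, g2, g3⟩ := hg
  rw [e] at g1 g2 g3
  exact ⟨g1, fun h0 p hp ht hf => g2 h0 p hp ht (hf.congr hp ht h'),
    fun h0 p hp ht hf => g3 h0 p hp ht (hf.congr hp ht h')⟩

theorem Solv.ext {γ δ : List α} (h : Solv T d v γ) (hγ : γ <+: δ) : Solv T d v δ := by
  obtain ⟨s, hs, hg⟩ := h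
  exact ⟨s, hs, fun e he hde => hg e he (hγ.trans hde)⟩

theorem exists_profile (hP : IsPruned T) : ∃ s, IsProfile T s := by
  choose! s hs using hP
  exact ⟨s, hs⟩

/-- nodes all of whose plays have outcome 0 are solvable -/
theorem solv_of_zero (hP : IsPruned T) (hT : IsTree T) {γ : List α}
    (h : ∀ p ∈ Body T, playPrefix p γ.length = γ → v p = 0) : Solv T d v γ := by
  obtain ⟨s, hs⟩ := exists_profile hP
  refine ⟨s, hs, fun δ hδ hγδ => ?_⟩
  have h0 : ∀ p ∈ Body T, playPrefix p δ.length = δ → v p = 0 := by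
    intro p hp ht
    refine h p hp (pp_eq_of_pfx (n := δ.length) ?_)
    rw [ht]; exact hγδ
  have := playOf_SP hT hs hδ
  have h1 := h0 _ this.body this.thr
  exact ⟨fun _ => h0, fun h => absurd h1 h, fun h => absurd h1 h⟩

/-- one profile solving all solvable nodes -/
theorem solv_global (hP : IsPruned T) (hT : IsTree T) :
    ∃ s, IsProfile T s ∧ ∀ δ ∈ T, Solv T d v δ → Good T d v s δ := by
  classical
  obtain ⟨s0, hs0⟩ := exists_profile hP
  have hch : ∀ γ, ∃ s, IsProfile T s ∧ (Solv T d v γ → ∀ δ ∈ T, γ <+: δ → Good T d v s δ) := by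
    intro γ
    by_cases h : Solv T d v γ
    · obtain ⟨s, h1, h2⟩ := h
      exact ⟨s, h1, fun _ => h2⟩
    · exact ⟨s0, hs0, fun h' => absurd h' h⟩
  choose sol hsol1 hsol2 using hch
  let ρ : List α → List α := fun δ =>
    if h : ∃ k, Solv T d v (δ.take k) then δ.take (Nat.find h) else δ
  have hρ : ∀ δ, Solv T d v δ → Solv T d v (ρ δ) ∧ ρ δ <+: δ ∧ ∀ e, δ <+: e → ρ e = ρ δ := by
    intro δ hδ
    have hex : ∃ k, Solv T d v (δ.take k) := ⟨δ.length, by rw [List.take_length]; exact hδ⟩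
    have e1 : ρ δ = δ.take (Nat.find hex) := dif_pos hex
    have hle : Nat.find hex ≤ δ.length := Nat.find_min' hex (by rw [List.take_length]; exact hδ)
    refine ⟨by rw [e1]; exact Nat.find_spec hex, by rw [e1]; exact ⟨_, List.take_append_drop _ _⟩, ?_⟩
    rintro e ⟨t, rfl⟩
    have htk : ∀ k, k ≤ δ.length → (δ ++ t).take k = δ.take k := by
      intro k hk
      rw [List.take_append_of_le_length hk]
    have hex' : ∃ k, Solv T d v ((δ ++ t).take k) :=
      ⟨Nat.find hex, by rw [htk _ hle]; exact Nat.find_spec hex⟩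
    have e2 : ρ (δ ++ t) = (δ ++ t).take (Nat.find hex') := dif_pos hex'
    have e3 : Nat.find hex' = Nat.find hex := by
      have a1 : Nat.find hex' ≤ Nat.find hex :=
        Nat.find_min' hex' (by rw [htk _ hle]; exact Nat.find_spec hex)
      have a2 : Nat.find hex ≤ Nat.find hex' := by
        apply Nat.find_min' hex
        rw [← htk _ (by omega)]
        exact Nat.find_spec hex'
      omega
    rw [e2, e3, htk _ hle, e1]
  refine ⟨fun δ => sol (ρ δ) δ, fun γ hγ => hsol1 _ γ hγ, fun δ hδ hS => ?_⟩
  obtain ⟨h1, h2, h3⟩ := hρ δ hS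
  refine Good.congr hT (hsol1 (ρ δ)) (fun γ hγ => hsol1 _ γ hγ) hδ ?_ (hsol2 _ h1 δ hδ h2)
  intro e he hde
  change sol (ρ δ) e = sol (ρ e) e
  rw [h3 e hde]

/-- Quasi-difference sets are trivial on a cone of each subtree. -/
theorem qd_delta {Y : Set (ℕ → α)} (hY : QuasiDiff T Y) :
    ∀ S : Set (List α), S ⊆ T → IsTree S → S.Nonempty → ∃ γ ∈ S,
      (∀ p ∈ Body S, playPrefix p γ.length = γ → p ∈ Y) ∨
      (∀ p ∈ Body S, playPrefix p γ.length = γ → p ∉ Y) := by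
  induction hY with
  | isOpen A hA =>
    obtain ⟨S', hS', rfl⟩ := hA
    intro S hST hS hne
    by_cases h : ∃ γ ∈ S, γ ∈ S'
    · obtain ⟨γ, h1, h2⟩ := h
      refine ⟨γ, h1, Or.inl fun p hp ht => ?_⟩
      exact Set.mem_biUnion h2 ⟨fun n => hST (hp n), ht⟩
    · obtain ⟨γ, hγ⟩ := hne
      refine ⟨γ, hγ, Or.inr fun p hp ht hpA => ?_⟩
      obtain ⟨e, he, hpe⟩ := Set.mem_iUnion₂.1 hpA
      exact h ⟨e, by rw [← hpe.2]; exact hp _, he⟩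
  | iUnion S' D hS' hpw hD hDc ih =>
    intro S hST hS hne
    by_cases h : ∃ γ ∈ S, γ ∈ S'
    · obtain ⟨γ, h1, h2⟩ := h
      let S1 : Set (List α) := {δ | δ ∈ S ∧ (δ <+: γ ∨ γ <+: δ)}
      have hcmp : ∀ p ∈ Body S, playPrefix p γ.length = γ → p ∈ Body S1 := by
        intro p hp ht n
        refine ⟨hp n, ?_⟩
        rcases Nat.le_total n γ.length with h | h
        · left
          conv_rhs => rw [← ht]
          exact pp_pfx p h
        · exact Or.inr (prefix_of_thr ht h)
      have hS1 : IsTree S1 := by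
        rintro a b hab ⟨hb1, hb2⟩
        refine ⟨hS hab hb1, ?_⟩
        rcases hb2 with hb2 | hb2
        · exact Or.inl (hab.trans hb2)
        · rcases Nat.le_total a.length γ.length with hl | hl
          · exact Or.inl (List.prefix_of_prefix_length_le hab hb2 hl)
          · exact Or.inr (List.prefix_of_prefix_length_le hb2 hab hl)
      obtain ⟨δ, hδ, hor⟩ := ih γ h2 S1 (fun x hx => hST hx.1) hS1 ⟨γ, h1, Or.inl (List.prefix_refl _)⟩
      obtain ⟨η, hη, hη1, hη2⟩ : ∃ η ∈ S, γ <+: η ∧ δ <+: η := by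
        rcases hδ.2 with h | h
        · exact ⟨γ, h1, List.prefix_refl _, h⟩
        · exact ⟨δ, hδ.1, h, List.prefix_refl _⟩
      have hD' : ∀ p, playPrefix p γ.length = γ → (p ∈ ⋃ γ ∈ S', D γ) → p ∈ D γ := by
        intro p ht hp
        obtain ⟨e, he, hpe⟩ := Set.mem_iUnion₂.1 hp
        by_cases heq : e = γ
        · rw [← heq]; exact hpe
        · exfalso
          have hc := (hDc e he hpe).2
          rcases Nat.le_total e.length γ.length with h | h
          · have := prefix_of_thr hc h
            rw [ht] at this
            exact hpw he h2 heq this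
          · have := prefix_of_thr ht h
            rw [hc] at this
            exact hpw h2 he (Ne.symm heq) this
      have hthr : ∀ p : ℕ → α, playPrefix p η.length = η →
          playPrefix p γ.length = γ ∧ playPrefix p δ.length = δ := by
        intro p ht
        exact ⟨pp_eq_of_pfx (n := η.length) (by rw [ht]; exact hη1),
          pp_eq_of_pfx (n := η.length) (by rw [ht]; exact hη2)⟩
      refine ⟨η, hη, ?_⟩
      rcases hor with hor | hor
      · left
        intro p hp ht
        exact Set.mem_biUnion h2 (hor p (hcmp p hp (hthr p ht).1) (hthr p ht).2)
      · right
        intro p hp ht hpU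
        exact hor p (hcmp p hp (hthr p ht).1) (hthr p ht).2 (hD' p (hthr p ht).1 hpU)
    · obtain ⟨γ, hγ⟩ := hne
      refine ⟨γ, hγ, Or.inr fun p hp ht hpA => ?_⟩
      obtain ⟨e, he, hpe⟩ := Set.mem_iUnion₂.1 hpA
      exact h ⟨e, by rw [← (hDc e he hpe).2]; exact hp _, he⟩
  | compl A hA ih =>
    intro S hST hS hne
    obtain ⟨γ, hγ, h⟩ := ih S hST hS hne
    refine ⟨γ, hγ, ?_⟩
    rcases h with h | h
    · right
      intro p hp ht hc
      exact hc.2 (h p hp ht)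
    · left
      intro p hp ht
      exact ⟨fun n => hST (hp n), h p hp ht⟩

/-- Glue lemma. -/
theorem glue (hT : IsTree T) (sU : List α → List α) (hsU : IsProfile T sU)
    (hU : ∀ δ ∈ T, Solv T d v δ → Good T d v sU δ) (γ : List α)
    (lam : List α → ℕ) (hlam : ∀ e ∈ T, Solv T d v e → lam e = v (playOf sU e))
    (s : List α → List α)
    (hs : ∀ δ ∈ T, ¬ Solv T d v δ → γ <+: δ → s δ ∈ treeSucc T δ ∧ lam δ ≠ 0 ∧ lam (s δ) = lam δ)
    (h2 : ∀ δ ∈ T, ¬ Solv T d v δ → γ <+: δ → d δ = true → ∀ c ∈ treeSucc T δ,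
      lam c = 0 ∨ lam δ ≤ lam c)
    (h3 : ∀ δ ∈ T, ¬ Solv T d v δ → γ <+: δ → d δ = false → ∀ c ∈ treeSucc T δ, lam c ≤ lam δ)
    (h4 : ∀ δ ∈ T, γ <+: δ → ∀ p ∈ Body T, (∀ n, ¬ Solv T d v (playPrefix p n)) →
      playPrefix p δ.length = δ → Follows d false s δ.length p → v p = 0 ∨ lam δ ≤ v p)
    (h5 : ∀ δ ∈ T, γ <+: δ → ∀ p ∈ Body T, (∀ n, ¬ Solv T d v (playPrefix p n)) →
      playPrefix p δ.length = δ → Follows d true s δ.length p → v p ≤ lam δ)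
    (h6 : ∀ δ ∈ T, γ <+: δ → ∀ p ∈ Body T, (∀ n, ¬ Solv T d v (playPrefix p n)) →
      SP T s δ p → v p ≠ 0) :
    Solv T d v γ := by
  classical
  let s' : List α → List α := fun δ => if Solv T d v δ ∨ ¬ γ <+: δ then sU δ else s δ
  have hs'U : ∀ δ, Solv T d v δ → s' δ = sU δ := fun δ h => if_pos (Or.inl h)
  have hs'S : ∀ δ, ¬ Solv T d v δ → γ <+: δ → s' δ = s δ := by
    intro δ h1 h2
    apply if_neg
    simp [h1, h2]
  have hs'P : IsProfile T s' := by
    intro δ hδ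
    by_cases h : Solv T d v δ ∨ ¬ γ <+: δ
    · simp only [s', if_pos h]; exact hsU δ hδ
    · simp only [s', if_neg h]
      push Not at h
      exact (hs δ hδ h.1 h.2).1
  have hgU : ∀ δ ∈ T, Solv T d v δ → Good T d v s' δ ∧ playOf s' δ = playOf sU δ := by
    intro δ hδ hS
    have hc : ∀ e ∈ T, δ <+: e → sU e = s' e := fun e _ hde => (hs'U e (hS.ext hde)).symm
    exact ⟨(hU δ hδ hS).congr hT hsU hs'P hδ hc, (playOf_congr hT hsU hs'P hδ hc).symm⟩
  refine ⟨s', hs'P, fun δ hδ hγδ => ?_⟩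
  by_cases hS : Solv T d v δ
  · exact (hgU δ hδ hS).1
  -- dichotomy for plays through δ
  have hdich : ∀ p ∈ Body T, playPrefix p δ.length = δ →
      (∀ n, ¬ Solv T d v (playPrefix p n)) ∨
      (∃ m, δ.length ≤ m ∧ Solv T d v (playPrefix p m) ∧ ∀ j < m, ¬ Solv T d v (playPrefix p j)) := by
    intro p hp ht
    by_cases hex : ∃ m, Solv T d v (playPrefix p m)
    · right
      refine ⟨Nat.find hex, ?_, Nat.find_spec hex, fun j hj => Nat.find_min hex hj⟩
      by_contra hlt
      apply hS
      rw [← ht]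
      exact (Nat.find_spec hex).ext (pp_pfx p (by omega))
    · left
      intro n hn
      exact hex ⟨n, hn⟩
  have hfolS : ∀ i p, p ∈ Body T → playPrefix p δ.length = δ → (∀ n, ¬ Solv T d v (playPrefix p n)) →
      Follows d i s' δ.length p → Follows d i s δ.length p := by
    intro i p hp ht hn hf m hm hd
    rw [hf m hm hd]
    exact hs'S _ (hn m) (hγδ.trans (prefix_of_thr ht hm))
  have hcone : ∀ p, playPrefix p δ.length = δ → ∀ m, δ.length ≤ m → γ <+: playPrefix p m :=
    fun p ht m hm => hγδ.trans (prefix_of_thr ht hm)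
  -- the outcome
  have hout : v (playOf s' δ) = lam δ := by
    obtain ⟨hb, ht, hf⟩ := playOf_SP hT hs'P hδ
    set q := playOf s' δ with hq
    rcases hdich q hb ht with hst | ⟨m, hm, hmS, hmin⟩
    · have hSPs : SP T s δ q := ⟨hb, ht, fun m hm => by
        rw [hf m hm]; exact hs'S _ (hst m) (hcone q ht m hm)⟩
      have a1 := h4 δ hδ hγδ q hb hst ht (fun m hm _ => hSPs.fol m hm)
      have a2 := h5 δ hδ hγδ q hb hst ht (fun m hm _ => hSPs.fol m hm)
      have a3 := h6 δ hδ hγδ q hb hst hSPs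
      omega
    · have hl : ∀ j, δ.length ≤ j → j ≤ m → lam (playPrefix q j) = lam δ := by
        intro j hj
        induction j, hj using Nat.le_induction with
        | base => intro _; rw [ht]
        | succ j hj ih =>
          intro hjm
          rw [hf j hj, hs'S _ (hmin j (by omega)) (hcone q ht j hj),
            (hs _ (hb j) (hmin j (by omega)) (hcone q ht j hj)).2.2, ih (by omega)]
      have hqm : q = playOf s' (playPrefix q m) := by
        refine SP.unique (T := T) (s := s') (s' := s') (γ := playPrefix q m) ⟨hb, by rw [length_pp], ?_⟩
          (playOf_SP hT hs'P (hb m)) (fun _ _ _ => rfl)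
        intro j hj
        rw [length_pp] at hj
        exact hf j (by omega)
      rw [← hl m hm le_rfl, hlam _ (hb m) hmS, ← (hgU _ (hb m) hmS).2, ← hqm]
  have hne := (hs δ hδ hS hγδ).2.1
  refine ⟨fun h0 => absurd (hout ▸ h0) hne, fun _ p hp ht hf => ?_, fun _ p hp ht hf => ?_⟩
  · rw [hout]
    rcases hdich p hp ht with hst | ⟨m, hm, hmS, hmin⟩
    · exact h4 δ hδ hγδ p hp hst ht (hfolS _ p hp ht hst hf)
    · have hl : ∀ j, δ.length ≤ j → j ≤ m → lam (playPrefix p j) = 0 ∨ lam δ ≤ lam (playPrefix p j) := by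
        intro j hj
        induction j, hj using Nat.le_induction with
        | base => intro _; rw [ht]; exact Or.inr le_rfl
        | succ j hj ih =>
          intro hjm
          have hjS := hmin j (by omega)
          have hc := hcone p ht j hj
          have hnz := (hs _ (hp j) hjS hc).2.1
          have hih : lam δ ≤ lam (playPrefix p j) := by
            rcases ih (by omega) with h | h
            · exact absurd h hnz
            · exact h
          cases hd : d (playPrefix p j) with
          | true =>
            rcases h2 _ (hp j) hjS hc hd _ (body_succ hp j) with h | h
            · exact Or.inl h
            · exact Or.inr (hih.trans h)
          | false =>
            right
            rw [hf j hj hd, hs'S _ hjS hc, (hs _ (hp j) hjS hc).2.2]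
            exact hih
      have hg := (hgU _ (hp m) hmS).1
      have he : lam (playPrefix p m) = v (playOf s' (playPrefix p m)) := by
        rw [hlam _ (hp m) hmS, (hgU _ (hp m) hmS).2]
      by_cases h0 : v (playOf s' (playPrefix p m)) = 0
      · exact Or.inl (hg.zero h0 p hp (by rw [length_pp]))
      · rcases hg.devA h0 p hp (by rw [length_pp])
          (fun j hj hd => hf j (by rw [length_pp] at hj; omega) hd) with h | h
        · exact Or.inl h
        · rcases hl m hm le_rfl with h' | h'
          · exact absurd (he ▸ h') h0
          · right; omega
  · rw [hout]
    rcases hdich p hp ht with hst | ⟨m, hm, hmS, hmin⟩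
    · exact h5 δ hδ hγδ p hp hst ht (hfolS _ p hp ht hst hf)
    · have hl : ∀ j, δ.length ≤ j → j ≤ m → lam (playPrefix p j) ≤ lam δ := by
        intro j hj
        induction j, hj using Nat.le_induction with
        | base => intro _; rw [ht]
        | succ j hj ih =>
          intro hjm
          have hjS := hmin j (by omega)
          have hc := hcone p ht j hj
          have hih := ih (by omega)
          cases hd : d (playPrefix p j) with
          | true =>
            rw [hf j hj hd, hs'S _ hjS hc, (hs _ (hp j) hjS hc).2.2]
            exact hih
          | false => exact (h3 _ (hp j) hjS hc hd _ (body_succ hp j)).trans hih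
      have hg := (hgU _ (hp m) hmS).1
      have he : lam (playPrefix p m) = v (playOf s' (playPrefix p m)) := by
        rw [hlam _ (hp m) hmS, (hgU _ (hp m) hmS).2]
      have hlm := hl m hm le_rfl
      by_cases h0 : v (playOf s' (playPrefix p m)) = 0
      · rw [hg.zero h0 p hp (by rw [length_pp])]; omega
      · have := hg.devB h0 p hp (by rw [length_pp])
          (fun j hj hd => hf j (by rw [length_pp] at hj; omega) hd)
        omega

end basics

end BD


namespace BD

universe u

section attr
variable {V : Type u}

/-- bounded reachability of `E` through `W` -/
inductive Reach (C : V → V → Prop) (W E : Set V) : ℕ → V → Prop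
  | here (w c : V) : w ∈ W → C w c → c ∈ E → Reach C W E 0 w
  | step (n : ℕ) (w c : V) : w ∈ W → C w c → Reach C W E n c → Reach C W E (n+1) w

variable {C : V → V → Prop}

theorem Reach.mem {W E : Set V} {n : ℕ} {w : V} (h : Reach C W E n w) : w ∈ W := by
  cases h <;> assumption

theorem Reach.mono {W W' E : Set V} (hW : W ⊆ W') {n : ℕ} {w : V} (h : Reach C W E n w) :
    Reach C W' E n w := by
  induction h with
  | here w c h1 h2 h3 => exact .here w c (hW h1) h2 h3
  | step n w c h1 h2 _ ih => exact .step n w c (hW h1) h2 ih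

variable (C) (dd : V → Bool) (R0 : Set V) (o : V → ℕ)

structure Ok (R : Set V) (k : ℕ) (W : Set V) : Prop where
  sub : W ⊆ R
  bown : ∀ w ∈ W, dd w = false → ∀ c, C w c → c ∈ W ∨ (c ∈ R0 ∧ c ∉ R) ∨ (c ∉ R0 ∧ o c ≤ k+1)
  reach : ∀ w ∈ W, ∃ n, Reach C W {c | c ∉ R0 ∧ o c = k+1} n w

def Wm (R : Set V) (k : ℕ) : Set V := ⋃₀ {W | Ok C dd R0 o R k W}

def LayR : ℕ → Set V
  | 0 => R0
  | k+1 => LayR k \ Wm C dd R0 o (LayR k) k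

variable {C dd R0 o}

theorem Ok.wm (R : Set V) (k : ℕ) : Ok C dd R0 o R k (Wm C dd R0 o R k) := by
  refine ⟨?_, ?_, ?_⟩
  · rintro w ⟨W, hW, hw⟩; exact hW.sub hw
  · rintro w ⟨W, hW, hw⟩ hd c hc
    rcases hW.bown w hw hd c hc with h | h
    · exact Or.inl ⟨W, hW, h⟩
    · exact Or.inr h
  · rintro w ⟨W, hW, hw⟩
    obtain ⟨n, hn⟩ := hW.reach w hw
    exact ⟨n, hn.mono (Set.subset_sUnion_of_mem hW)⟩

theorem Ok.le {R W : Set V} {k : ℕ} (h : Ok C dd R0 o R k W) : W ⊆ Wm C dd R0 o R k :=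
  Set.subset_sUnion_of_mem h

structure Inv (k : ℕ) (R : Set V) : Prop where
  aown : ∀ w ∈ R, dd w = true → ∀ c, C w c → c ∈ R ∨ (c ∉ R0 ∧ (o c = 0 ∨ k < o c))
  reach : ∀ w ∈ R, ∃ n, Reach C R {c | c ∉ R0 ∧ k < o c} n w

theorem Inv.step {R : Set V} {k : ℕ} (h : Inv (C := C) (dd := dd) (R0 := R0) (o := o) k R) :
    Inv (C := C) (dd := dd) (R0 := R0) (o := o) (k+1) (R \ Wm C dd R0 o R k) := by
  set W := Wm C dd R0 o R k with hW
  have hOk : Ok C dd R0 o R k W := Ok.wm R k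
  constructor
  · intro w hw hd c hc
    have key : (c ∈ W ∨ (c ∉ R0 ∧ o c = k+1)) → False := by
      intro hcase
      apply hw.2
      have : Ok C dd R0 o R k (insert w W) := by
        refine ⟨Set.insert_subset hw.1 hOk.sub, ?_, ?_⟩
        · rintro x (rfl | hx) hdx e he
          · rw [hd] at hdx; cases hdx
          · rcases hOk.bown x hx hdx e he with h1 | h1
            · exact Or.inl (Or.inr h1)
            · exact Or.inr h1
        · rintro x (rfl | hx)
          · rcases hcase with h1 | h1
            · obtain ⟨n, hn⟩ := hOk.reach c h1
              exact ⟨n+1, .step n _ c (Or.inl rfl) hc (hn.mono (Set.subset_insert _ _))⟩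
            · exact ⟨0, .here _ c (Or.inl rfl) hc h1⟩
          · obtain ⟨n, hn⟩ := hOk.reach x hx
            exact ⟨n, hn.mono (Set.subset_insert _ _)⟩
      exact this.le (Set.mem_insert _ _)
    rcases h.aown w hw.1 hd c hc with h1 | ⟨h1, h2 | h2⟩
    · left
      exact ⟨h1, fun h2 => key (Or.inl h2)⟩
    · exact Or.inr ⟨h1, Or.inl h2⟩
    · right
      refine ⟨h1, Or.inr ?_⟩
      by_contra h3
      exact key (Or.inr ⟨h1, by omega⟩)
  · intro w hw
    by_contra hno
    let Q : Set V := {w | w ∈ R \ W ∧ ¬ ∃ n, Reach C (R \ W) {c | c ∉ R0 ∧ k+1 < o c} n w}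
    have hQ1 : ∀ x ∈ Q, ∀ c, C x c → c ∉ R0 → o c ≤ k+1 := by
      intro x hx c hc hc0
      by_contra hlt
      exact hx.2 ⟨0, .here x c hx.1 hc ⟨hc0, by omega⟩⟩
    have hQ2 : ∀ x ∈ Q, ∀ c, C x c → c ∈ R → c ∈ Q ∪ W := by
      intro x hx c hc hcR
      by_cases hcW : c ∈ W
      · exact Or.inr hcW
      · refine Or.inl ⟨⟨hcR, hcW⟩, ?_⟩
        rintro ⟨n, hn⟩
        exact hx.2 ⟨n+1, .step n x c hx.1 hc hn⟩
    have hre : ∀ n x, Reach C R {c | c ∉ R0 ∧ k < o c} n x → x ∈ Q ∪ W →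
        ∃ n, Reach C (Q ∪ W) {c | c ∉ R0 ∧ o c = k+1} n x := by
      intro n x hx
      have hWc : ∀ x ∈ W, ∃ n, Reach C (Q ∪ W) {c | c ∉ R0 ∧ o c = k+1} n x := by
        intro x hx
        obtain ⟨n, hn⟩ := hOk.reach x hx
        exact ⟨n, hn.mono Set.subset_union_right⟩
      induction hx with
      | here x c h1 h2 h3 =>
        rintro (hq | hq)
        · have := hQ1 x hq c h2 h3.1
          have h4 := h3.2
          exact ⟨0, .here x c (Or.inl hq) h2 ⟨h3.1, by omega⟩⟩
        · exact hWc x hq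
      | step n x c h1 h2 h3 ih =>
        rintro (hq | hq)
        · obtain ⟨m, hm⟩ := ih (hQ2 x hq c h2 h3.mem)
          exact ⟨m+1, .step m x c (Or.inl hq) h2 hm⟩
        · exact hWc x hq
    have hOk2 : Ok C dd R0 o R k (Q ∪ W) := by
      refine ⟨Set.union_subset (fun x hx => hx.1.1) hOk.sub, ?_, ?_⟩
      · rintro x (hx | hx) hd c hc
        · by_cases hc0 : c ∈ R0
          · by_cases hcR : c ∈ R
            · exact Or.inl (hQ2 x hx c hc hcR)
            · exact Or.inr (Or.inl ⟨hc0, hcR⟩)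
          · exact Or.inr (Or.inr ⟨hc0, hQ1 x hx c hc hc0⟩)
        · rcases hOk.bown x hx hd c hc with h1 | h1
          · exact Or.inl (Or.inr h1)
          · exact Or.inr h1
      · intro x hx
        have hxR : x ∈ R := by
          rcases hx with hx | hx
          · exact hx.1.1
          · exact hOk.sub hx
        obtain ⟨n, hn⟩ := h.reach x hxR
        exact hre n x hn hx
    exact hw.2 (hOk2.le (Or.inl ⟨hw, hno⟩))

theorem layer (C : V → V → Prop) (dd : V → Bool) (R0 : Set V) (o : V → ℕ) (N : ℕ)
    (hN : ∀ c, o c ≤ N)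
    (hR : ∀ w ∈ R0, ∃ n, Reach C R0 {c | c ∉ R0 ∧ 0 < o c} n w) :
    ∃ (lam : V → ℕ) (s : V → V) (r : V → ℕ), (∀ c, c ∉ R0 → lam c = o c) ∧
      (∀ w ∈ R0, C w (s w) ∧ lam w ≠ 0 ∧ lam (s w) = lam w ∧ (s w ∈ R0 → r (s w) < r w)) ∧
      (∀ w ∈ R0, dd w = true → ∀ c, C w c → lam c = 0 ∨ lam w ≤ lam c) ∧
      (∀ w ∈ R0, dd w = false → ∀ c, C w c → lam c ≤ lam w) := by
  classical
  set R := LayR C dd R0 o with hRdef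
  have hR0 : R 0 = R0 := rfl
  have hRs : ∀ k, R (k+1) = R k \ Wm C dd R0 o (R k) k := fun k => rfl
  have hanti : Antitone R := antitone_nat_of_succ_le (fun k => by rw [hRs]; exact Set.diff_subset)
  have hinv : ∀ k, Inv (C := C) (dd := dd) (R0 := R0) (o := o) k (R k) := by
    intro k
    induction k with
    | zero =>
      refine ⟨fun w hw hd c hc => ?_, hR⟩
      by_cases h : c ∈ R0
      · exact Or.inl h
      · exact Or.inr ⟨h, Nat.eq_zero_or_pos _⟩
    | succ k ih => rw [hRs]; exact ih.step
  have hempty : ∀ w, w ∉ R N := by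
    intro w hw
    obtain ⟨n, hn⟩ := (hinv N).reach w hw
    induction hn with
    | here w c h1 h2 h3 => have := h3.2; have := hN c; omega
    | step n w c h1 h2 h3 ih => exact ih h3.mem
  have hex : ∀ w, ∃ k, w ∉ R k := fun w => ⟨N, hempty w⟩
  let f : V → ℕ := fun w => Nat.find (hex w)
  have hf : ∀ w k, w ∉ R k ↔ f w ≤ k := by
    intro w k
    constructor
    · intro h; exact Nat.find_min' _ h
    · intro h h'
      exact Nat.find_spec (hex w) (hanti h h')
  have hf' : ∀ w k, w ∈ R k ↔ k < f w := by
    intro w k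
    rw [← not_iff_not, hf]; omega
  have hfpos : ∀ w ∈ R0, ∃ j, f w = j + 1 ∧ w ∈ Wm C dd R0 o (R j) j := by
    intro w hw
    have h0 : 0 < f w := (hf' w 0).1 hw
    refine ⟨f w - 1, by omega, ?_⟩
    have h1 : w ∈ R (f w - 1) := (hf' _ _).2 (by omega)
    have h2 : w ∉ R (f w - 1 + 1) := (hf _ _).2 (by omega)
    rw [hRs] at h2
    by_contra h3
    exact h2 ⟨h1, h3⟩
  have hfW : ∀ w j, w ∈ Wm C dd R0 o (R j) j → f w = j + 1 := by
    intro w j h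
    have h1 := (hf' w j).1 ((Ok.wm (R j) j).sub h)
    have h2 : f w ≤ j + 1 := (hf w (j+1)).1 (by rw [hRs]; exact fun h3 => h3.2 h)
    omega
  have hWR0 : ∀ w j, w ∈ Wm C dd R0 o (R j) j → w ∈ R0 := fun w j h =>
    hanti (Nat.zero_le j) ((Ok.wm (R j) j).sub h)
  let lam : V → ℕ := fun w => if w ∈ R0 then f w else o w
  have hlam1 : ∀ w ∈ R0, lam w = f w := fun w h => if_pos h
  have hlam2 : ∀ w, w ∉ R0 → lam w = o w := fun w h => if_neg h
  have hre : ∀ w, w ∈ R0 → ∃ n, Reach C (Wm C dd R0 o (R (f w - 1)) (f w - 1))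
      {c | c ∉ R0 ∧ o c = f w} n w := by
    intro w hw
    obtain ⟨j, hj, hW⟩ := hfpos w hw
    have := (Ok.wm (R j) j).reach w hW
    rw [hj]
    exact this
  let r : V → ℕ := fun w => sInf {n | Reach C (Wm C dd R0 o (R (f w - 1)) (f w - 1))
      {c | c ∉ R0 ∧ o c = f w} n w}
  have hstep : ∀ w ∈ R0, ∃ c, C w c ∧ lam c = lam w ∧ (c ∈ R0 → r c < r w) := by
    intro w hw
    have hr : Reach C (Wm C dd R0 o (R (f w - 1)) (f w - 1))
      {c | c ∉ R0 ∧ o c = f w} (r w) w := Nat.sInf_mem (hre w hw)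
    rw [hlam1 w hw]
    generalize hn : r w = n at hr
    cases hr with
    | here _ c h1 h2 h3 => exact ⟨c, h2, by rw [hlam2 c h3.1]; exact h3.2, fun h => absurd h h3.1⟩
    | step n _ c h1 h2 h3 =>
      have e := hfW _ _ h3.mem
      obtain ⟨j, hj, -⟩ := hfpos w hw
      have e' : f c = f w := by omega
      refine ⟨c, h2, by rw [hlam1 c (hWR0 _ _ h3.mem), e'], fun _ => ?_⟩
      have : r c ≤ n := by
        apply Nat.sInf_le
        change Reach C _ _ _ _
        rw [e']
        exact h3
      omega
  choose! s hs using hstep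
  refine ⟨lam, s, r, hlam2, fun w hw => ⟨(hs w hw).1, ?_, (hs w hw).2.1, (hs w hw).2.2⟩, ?_, ?_⟩
  · obtain ⟨j, hj, -⟩ := hfpos w hw
    rw [hlam1 w hw]; omega
  · intro w hw hd c hc
    obtain ⟨j, hj, hW⟩ := hfpos w hw
    rw [hlam1 w hw]
    rcases (hinv j).aown w ((Ok.wm (R j) j).sub hW) hd c hc with h | ⟨h, h1⟩
    · rw [hlam1 c (hanti (Nat.zero_le j) h)]
      have := (hf' c j).1 h
      omega
    · rw [hlam2 c h]; omega
  · intro w hw hd c hc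
    obtain ⟨j, hj, hW⟩ := hfpos w hw
    rw [hlam1 w hw]
    rcases (Ok.wm (R j) j).bown w hW hd c hc with h | ⟨h, h1⟩ | ⟨h, h1⟩
    · rw [hlam1 c (hWR0 _ _ h), hfW c j h]; omega
    · rw [hlam1 c h]
      have := (hf c j).1 h1
      omega
    · rw [hlam2 c h]; omega

end attr

section case2
variable {α : Type u} [Inhabited α] {T : Set (List α)} {d : List α → Bool} {v : (ℕ → α) → ℕ}

theorem case2 (hP : IsPruned T) (hT : IsTree T) (N : ℕ) (hN : ∀ p, v p ≤ N) (γ : List α)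
    (h0 : ∀ p ∈ Body T, (∀ n, ¬ Solv T d v (playPrefix p n)) → playPrefix p γ.length = γ → v p = 0) :
    Solv T d v γ := by
  obtain ⟨sU, hsU, hU⟩ := solv_global (d := d) (v := v) hP hT
  let R0 : Set (List α) := {δ | δ ∈ T ∧ ¬ Solv T d v δ ∧ γ <+: δ}
  let o : List α → ℕ := fun e => v (playOf sU e)
  let C : List α → List α → Prop := fun w c => c ∈ treeSucc T w
  have hR : ∀ w ∈ R0, ∃ n, Reach C R0 {c | c ∉ R0 ∧ 0 < o c} n w := by
    rintro w ⟨hw, hS, hγ⟩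
    have : ∃ p ∈ Body T, playPrefix p w.length = w ∧ v p ≠ 0 := by
      by_contra hno
      push Not at hno
      exact hS (solv_of_zero hP hT hno)
    obtain ⟨p, hp, hpw, hvp⟩ := this
    have hpγ : playPrefix p γ.length = γ :=
      pp_eq_of_pfx (n := w.length) (by rw [hpw]; exact hγ)
    have hex : ∃ m, Solv T d v (playPrefix p m) := by
      by_contra hno
      push Not at hno
      exact hvp (h0 p hp hno hpγ)
    classical
    obtain ⟨hm1, hm2⟩ := (⟨Nat.find_spec hex, fun j hj => Nat.find_min hex hj⟩ :
      Solv T d v (playPrefix p (Nat.find hex)) ∧ ∀ j < Nat.find hex, ¬ Solv T d v (playPrefix p j))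
    set m := Nat.find hex
    have hwm : w.length < m := by
      by_contra hle
      apply hS
      rw [← hpw]
      exact hm1.ext (pp_pfx p (by omega))
    have hin : ∀ j, w.length ≤ j → j < m → playPrefix p j ∈ R0 := fun j h1 h2 =>
      ⟨hp j, hm2 j h2, hγ.trans (prefix_of_thr hpw h1)⟩
    have key : ∀ k, ∀ j, w.length ≤ j → j + k + 1 = m →
        Reach C R0 {c | c ∉ R0 ∧ 0 < o c} k (playPrefix p j) := by
      intro k
      induction k with
      | zero =>
        intro j h1 h2
        refine .here _ (playPrefix p (j+1)) (hin j h1 (by omega)) (body_succ hp j) ⟨?_, ?_⟩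
        · intro h3
          apply h3.2.1
          rw [show j + 1 = m by omega]
          exact hm1
        · apply Nat.pos_of_ne_zero
          intro h3
          rw [show j + 1 = m by omega] at h3
          refine hvp ((hU _ (hp m) hm1).zero h3 p hp ?_)
          rw [length_pp]
      | succ k ih =>
        intro j h1 h2
        exact .step k _ (playPrefix p (j+1)) (hin j h1 (by omega)) (body_succ hp j)
          (ih (j+1) (by omega) (by omega))
    refine ⟨m - w.length - 1, ?_⟩
    have := key (m - w.length - 1) w.length le_rfl (by omega)
    rwa [hpw] at this
  obtain ⟨lam, s, r, hl, hs, h2, h3⟩ := layer C d R0 o N (fun c => hN _) hR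
  refine glue hT sU hsU hU γ lam (fun e he hS => hl e (fun h => h.2.1 hS)) s ?_ ?_ ?_ ?_ ?_ ?_
  · intro δ hδ hS hg
    have := hs δ ⟨hδ, hS, hg⟩
    exact ⟨this.1, this.2.1, this.2.2.1⟩
  · intro δ hδ hS hg
    exact h2 δ ⟨hδ, hS, hg⟩
  · intro δ hδ hS hg
    exact h3 δ ⟨hδ, hS, hg⟩
  · intro δ hδ hg p hp hst ht _
    exact Or.inl (h0 p hp hst (pp_eq_of_pfx (n := δ.length) (by rw [ht]; exact hg)))
  · intro δ hδ hg p hp hst ht _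
    rw [h0 p hp hst (pp_eq_of_pfx (n := δ.length) (by rw [ht]; exact hg))]
    exact Nat.zero_le _
  · intro δ hδ hg p hp hst hSP
    exfalso
    have hin : ∀ j, δ.length ≤ j → playPrefix p j ∈ R0 := fun j h1 =>
      ⟨hp j, hst j, hg.trans (prefix_of_thr hSP.thr h1)⟩
    have hdec : ∀ k, r (playPrefix p (δ.length + k)) + k ≤ r (playPrefix p δ.length) := by
      intro k
      induction k with
      | zero => simp
      | succ k ih =>
        have e := hSP.fol (δ.length + k) (by omega)
        have := (hs _ (hin (δ.length + k) (by omega))).2.2.2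
        rw [← e] at this
        have := this (hin _ (by omega))
        rw [show δ.length + (k+1) = δ.length + k + 1 by omega]
        omega
    have := hdec (r (playPrefix p δ.length) + 1)
    omega

end case2

end BD


namespace BD

universe u

section unif
variable {α : Type u} [Inhabited α] {T : Set (List α)}

theorem ev_const (f : ℕ → ℕ) (m0 : ℕ) (h : ∀ m, m0 ≤ m → f (m+1) ≤ f m) :
    ∃ m1, m0 ≤ m1 ∧ ∀ m, m1 ≤ m → f m = f m1 := by
  classical
  have hex : ∃ x, ∃ m, m0 ≤ m ∧ f m = x := ⟨_, m0, le_rfl, rfl⟩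
  obtain ⟨m1, h1, h2⟩ := Nat.find_spec hex
  refine ⟨m1, h1, fun m hm => ?_⟩
  have h3 : f m ≤ f m1 := by
    induction m, hm using Nat.le_induction with
    | base => exact le_rfl
    | succ m hm ih => exact (h m (by omega)).trans ih
  have h4 : Nat.find hex ≤ f m := Nat.find_min' hex ⟨m, by omega, rfl⟩
  omega

def Forces (T : Set (List α)) (d : List α → Bool) (u : (ℕ → α) → ℕ) (i : Bool) (k : ℕ)
    (δ : List α) (σ : List α → List α) : Prop :=
  ∀ p ∈ Body T, playPrefix p δ.length = δ → Follows d i σ δ.length p → u p ≤ k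

theorem Forces.child {d : List α → Bool} {u : (ℕ → α) → ℕ} {i : Bool} {k : ℕ}
    {δ c : List α} {σ : List α → List α} (h : Forces T d u i k δ σ) (hc : c ∈ treeSucc T δ)
    (hd : d δ = i → σ δ = c) : Forces T d u i k c σ := by
  intro p hp ht hf
  have hl : c.length = δ.length + 1 := hc.2.2
  have hpδ : playPrefix p δ.length = δ :=
    pp_eq_of_pfx (n := c.length) (by rw [ht]; exact hc.2.1)
  refine h p hp hpδ ?_
  intro m hm hdm
  rcases Nat.eq_or_lt_of_le hm with rfl | hlt
  · rw [hpδ] at hdm ⊢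
    rw [hd hdm, ← hl, ht]
  · exact hf m (by omega) hdm

theorem unif [Countable α] (hP : IsPruned T) (d : List α → Bool)
    (u : (ℕ → α) → ℕ) (N : ℕ) (hN : ∀ p, u p ≤ N) (i : Bool) :
    ∃ (s : List α → List α) (val : List α → ℕ), IsProfile T s ∧
      (∀ δ ∈ T, Forces T d u i (val δ) δ s) ∧
      (∀ δ ∈ T, d δ = i → val (s δ) = val δ ∧ ∀ c ∈ treeSucc T δ, val δ ≤ val c) ∧
      (∀ δ ∈ T, d δ ≠ i → ∀ c ∈ treeSucc T δ, val c ≤ val δ) ∧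
      (∀ δ ∈ T, ∀ k σ, IsProfile T σ → Forces T d u i k δ σ → val δ ≤ k) := by
  classical
  obtain ⟨s0, hs0⟩ := exists_profile hP
  have hex : ∀ δ, ∃ k, ∃ σ, IsProfile T σ ∧ Forces T d u i k δ σ :=
    fun δ => ⟨N, s0, hs0, fun p _ _ _ => hN p⟩
  let val : List α → ℕ := fun δ => Nat.find (hex δ)
  have hmin : ∀ δ k σ, IsProfile T σ → Forces T d u i k δ σ → val δ ≤ k :=
    fun δ k σ h1 h2 => Nat.find_min' (hex δ) ⟨σ, h1, h2⟩
  have hspec : ∀ δ, ∃ σ, IsProfile T σ ∧ Forces T d u i (val δ) δ σ :=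
    fun δ => Nat.find_spec (hex δ)
  choose σ hσ1 hσ2 using hspec
  obtain ⟨enc⟩ : Nonempty (Encodable (List α)) := ⟨Encodable.ofCountable _⟩
  let τ : ℕ → List α → List α := fun n => ((Encodable.decode n).map σ).getD s0
  have hτ1 : ∀ n, IsProfile T (τ n) := by
    intro n
    simp only [τ]
    cases (Encodable.decode n : Option (List α)) with
    | none => exact hs0
    | some x => exact hσ1 x
  have hτ2 : ∀ δ, ∃ n, Forces T d u i (val δ) δ (τ n) := by
    intro δ
    refine ⟨Encodable.encode δ, ?_⟩
    simp only [τ, Encodable.encodek]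
    exact hσ2 δ
  let ref : List α → ℕ := fun δ => Nat.find (hτ2 δ)
  have href : ∀ δ, Forces T d u i (val δ) δ (τ (ref δ)) := fun δ => Nat.find_spec (hτ2 δ)
  have hrefmin : ∀ δ n, Forces T d u i (val δ) δ (τ n) → ref δ ≤ n :=
    fun δ n h => Nat.find_min' (hτ2 δ) h
  have hown : ∀ δ ∈ T, d δ = i → ∀ c ∈ treeSucc T δ, val δ ≤ val c := by
    intro δ hδ hd c hc
    refine hmin δ _ (Function.update (σ c) δ c) ?_ ?_
    · intro e he
      by_cases h : e = δ
      · subst h; simpa using hc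
      · rw [Function.update_of_ne h]; exact hσ1 c e he
    · intro p hp ht hf
      have hl : c.length = δ.length + 1 := hc.2.2
      have h1 := hf δ.length le_rfl (by rw [ht]; exact hd)
      rw [ht, Function.update_self] at h1
      refine hσ2 c p hp (by rw [hl]; exact h1) ?_
      intro m hm hdm
      have h2 := hf m (by omega) hdm
      rw [Function.update_of_ne] at h2
      · exact h2
      · intro h3
        have := congrArg List.length h3
        rw [length_pp] at this
        omega
  have hopp : ∀ δ ∈ T, d δ ≠ i → ∀ c ∈ treeSucc T δ, val c ≤ val δ := by
    intro δ hδ hd c hc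
    exact hmin c _ (σ δ) (hσ1 δ) ((hσ2 δ).child hc (fun h => absurd h hd))
  let s : List α → List α := fun δ => τ (ref δ) δ
  have hsP : IsProfile T s := fun δ hδ => hτ1 _ δ hδ
  have hsval : ∀ δ ∈ T, d δ = i → val (s δ) = val δ := by
    intro δ hδ hd
    apply le_antisymm
    · exact hmin _ _ _ (hτ1 _) ((href δ).child (hsP δ hδ) (fun _ => rfl))
    · exact hown δ hδ hd _ (hsP δ hδ)
  refine ⟨s, val, hsP, ?_, fun δ hδ hd => ⟨hsval δ hδ hd, hown δ hδ hd⟩, hopp,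
    fun δ _ => hmin δ⟩
  intro δ hδ p hp ht hf
  have hstepv : ∀ m, δ.length ≤ m → val (playPrefix p (m+1)) ≤ val (playPrefix p m) := by
    intro m hm
    by_cases hd : d (playPrefix p m) = i
    · rw [hf m hm hd]; exact (hsval _ (hp m) hd).le
    · exact hopp _ (hp m) hd _ (body_succ hp m)
  obtain ⟨m1, hm1, hc1⟩ := ev_const (fun m => val (playPrefix p m)) δ.length hstepv
  have hstepr : ∀ m, m1 ≤ m → ref (playPrefix p (m+1)) ≤ ref (playPrefix p m) := by
    intro m hm
    apply hrefmin
    have e : val (playPrefix p (m+1)) = val (playPrefix p m) :=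
      (hc1 (m+1) (by omega)).trans (hc1 m hm).symm
    rw [e]
    refine (href _).child (body_succ hp m) (fun hd => ?_)
    exact (hf m (by omega) hd).symm
  obtain ⟨m2, hm2, hc2⟩ := ev_const (fun m => ref (playPrefix p m)) m1 hstepr
  have hlast : u p ≤ val (playPrefix p m2) := by
    refine href (playPrefix p m2) p hp (by rw [length_pp]) ?_
    intro m hm hd
    rw [length_pp] at hm
    have h1 := hf m (by omega) hd
    rw [h1]
    change τ (ref _) _ = _
    rw [hc2 m hm]
  have hle : val (playPrefix p m2) ≤ val δ := by
    have : ∀ m, δ.length ≤ m → val (playPrefix p m) ≤ val δ := by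
      intro m hm
      induction m, hm using Nat.le_induction with
      | base => rw [ht]
      | succ m hm ih => exact (hstepv m hm).trans ih
    exact this m2 (by omega)
  exact hlast.trans hle

theorem meas_pp [Countable α] (P : List α → Prop) (n : ℕ) :
    @MeasurableSet (ℕ → α) (CylM α) {p | P (playPrefix p n)} := by
  have e : {p : ℕ → α | P (playPrefix p n)} = ⋃ γ ∈ {γ : List α | P γ ∧ γ.length = n}, Cyl γ := by
    ext p
    simp only [Set.mem_setOf_eq, Set.mem_iUnion, Cyl, exists_prop]
    constructor
    · intro h
      exact ⟨playPrefix p n, ⟨h, length_pp p n⟩, by rw [length_pp]⟩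
    · rintro ⟨γ, ⟨h1, rfl⟩, h2⟩
      rw [h2]; exact h1
  rw [e]
  refine @MeasurableSet.biUnion _ _ (CylM α) _ _ (Set.to_countable _) (fun γ _ => ?_)
  exact MeasurableSpace.measurableSet_generateFrom ⟨γ, rfl⟩

theorem meas_body [Countable α] : @MeasurableSet (ℕ → α) (CylM α) (Body T) := by
  have e : Body T = ⋂ n, {p : ℕ → α | playPrefix p n ∈ T} := by
    ext p; simp [Body]
  rw [e]
  exact @MeasurableSet.iInter _ _ (CylM α) _ _ (fun n => meas_pp _ n)

end unif

section case1
variable {α : Type u} [Inhabited α] [Countable α] {T : Set (List α)} {d : List α → Bool}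
  {v : (ℕ → α) → ℕ}

theorem case1 (hP : IsPruned T) (hT : IsTree T) (N : ℕ) (hN : ∀ p, v p ≤ N)
    (hM : ∀ k, @MeasurableSet (ℕ → α) (CylM α) {p | p ∈ Body T ∧ v p ≤ k}) (γ : List α)
    (h0 : ∀ p ∈ Body T, (∀ n, ¬ Solv T d v (playPrefix p n)) → playPrefix p γ.length = γ → v p ≠ 0) :
    Solv T d v γ := by
  classical
  obtain ⟨sU, hsU, hU⟩ := solv_global (d := d) (v := v) hP hT
  let o : List α → ℕ := fun e => v (playOf sU e)
  let T' : Set (List α) := {δ | ∃ p ∈ Body T, playPrefix p δ.length = δ ∧ v p ≠ 0}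
  have hT'T : T' ⊆ T := by
    rintro δ ⟨p, hp, h, -⟩
    rw [← h]; exact hp _
  have hT' : IsTree T' := by
    rintro e δ hpre ⟨p, hp, h, hv⟩
    exact ⟨p, hp, pp_eq_of_pfx (n := δ.length) (by rw [h]; exact hpre), hv⟩
  have hP' : IsPruned T' := by
    rintro δ ⟨p, hp, h, hv⟩
    have := body_succ hp δ.length
    rw [h] at this
    exact ⟨_, ⟨p, hp, by rw [length_pp], hv⟩, this.2⟩
  have hsub : ∀ {δ c}, c ∈ treeSucc T' δ → c ∈ treeSucc T δ := fun h => ⟨hT'T h.1, h.2⟩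
  have hBT : ∀ p, p ∈ Body T' → p ∈ Body T := fun p hp n => hT'T (hp n)
  have hun : ∀ δ ∈ T, ¬ Solv T d v δ → δ ∈ T' := by
    intro δ _ hS
    by_contra hno
    apply hS
    apply solv_of_zero hP hT
    intro p hp ht
    by_contra hv
    exact hno ⟨p, hp, ht, hv⟩
  have hout : ∀ c ∈ T, c ∉ T' → o c = 0 := by
    intro c hc hno
    by_contra hv
    have := playOf_SP hT hsU hc
    exact hno ⟨_, this.body, this.thr, hv⟩
  have hin : ∀ c ∈ T', Solv T d v c → o c ≠ 0 := by
    rintro c ⟨p, hp, ht, hv⟩ hS h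
    have hc : c ∈ T := by rw [← ht]; exact hp _
    exact hv ((hU c hc hS).zero h p hp ht)
  let w : (ℕ → α) → ℕ := fun p =>
    if h : ∃ m, Solv T d v (playPrefix p m) then o (playPrefix p (Nat.find h)) else v p
  have hwN : ∀ p, w p ≤ N := by
    intro p
    simp only [w]
    split_ifs
    · exact hN _
    · exact hN _
  have hw1 : ∀ p, (∀ n, ¬ Solv T d v (playPrefix p n)) → w p = v p := by
    intro p h
    exact dif_neg (by push Not; exact h)
  have hw2 : ∀ p m, Solv T d v (playPrefix p m) → (∀ j < m, ¬ Solv T d v (playPrefix p j)) →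
      w p = o (playPrefix p m) := by
    intro p m h1 h2
    have hex : ∃ m, Solv T d v (playPrefix p m) := ⟨m, h1⟩
    have e : Nat.find hex = m := (Nat.find_eq_iff hex).2 ⟨h1, h2⟩
    simp only [w]
    rw [dif_pos hex, e]
  have hw0 : ∀ p ∈ Body T', playPrefix p γ.length = γ → w p ≠ 0 := by
    intro p hp ht
    by_cases hex : ∃ m, Solv T d v (playPrefix p m)
    · rw [hw2 p (Nat.find hex) (Nat.find_spec hex) (fun j hj => Nat.find_min hex hj)]
      exact hin _ (hp _) (Nat.find_spec hex)
    · push Not at hex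
      rw [hw1 p hex]
      exact h0 p (hBT p hp) hex ht
  -- measurability
  have hMw : ∀ k, @MeasurableSet (ℕ → α) (CylM α) {p | p ∈ Body T ∧ w p ≤ k} := by
    intro k
    letI : MeasurableSpace (ℕ → α) := CylM α
    have e : {p | p ∈ Body T ∧ w p ≤ k} =
        ((⋂ n, {p : ℕ → α | ¬ Solv T d v (playPrefix p n)}) ∩ {p | p ∈ Body T ∧ v p ≤ k}) ∪
        (Body T ∩ ⋃ m, ({p : ℕ → α | Solv T d v (playPrefix p m) ∧ o (playPrefix p m) ≤ k} ∩
          ⋂ j, ⋂ (_ : j < m), {p : ℕ → α | ¬ Solv T d v (playPrefix p j)})) := by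
      ext p
      simp only [Set.mem_setOf_eq, Set.mem_union, Set.mem_inter_iff, Set.mem_iInter, Set.mem_iUnion]
      constructor
      · rintro ⟨hp, hk⟩
        by_cases hex : ∃ m, Solv T d v (playPrefix p m)
        · right
          have := hw2 p (Nat.find hex) (Nat.find_spec hex) (fun j hj => Nat.find_min hex hj)
          exact ⟨hp, Nat.find hex, ⟨Nat.find_spec hex, by rw [← this]; exact hk⟩,
            fun j hj => Nat.find_min hex hj⟩
        · push Not at hex
          left
          exact ⟨hex, hp, by rw [← hw1 p hex]; exact hk⟩
      · rintro (⟨h1, h2, h3⟩ | ⟨hp, m, ⟨h1, h2⟩, h3⟩)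
        · exact ⟨h2, by rw [hw1 p h1]; exact h3⟩
        · exact ⟨hp, by rw [hw2 p m h1 h3]; exact h2⟩
    rw [e]
    refine MeasurableSet.union (MeasurableSet.inter (MeasurableSet.iInter fun n => ?_) (hM k))
      (MeasurableSet.inter meas_body (MeasurableSet.iUnion fun m => MeasurableSet.inter ?_
        (MeasurableSet.iInter fun j => MeasurableSet.iInter fun _ => ?_)))
    · exact meas_pp (fun e => ¬ Solv T d v e) n
    · exact meas_pp (fun e => Solv T d v e ∧ o e ≤ k) m
    · exact meas_pp (fun e => ¬ Solv T d v e) j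
  obtain ⟨sa, A, hsa, hA1, hA2, hA3, hA4⟩ := unif hP' d w N hwN true
  obtain ⟨sb, B, hsb, hB1, hB2, hB3, hB4⟩ := unif hP' d (fun p => N - w p) N
    (fun p => Nat.sub_le _ _) false
  have hAN : ∀ δ ∈ T', A δ ≤ N := fun δ hδ => hA4 δ hδ N sa hsa (fun p _ _ _ => hwN p)
  let s : List α → List α := fun δ => if d δ = true then sa δ else sb δ
  have hsT : ∀ δ, d δ = true → s δ = sa δ := fun δ h => if_pos h
  have hsF : ∀ δ, d δ = false → s δ = sb δ := fun δ h => if_neg (by simp [h])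
  have hsP : IsProfile T' s := by
    intro δ hδ
    cases h : d δ with
    | true => rw [hsT δ h]; exact hsa δ hδ
    | false => rw [hsF δ h]; exact hsb δ hδ
  have hfa : ∀ δ p, Follows d true s δ p → Follows d true sa δ p := by
    intro δ p h m hm hd
    rw [h m hm hd, hsT _ hd]
  have hfb : ∀ δ p, Follows d false s δ p → Follows d false sb δ p := by
    intro δ p h m hm hd
    rw [h m hm hd, hsF _ hd]
  have hAB : ∀ δ ∈ T', B δ = N - A δ := by
    intro δ hδ
    apply le_antisymm
    · rcases Nat.eq_zero_or_pos (A δ) with h | h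
      · rw [h]
        exact hB4 δ hδ _ sb hsb (fun p _ _ _ => by change N - w p ≤ N - 0; omega)
      · rcases borel_det hT' hP' d {p | p ∈ Body T ∧ w p ≤ A δ - 1} (hMw _) δ hδ with
          ⟨σ, hσ, h1⟩ | ⟨σ, hσ, h1⟩
        · have := hA4 δ hδ (A δ - 1) σ hσ (fun p hp ht hf => (h1 p hp ht hf).2)
          omega
        · refine hB4 δ hδ _ σ hσ (fun p hp ht hf => ?_)
          have h2 := h1 p hp ht hf
          simp only [Set.mem_setOf_eq, not_and, not_le] at h2
          have := h2 (hBT p hp)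
          change N - w p ≤ _
          omega
    · have hp := playOf_SP hT' hsP hδ
      have h1 := hA1 δ hδ _ hp.body hp.thr (hfa _ _ (fun m hm _ => hp.fol m hm))
      have h2 := hB1 δ hδ _ hp.body hp.thr (hfb _ _ (fun m hm _ => hp.fol m hm))
      simp only at h2
      omega
  let lam : List α → ℕ := fun δ => if Solv T d v δ then o δ else A δ
  have hl1 : ∀ δ, Solv T d v δ → lam δ = o δ := fun δ h => if_pos h
  have hl2 : ∀ δ, ¬ Solv T d v δ → lam δ = A δ := fun δ h => if_neg h
  have hlc : ∀ δ ∈ T, ¬ Solv T d v δ → ∀ c ∈ treeSucc T δ, c ∈ T' → lam c = A c := by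
    intro δ hδ hS c hc hc'
    by_cases hSc : Solv T d v c
    · rw [hl1 c hSc]
      have hwc : ∀ p ∈ Body T', playPrefix p c.length = c → w p = o c := by
        intro p hp ht
        rw [hw2 p c.length (by rw [ht]; exact hSc) ?_, ht]
        intro j hj hSj
        apply hS
        have hpδ : playPrefix p δ.length = δ :=
          pp_eq_of_pfx (n := c.length) (by rw [ht]; exact hc.2.1)
        rw [← hpδ]
        have hl := hc.2.2
        exact hSj.ext (pp_pfx p (by omega))
      apply le_antisymm
      · have hp := playOf_SP hT' hsa hc'
        have := hA1 c hc' _ hp.body hp.thr (fun m hm _ => hp.fol m hm)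
        rw [hwc _ hp.body hp.thr] at this
        exact this
      · exact hA4 c hc' _ sa hsa (fun p hp ht _ => (hwc p hp ht).le)
    · exact hl2 c hSc
  have hlo : ∀ c ∈ T, c ∉ T' → lam c = 0 := by
    intro c hc hc'
    have : Solv T d v c := by
      by_contra h
      exact hc' (hun c hc h)
    rw [hl1 c this, hout c hc hc']
  have hgam : ∀ {δ : List α} {p : ℕ → α}, γ <+: δ → playPrefix p δ.length = δ →
      playPrefix p γ.length = γ := fun hg ht =>
    pp_eq_of_pfx (n := _) (by rw [ht]; exact hg)
  refine glue hT sU hsU hU γ lam (fun e he hS => hl1 e hS) s ?_ ?_ ?_ ?_ ?_ ?_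
  · intro δ hδ hS hg
    have hδ' := hun δ hδ hS
    refine ⟨hsub (hsP δ hδ'), ?_, ?_⟩
    · rw [hl2 δ hS]
      have hp := playOf_SP hT' hsa hδ'
      have := hA1 δ hδ' _ hp.body hp.thr (fun m hm _ => hp.fol m hm)
      have := hw0 _ hp.body (hgam hg hp.thr)
      omega
    · rw [hlc δ hδ hS _ (hsub (hsP δ hδ')) (hsP δ hδ').1, hl2 δ hS]
      cases h : d δ with
      | true => rw [hsT δ h]; exact (hA2 δ hδ' h).1
      | false =>
        rw [hsF δ h]
        have h1 := (hB2 δ hδ' h).1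
        have hc := (hsb δ hδ').1
        rw [hAB _ hc, hAB _ hδ'] at h1
        have := hAN _ hc
        have := hAN _ hδ'
        omega
  · intro δ hδ hS hg hd c hc
    by_cases hc' : c ∈ T'
    · right
      rw [hlc δ hδ hS c hc hc', hl2 δ hS]
      exact (hA2 δ (hun δ hδ hS) hd).2 c ⟨hc', hc.2⟩
    · exact Or.inl (hlo c hc.1 hc')
  · intro δ hδ hS hg hd c hc
    by_cases hc' : c ∈ T'
    · rw [hlc δ hδ hS c hc hc', hl2 δ hS]
      exact hA3 δ (hun δ hδ hS) (by simp [hd]) c ⟨hc', hc.2⟩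
    · rw [hlo c hc.1 hc']; exact Nat.zero_le _
  · intro δ hδ hg p hp hst ht hf
    right
    have hS : ¬ Solv T d v δ := by rw [← ht]; exact hst _
    have hδ' := hun δ hδ hS
    have hp' : p ∈ Body T' := fun n => hun _ (hp n) (hst n)
    have h1 := hB1 δ hδ' p hp' ht (hfb _ _ hf)
    rw [hAB _ hδ'] at h1
    simp only [hw1 p hst] at h1
    rw [hl2 δ hS]
    have := hAN δ hδ'
    have := hN p
    omega
  · intro δ hδ hg p hp hst ht hf
    have hS : ¬ Solv T d v δ := by rw [← ht]; exact hst _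
    have hδ' := hun δ hδ hS
    have hp' : p ∈ Body T' := fun n => hun _ (hp n) (hst n)
    have h1 := hA1 δ hδ' p hp' ht (hfa _ _ hf)
    rw [hw1 p hst] at h1
    rw [hl2 δ hS]
    exact h1
  · intro δ hδ hg p hp hst hSP
    exact h0 p hp hst (hgam hg hSP.thr)

end case1

end BD


namespace BD

universe u

section final
variable {α : Type u} [Inhabited α]

theorem meas_of_borel [Countable α] {T : Set (List α)} {X : Set (ℕ → α)} (h : IsBorelIn T X) :
    @MeasurableSet (ℕ → α) (CylM α) X := by
  have hle : MeasurableSpace.generateFrom {A | IsOpenIn T A} ≤ CylM α := by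
    apply MeasurableSpace.generateFrom_le
    rintro A ⟨S, hS, rfl⟩
    refine @MeasurableSet.biUnion _ _ (CylM α) _ _ (Set.to_countable _) (fun γ _ => ?_)
    have e : cylinder T γ = Body T ∩ Cyl γ := rfl
    rw [e]
    exact @MeasurableSet.inter _ (CylM α) _ _ meas_body
      (MeasurableSpace.measurableSet_generateFrom ⟨γ, rfl⟩)
  exact hle _ h.2

theorem pp_listExtend (γ : List α) (q : ℕ → α) (k : ℕ) :
    playPrefix (listExtend γ q) (γ.length + k) = γ ++ playPrefix q k := by
  apply List.ext_getElem
  · simp [length_pp]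
  · intro i h1 h2
    rw [getElem_pp]
    rw [length_pp] at h1
    by_cases h : i < γ.length
    · rw [List.getElem_append_left h]
      simp [listExtend, h]
    · rw [List.getElem_append_right (by omega), getElem_pp]
      simp [listExtend, h]

theorem pp_listExtend0 (γ : List α) (q : ℕ → α) :
    playPrefix (listExtend γ q) γ.length = γ := by
  have := pp_listExtend γ q 0
  simpa [playPrefix] using this

theorem sub_body {T : Set (List α)} (hT : IsTree T) {γ : List α} {q : ℕ → α}
    (hq : q ∈ Body {δ | γ ++ δ ∈ T}) : listExtend γ q ∈ Body T :=
  body_of_large hT γ.length (fun k => by rw [pp_listExtend]; exact hq k)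

theorem sub_profile {T : Set (List α)} {s : List α → List α} (hs : IsProfile T s) {γ δ : List α}
    (hδ : γ ++ δ ∈ T) : γ ++ subProfile γ s δ = s (γ ++ δ) := by
  obtain ⟨t, ht⟩ := (hs _ hδ).2.1
  simp only [subProfile]
  rw [← ht, List.append_assoc, List.drop_left]

theorem sub_isProfile {T : Set (List α)} {s : List α → List α} (hs : IsProfile T s) {γ : List α} :
    IsProfile {δ | γ ++ δ ∈ T} (subProfile γ s) := by
  intro δ hδ
  have e := sub_profile hs hδ
  have h := hs _ hδ
  rw [← e] at h
  refine ⟨h.1, ?_, ?_⟩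
  · exact (List.prefix_append_right_inj γ).1 h.2.1
  · have := h.2.2
    simp only [List.length_append] at this
    omega

theorem gpspe_of_good (n : ℕ) (g : Game α Bool (Fin (n + 1)))
    (hT : IsTree g.T) (hpa : g.pref true = prefA n) (hpb : g.pref false = prefB n)
    (s : List α → List α) (hs : IsProfile g.T s)
    (hG : ∀ γ ∈ g.T, Good g.T g.d (fun p => (g.v p).val) s γ) : IsGPSPE g s := by
  have hsubT : ∀ γ, IsTree {δ | γ ++ δ ∈ g.T} := by
    intro γ e δ h1 h2
    exact hT ((List.prefix_append_right_inj γ).2 h1) h2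
  have hplay : ∀ γ ∈ g.T, ∀ s', IsProfile {δ | γ ++ δ ∈ g.T} s' →
      SP {δ | γ ++ δ ∈ g.T} s' [] (inducedPlay s') := by
    intro γ hγ s' hs'
    exact playOf_SP (hsubT γ) hs' (by simpa using hγ)
  have hind : ∀ γ ∈ g.T, listExtend γ (inducedPlay (subProfile γ s)) = playOf s γ := by
    intro γ hγ
    have h1 := hplay γ hγ _ (sub_isProfile hs)
    refine SP.unique (T := g.T) (s := s) (γ := γ) ⟨sub_body hT h1.body, pp_listExtend0 _ _, ?_⟩
      (playOf_SP hT hs hγ) (fun _ _ _ => rfl)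
    intro m hm
    obtain ⟨k, rfl⟩ := Nat.exists_eq_add_of_le hm
    rw [Nat.add_assoc, pp_listExtend, pp_listExtend, h1.fol k (Nat.zero_le _)]
    exact sub_profile hs (h1.body k)
  have hout : ∀ γ ∈ g.T, (g.sub γ).v (inducedPlay (subProfile γ s)) = g.v (playOf s γ) := by
    intro γ hγ
    rw [← hind γ hγ]
    rfl
  refine ⟨?_, ?_⟩
  · rintro γ hγ ⟨a, s', hs', hdev, hpref⟩
    rw [hout γ hγ] at hpref
    have h1 := hplay γ hγ s' hs'
    have hb : listExtend γ (inducedPlay s') ∈ Body g.T := sub_body hT h1.body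
    have ht := pp_listExtend0 γ (inducedPlay s')
    have hfol : ∀ i, i ≠ a → Follows g.d i s γ.length (listExtend γ (inducedPlay s')) := by
      intro i hi m hm hd
      obtain ⟨k, rfl⟩ := Nat.exists_eq_add_of_le hm
      rw [Nat.add_assoc, pp_listExtend]
      rw [pp_listExtend] at hd ⊢
      rw [h1.fol k (Nat.zero_le _)]
      have hk := h1.body k
      have e : subProfile γ s (playPrefix (inducedPlay s') k) = s' (playPrefix (inducedPlay s') k) := by
        by_contra hne
        have := hdev _ hk hne
        exact hi (hd.symm.trans this)
      rw [← e]
      exact sub_profile hs hk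
    have hpref' : g.pref a (g.v (playOf s γ)) (g.v (listExtend γ (inducedPlay s'))) := hpref
    obtain ⟨g1, g2, g3⟩ := hG γ hγ
    cases a with
    | true =>
      rw [hpa] at hpref'
      obtain ⟨k1, k2⟩ := hpref'
      by_cases h0 : (g.v (playOf s γ)).val = 0
      · exact k1 (Fin.ext (g1 h0 _ hb ht))
      · rcases k2 with k2 | k2
        · exact h0 (by rw [k2]; rfl)
        · have := g2 h0 _ hb ht (hfol false (by simp))
          rcases this with h | h
          · exact k1 (Fin.ext h)
          · have := Fin.lt_def.1 k2
            omega
    | false =>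
      rw [hpb] at hpref'
      have k := Fin.lt_def.1 hpref'
      by_cases h0 : (g.v (playOf s γ)).val = 0
      · have := g1 h0 _ hb ht
        omega
      · have := g3 h0 _ hb ht (hfol true (by simp))
        omega
  · intro γ hγ
    refine ⟨⟨_, (hplay γ hγ _ (sub_isProfile hs)).body, rfl⟩, ?_⟩
    rintro y ⟨q, hq, rfl⟩ a hpref
    have hb : listExtend γ q ∈ Body g.T := sub_body hT hq
    have ht := pp_listExtend0 γ q
    obtain ⟨g1, -, -⟩ := hG γ hγ
    have e : subOutcome g s γ = g.v (playOf s γ) := hout γ hγ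
    rw [e] at hpref ⊢
    change g.pref a _ (g.v (listExtend γ q)) at hpref
    change ∃ b, g.pref b (g.v (listExtend γ q)) _
    by_cases h0 : (g.v (playOf s γ)).val = 0
    · exfalso
      have h1 : g.v (listExtend γ q) = 0 := Fin.ext (g1 h0 _ hb ht)
      have h2 : g.v (playOf s γ) = 0 := Fin.ext h0
      rw [h1, h2] at hpref
      cases a with
      | true => rw [hpa] at hpref; exact hpref.1 rfl
      | false => rw [hpb] at hpref; exact lt_irrefl _ hpref
    · have h0' : g.v (playOf s γ) ≠ 0 := fun h => h0 (by rw [h]; rfl)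
      cases a with
      | true =>
        rw [hpa] at hpref
        refine ⟨false, ?_⟩
        rw [hpb]
        exact hpref.2.resolve_left h0'
      | false =>
        rw [hpb] at hpref
        refine ⟨true, ?_⟩
        rw [hpa]
        exact ⟨h0', Or.inr hpref⟩

theorem main_aux [Countable α] (n : ℕ)
    (g : Game α Bool (Fin (n + 1)))
    (hT : IsTree g.T) (hpr : IsPruned g.T)
    (hpa : g.pref true = prefA n) (hpb : g.pref false = prefB n)
    (hBorel : ∀ x : Fin (n + 1), x ≠ 0 → IsBorelIn g.T {p ∈ Body g.T | g.v p = x})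
    (hy : QuasiDiff g.T {p ∈ Body g.T | g.v p = 0}) :
    ∃ s, IsProfile g.T s ∧ IsGPSPE g s := by
  let v : (ℕ → α) → ℕ := fun p => (g.v p).val
  have hN : ∀ p, v p ≤ n := fun p => Nat.lt_succ_iff.1 (g.v p).isLt
  have hM : ∀ k, @MeasurableSet (ℕ → α) (CylM α) {p | p ∈ Body g.T ∧ v p ≤ k} := by
    intro k
    let _ : MeasurableSpace (ℕ → α) := CylM α
    have e : {p | p ∈ Body g.T ∧ v p ≤ k} =
        Body g.T \ ⋃ x : Fin (n+1), ⋃ (_ : k < x.val), {p ∈ Body g.T | g.v p = x} := by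
      ext p
      constructor
      · rintro ⟨h1, h2⟩
        refine ⟨h1, fun h3 => ?_⟩
        obtain ⟨x, h3⟩ := Set.mem_iUnion.1 h3
        obtain ⟨h4, h5, h6⟩ := Set.mem_iUnion.1 h3
        have : v p = x.val := by simp only [v]; rw [h6]
        omega
      · rintro ⟨h1, h2⟩
        refine ⟨h1, ?_⟩
        by_contra h3
        exact h2 (Set.mem_iUnion.2 ⟨g.v p, Set.mem_iUnion.2 ⟨not_le.1 h3, h1, rfl⟩⟩)
    rw [e]
    refine MeasurableSet.diff meas_body (MeasurableSet.iUnion fun x => MeasurableSet.iUnion fun hx => ?_)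
    refine meas_of_borel (hBorel x ?_)
    rintro rfl
    simp at hx
  have hall : ∀ δ ∈ g.T, Solv g.T g.d v δ := by
    by_contra hno
    push Not at hno
    obtain ⟨δ0, hδ0, hS0⟩ := hno
    let S : Set (List α) := {δ | δ ∈ g.T ∧ ¬ Solv g.T g.d v δ}
    have hS : IsTree S := fun e δ h1 h2 => ⟨hT h1 h2.1, fun h => h2.2 (h.ext h1)⟩
    obtain ⟨γ, hγ, h | h⟩ := qd_delta hy S (fun x hx => hx.1) hS ⟨δ0, hδ0, hS0⟩
    · refine hγ.2 (case2 hpr hT n hN γ (fun p hp hst ht => ?_))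
      have := (h p (fun k => ⟨hp k, hst k⟩) ht).2
      simp only [v]; rw [this]; rfl
    · refine hγ.2 (case1 hpr hT n hN hM γ (fun p hp hst ht => ?_))
      intro hv
      exact h p (fun k => ⟨hp k, hst k⟩) ht ⟨hp, Fin.ext hv⟩
  obtain ⟨s, hs, hG⟩ := solv_global (d := g.d) (v := v) hpr hT
  exact ⟨s, hs, gpspe_of_good n g hT hpa hpb s hs (fun γ hγ => hG γ hγ (hall γ hγ))⟩

end final

end BD

/-- a two-player game on a countable pruned tree over a countable alphabet,
with preferences `y <_a x_n <_a ⋯ <_a x_1` and `y <_b x_1 <_b ⋯ <_b x_n`, such that each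
set of plays with outcome `x_i` is Borel and the set of plays with outcome `y` is a
quasi-difference set, has a global-Pareto subgame perfect equilibrium.
Players: `true = a`, `false = b`; outcomes: `0 = y`, `i = x_i`. -/
theorem stmt7 {α : Type*} [Inhabited α] [Countable α] (n : ℕ)
    (g : Game α Bool (Fin (n + 1)))
    (hT : IsTree g.T) (hne : g.T.Nonempty) (hpr : IsPruned g.T) (hTc : g.T.Countable)
    (hpa : g.pref true = prefA n) (hpb : g.pref false = prefB n)
    (hBorel : ∀ x : Fin (n + 1), x ≠ 0 → IsBorelIn g.T {p ∈ Body g.T | g.v p = x})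
    (hy : QuasiDiff g.T {p ∈ Body g.T | g.v p = 0}) :
    ∃ s, IsProfile g.T s ∧ IsGPSPE g s := by
  exact BD.main_aux n g hT hpr hpa hpb hBorel hy
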